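/- arXiv:1202.3463 — 2 statements merged into one kernel-verified Lean document; each statement's English description precedes it below -/
import Mathlib

section
/- For all integers m ≥ 1 and k ≥ 1: under the identification of L_1 ⊗ L_{2k+1} with L_1 ⊗ L'_{2k+1} (the projection L'_{2k+1} → L_{2k+1} being an isomorphism), D'_{2k} is a subgroup of D_{2k}, the recipe sq(sl_{2k}(Z)) = (L'-valued bracket of Z) defines a homomorphism sl_{2k} : D_{2k} → ℤ₂ ⊗ L_{k+1}, sl_{2k} is surjective, and Ker(sl_{2k}) = D'_{2k}; that is, there is a short exact sequence 0 → D'_{2k} → D_{2k} → ℤ₂ ⊗ L_{k+1} → 0. -/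
open scoped TensorProduct

/-- Rooted binary trees (formal non-associative bracket monomials) with
leaves labeled in `Fin m`.  The degree is the number of leaves, the order is
the degree minus one. -/
inductive RTree (m : ℕ) : Type
  | leaf : Fin m → RTree m
  | node : RTree m → RTree m → RTree m

namespace RTree

/-- The degree of a rooted tree = its number of leaves. -/
def deg {m : ℕ} : RTree m → ℕ
  | leaf _ => 1
  | node a b => deg a + deg b

end RTree

/-- One-hole contexts for rooted trees. -/
inductive Ctx (m : ℕ) : Type
  | hole : Ctx m
  | nodeL : Ctx m → RTree m → Ctx m
  | nodeR : RTree m → Ctx m → Ctx m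

/-- Fill the hole of a context with a rooted tree. -/
def Ctx.fill {m : ℕ} : Ctx m → RTree m → RTree m
  | .hole, t => t
  | .nodeL c r, t => RTree.node (c.fill t) r
  | .nodeR l c, t => RTree.node l (c.fill t)

/-- Relators presenting the degree `n` part `L'_n` of the free quasi-Lie ring:
generators of the wrong degree are killed, and antisymmetry and Jacobi
relators are imposed at every position (one-hole context). -/
def quasiLieRels (m n : ℕ) : Set (FreeAbelianGroup (RTree m)) :=
  {x | ∃ J : RTree m, J.deg ≠ n ∧ x = FreeAbelianGroup.of J} ∪
  {x | ∃ (c : Ctx m) (A B : RTree m),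
      x = FreeAbelianGroup.of (c.fill (RTree.node A B)) +
          FreeAbelianGroup.of (c.fill (RTree.node B A))} ∪
  {x | ∃ (c : Ctx m) (A B C : RTree m),
      x = FreeAbelianGroup.of (c.fill (RTree.node A (RTree.node B C))) -
          FreeAbelianGroup.of (c.fill (RTree.node (RTree.node A B) C)) -
          FreeAbelianGroup.of (c.fill (RTree.node B (RTree.node A C)))}

/-- `L'_n`, the degree `n` part of Levine's free quasi-Lie ring on `X_1,…,X_m`. -/
abbrev Lp (m n : ℕ) :=
  FreeAbelianGroup (RTree m) ⧸ AddSubgroup.closure (quasiLieRels m n)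

/-- The canonical projection onto `L'_n`. -/
abbrev LpMk (m n : ℕ) : FreeAbelianGroup (RTree m) →+ Lp m n :=
  QuotientAddGroup.mk' _

/-- Relators for the free Lie ring: additionally kill all squares `[J,J]`
(at every position). -/
def lieRels (m n : ℕ) : Set (FreeAbelianGroup (RTree m)) :=
  quasiLieRels m n ∪
  {x | ∃ (c : Ctx m) (J : RTree m), x = FreeAbelianGroup.of (c.fill (RTree.node J J))}

/-- `L_n`, the degree `n` part of the free Lie ring on `X_1,…,X_m` over `ℤ`. -/
abbrev LL (m n : ℕ) :=
  FreeAbelianGroup (RTree m) ⧸ AddSubgroup.closure (lieRels m n)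

/-- The canonical projection onto `L_n`. -/
abbrev LLMk (m n : ℕ) : FreeAbelianGroup (RTree m) →+ LL m n :=
  QuotientAddGroup.mk' _

/-- The canonical projection `L'_n → L_n`. -/
def LpToLL (m n : ℕ) : Lp m n →+ LL m n :=
  QuotientAddGroup.map _ _ (AddMonoidHom.id _)
    (by
      rw [AddSubgroup.comap_id]
      exact AddSubgroup.closure_mono Set.subset_union_left)

/-- Free-level bracketing `t ↦ [X i, t]` with a degree one generator. -/
def brLeafFree (m : ℕ) (i : Fin m) :
    FreeAbelianGroup (RTree m) →+ FreeAbelianGroup (RTree m) :=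
  FreeAbelianGroup.lift fun t => FreeAbelianGroup.of (RTree.node (RTree.leaf i) t)

theorem brLeafFree_mem_quasi {m n : ℕ} (i : Fin m) {x : FreeAbelianGroup (RTree m)}
    (hx : x ∈ quasiLieRels m n) :
    brLeafFree m i x ∈ AddSubgroup.closure (quasiLieRels m (n + 1)) := by
  apply AddSubgroup.subset_closure
  rcases hx with (⟨J, hJ, rfl⟩ | ⟨c, A, B, rfl⟩) | ⟨c, A, B, C, rfl⟩
  · refine Or.inl (Or.inl ⟨RTree.node (RTree.leaf i) J, ?_, ?_⟩)
    · simp only [RTree.deg]; omega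
    · simp [brLeafFree]
  · refine Or.inl (Or.inr ⟨Ctx.nodeR (RTree.leaf i) c, A, B, ?_⟩)
    simp [brLeafFree, Ctx.fill]
  · refine Or.inr ⟨Ctx.nodeR (RTree.leaf i) c, A, B, C, ?_⟩
    simp [brLeafFree, Ctx.fill]

theorem brLeafFree_closure_quasi {m n : ℕ} (i : Fin m) :
    AddSubgroup.closure (quasiLieRels m n) ≤
      (AddSubgroup.closure (quasiLieRels m (n + 1))).comap (brLeafFree m i) :=
  (AddSubgroup.closure_le _).2 fun _x hx =>
    AddSubgroup.mem_comap.2 (brLeafFree_mem_quasi i hx)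

/-- Bracketing `[X_i, ·] : L'_n → L'_{n+1}` with a degree one generator. -/
def brLeaf (m n : ℕ) (i : Fin m) : Lp m n →+ Lp m (n + 1) :=
  QuotientAddGroup.map _ _ (brLeafFree m i) (brLeafFree_closure_quasi i)

theorem brLeafFree_mem_lie {m n : ℕ} (i : Fin m) {x : FreeAbelianGroup (RTree m)}
    (hx : x ∈ lieRels m n) :
    brLeafFree m i x ∈ AddSubgroup.closure (lieRels m (n + 1)) := by
  apply AddSubgroup.subset_closure
  rcases hx with ((⟨J, hJ, rfl⟩ | ⟨c, A, B, rfl⟩) | ⟨c, A, B, C, rfl⟩) | ⟨c, J, rfl⟩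
  · refine Or.inl (Or.inl (Or.inl ⟨RTree.node (RTree.leaf i) J, ?_, ?_⟩))
    · simp only [RTree.deg]; omega
    · simp [brLeafFree]
  · exact Or.inl (Or.inl (Or.inr ⟨Ctx.nodeR (RTree.leaf i) c, A, B, by
      simp [brLeafFree, Ctx.fill]⟩))
  · exact Or.inl (Or.inr ⟨Ctx.nodeR (RTree.leaf i) c, A, B, C, by
      simp [brLeafFree, Ctx.fill]⟩)
  · exact Or.inr ⟨Ctx.nodeR (RTree.leaf i) c, J, by simp [brLeafFree, Ctx.fill]⟩

theorem brLeafFree_closure_lie {m n : ℕ} (i : Fin m) :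
    AddSubgroup.closure (lieRels m n) ≤
      (AddSubgroup.closure (lieRels m (n + 1))).comap (brLeafFree m i) :=
  (AddSubgroup.closure_le _).2 fun _x hx =>
    AddSubgroup.mem_comap.2 (brLeafFree_mem_lie i hx)

/-- Bracketing `[X_i, ·] : L_n → L_{n+1}` with a degree one generator. -/
def brLeafL (m n : ℕ) (i : Fin m) : LL m n →+ LL m (n + 1) :=
  QuotientAddGroup.map _ _ (brLeafFree m i) (brLeafFree_closure_lie i)

/-- The bracket map `L'_1 ⊗ L'_a → L'_{a+1}`, `X_i ⊗ Y ↦ [X_i, Y]`,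
where `L'_1 = L_1 ≅ ℤ^m` is realized as `FreeAbelianGroup (Fin m)` with basis `X_i`.
The kernel of `bracketLp m (n+1)` is the group `D'_n`. -/
noncomputable def bracketLp (m a : ℕ) :
    (FreeAbelianGroup (Fin m)) ⊗[ℤ] (Lp m a) →ₗ[ℤ] Lp m (a + 1) :=
  TensorProduct.lift
    ((FreeAbelianGroup.lift fun i => (brLeaf m a i).toIntLinearMap).toIntLinearMap)

/-- The bracket map `L_1 ⊗ L_a → L_{a+1}`.  The kernel of `bracketLL m (n+1)` is `D_n`. -/
noncomputable def bracketLL (m a : ℕ) :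
    (FreeAbelianGroup (Fin m)) ⊗[ℤ] (LL m a) →ₗ[ℤ] LL m (a + 1) :=
  TensorProduct.lift
    ((FreeAbelianGroup.lift fun i => (brLeafL m a i).toIntLinearMap).toIntLinearMap)

/-- `id ⊗ proj : L_1 ⊗ L'_n → L_1 ⊗ L_n`. -/
noncomputable def projT (m n : ℕ) :
    (FreeAbelianGroup (Fin m)) ⊗[ℤ] (Lp m n) →ₗ[ℤ]
      (FreeAbelianGroup (Fin m)) ⊗[ℤ] (LL m n) :=
  LinearMap.lTensor _ (LpToLL m n).toIntLinearMap

/-- Given a rooted tree `t` and a rooted tree `rest` (representing the rest of the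
unrooted tree `⟨t, rest⟩` hanging off the root edge of `t`), list, for each leaf `v`
of `t`, the label of `v` together with the rooted tree obtained from the unrooted
tree `⟨t, rest⟩` by making `v` the root. -/
def rerootList {m : ℕ} : RTree m → RTree m → List (Fin m × RTree m)
  | RTree.leaf i, rest => [(i, rest)]
  | RTree.node a b, rest =>
      rerootList a (RTree.node b rest) ++ rerootList b (RTree.node rest a)

/-- All univalent vertices of the unrooted tree `⟨p.1, p.2⟩`, together with the
corresponding rerooted trees. -/
def pairReroots {m : ℕ} (p : RTree m × RTree m) : List (Fin m × RTree m) :=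
  rerootList p.1 p.2 ++ rerootList p.2 p.1

/-- Relators presenting the order `n` tree group `𝒯_n`.  An unrooted unitrivalent
labeled vertex-oriented tree is presented as the inner product `⟨I,J⟩` of a pair of
rooted trees (cutting an edge); generators of the wrong order are killed, and we
impose: symmetry `⟨I,J⟩ = ⟨J,I⟩`, edge-sliding `⟨(A,B),C⟩ = ⟨A,(B,C)⟩` (both of
which express that the pair presents the same unrooted tree), antisymmetry (AS),
and Jacobi (IHX) relations. -/
def treeRels (m n : ℕ) : Set (FreeAbelianGroup (RTree m × RTree m)) :=
  {x | ∃ p : RTree m × RTree m, p.1.deg + p.2.deg ≠ n + 2 ∧ x = FreeAbelianGroup.of p} ∪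
  {x | ∃ I J : RTree m, x = FreeAbelianGroup.of (I, J) - FreeAbelianGroup.of (J, I)} ∪
  {x | ∃ A B C : RTree m,
      x = FreeAbelianGroup.of (RTree.node A B, C) - FreeAbelianGroup.of (A, RTree.node B C)} ∪
  {x | ∃ A B C : RTree m,
      x = FreeAbelianGroup.of (RTree.node A B, C) + FreeAbelianGroup.of (RTree.node B A, C)} ∪
  {x | ∃ A B C D : RTree m,
      x = FreeAbelianGroup.of (RTree.node A (RTree.node B C), D)
        - FreeAbelianGroup.of (RTree.node (RTree.node A B) C, D)
        - FreeAbelianGroup.of (RTree.node B (RTree.node A C), D)}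

/-- `𝒯_n`, the order `n` tree group. -/
abbrev Tgrp (m n : ℕ) :=
  FreeAbelianGroup (RTree m × RTree m) ⧸ AddSubgroup.closure (treeRels m n)

/-- The canonical projection onto `𝒯_n`; the generator `⟨I,J⟩` is `TMk m n (.of (I,J))`. -/
abbrev TMk (m n : ℕ) : FreeAbelianGroup (RTree m × RTree m) →+ Tgrp m n :=
  QuotientAddGroup.mk' _

/-- The boundary-twist relators `⟨(i,J),J⟩` (for `J` of order `k-1`, i.e. degree `k`). -/
def btRels (m k : ℕ) : Set (FreeAbelianGroup (RTree m × RTree m)) :=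
  {x | ∃ (i : Fin m) (J : RTree m), J.deg = k ∧
      x = FreeAbelianGroup.of (RTree.node (RTree.leaf i) J, J)}

/-- `𝒯^∞_{2k-1}`, the quotient of `𝒯_{2k-1}` by the boundary-twist relations. -/
abbrev Tinfodd (m k : ℕ) :=
  FreeAbelianGroup (RTree m × RTree m) ⧸
    AddSubgroup.closure (treeRels m (2 * k - 1) ∪ btRels m k)

abbrev TinfoddMk (m k : ℕ) : FreeAbelianGroup (RTree m × RTree m) →+ Tinfodd m k :=
  QuotientAddGroup.mk' _

/-- Relators presenting `𝒯^∞_{2k}`: generators are order `2k` unrooted trees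
(`Sum.inl` of a pair of rooted trees, as in `treeRels`) together with `∞`-trees
`J^∞` (`Sum.inr J`) for rooted trees `J` of order `k` (degree `k+1`).  Relations:
the relations of `𝒯_{2k}` among the non-`∞` trees, wrong-degree `∞`-generators are
killed, the symmetry relations `(-J)^∞ = J^∞`, the twisted IHX relations
`I^∞ = H^∞ + X^∞ - ⟨H,X⟩`, and the interior-twist relations `2 J^∞ = ⟨J,J⟩`. -/
def tinfRels (m k : ℕ) : Set (FreeAbelianGroup ((RTree m × RTree m) ⊕ RTree m)) :=
  (⇑(FreeAbelianGroup.map (Sum.inl : RTree m × RTree m → (RTree m × RTree m) ⊕ RTree m)) ''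
      treeRels m (2 * k)) ∪
  {x | ∃ J : RTree m, J.deg ≠ k + 1 ∧ x = FreeAbelianGroup.of (Sum.inr J)} ∪
  {x | ∃ (c : Ctx m) (A B : RTree m),
      x = FreeAbelianGroup.of (Sum.inr (c.fill (RTree.node A B)))
        - FreeAbelianGroup.of (Sum.inr (c.fill (RTree.node B A)))} ∪
  {x | ∃ (c : Ctx m) (A B C : RTree m),
      x = FreeAbelianGroup.of (Sum.inr (c.fill (RTree.node A (RTree.node B C))))
        - FreeAbelianGroup.of (Sum.inr (c.fill (RTree.node (RTree.node A B) C)))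
        - FreeAbelianGroup.of (Sum.inr (c.fill (RTree.node B (RTree.node A C))))
        + FreeAbelianGroup.of (Sum.inl (c.fill (RTree.node (RTree.node A B) C),
            c.fill (RTree.node B (RTree.node A C))))} ∪
  {x | ∃ J : RTree m,
      x = FreeAbelianGroup.of (Sum.inr J) + FreeAbelianGroup.of (Sum.inr J)
        - FreeAbelianGroup.of (Sum.inl (J, J))}

/-- `𝒯^∞_{2k}`, the twisted tree group in even order `2k`. -/
abbrev Tinf (m k : ℕ) :=
  FreeAbelianGroup ((RTree m × RTree m) ⊕ RTree m) ⧸ AddSubgroup.closure (tinfRels m k)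

abbrev TinfMk (m k : ℕ) :
    FreeAbelianGroup ((RTree m × RTree m) ⊕ RTree m) →+ Tinf m k :=
  QuotientAddGroup.mk' _

/-- The degree-guarded free-level bracket: for `s, t` rooted trees,
`brFree m a b (of s) (of t) = of [s,t]` if `s` has degree `a` and `t` degree `b`,
and `0` otherwise.  It induces the bracket `L'_a × L'_b → L'_{a+b}`. -/
def brFree (m a b : ℕ) :
    FreeAbelianGroup (RTree m) →+
      FreeAbelianGroup (RTree m) →+ FreeAbelianGroup (RTree m) :=
  FreeAbelianGroup.lift fun s =>
    FreeAbelianGroup.lift fun t =>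
      if s.deg = a ∧ t.deg = b then FreeAbelianGroup.of (RTree.node s t) else 0

section FreeLieEmbedding

attribute [local instance] LieRing.ofAssociativeRing

variable {R A : Type} [CommRing R]

/-- Bracket monomials of a free Lie algebra on weighted generators, with their weight. -/
inductive IsLieMonomial (R : Type) [CommRing R] {A : Type} (wt : A → ℕ) :
    ℕ → FreeLieAlgebra R A → Prop
  | of (a : A) : IsLieMonomial R wt (wt a) (FreeLieAlgebra.of R a)
  | lie {p q : ℕ} {u v : FreeLieAlgebra R A} :
      IsLieMonomial R wt p u → IsLieMonomial R wt q v → IsLieMonomial R wt (p + q) ⁅u, v⁆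

/-- The homogeneous component of weight `n` of a free Lie algebra on weighted generators. -/
noncomputable def weightSpan (R : Type) [CommRing R] {A : Type} (wt : A → ℕ) (n : ℕ) :
    Submodule R (FreeLieAlgebra R A) :=
  Submodule.span R {y | IsLieMonomial R wt n y}

/-- The canonical Lie homomorphism from the free Lie algebra to the free associative algebra. -/
noncomputable def freeLieToFreeAlgebra (R A : Type) [CommRing R] :
    FreeLieAlgebra R A →ₗ⁅R⁆ FreeAlgebra R A :=
  FreeLieAlgebra.lift R (FreeAlgebra.ι R)

theorem lie_mem_weightSpan {wt : A → ℕ} {p q : ℕ} {u v : FreeLieAlgebra R A}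
    (hu : u ∈ weightSpan R wt p) (hv : v ∈ weightSpan R wt q) :
    ⁅u, v⁆ ∈ weightSpan R wt (p + q) := by
  induction hu using Submodule.span_induction with
  | mem u hu =>
    induction hv using Submodule.span_induction with
    | mem v hv => exact Submodule.subset_span (IsLieMonomial.lie hu hv)
    | zero => simp
    | add x y _ _ hx hy => rw [lie_add]; exact add_mem hx hy
    | smul r x _ hx => rw [lie_smul]; exact Submodule.smul_mem _ r hx
  | zero => simp
  | add x y _ _ hx hy => rw [add_lie]; exact add_mem hx hy
  | smul r x _ hx => rw [smul_lie]; exact Submodule.smul_mem _ r hx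

/-- The generators left after eliminating `x`: the letter `(n, b)` stands for `(ad x)^n b`. -/
abbrev ElimLetters (x : A) : Type := ℕ × {a : A // a ≠ x}

/-- The weight of `(ad x)^n b`. -/
def elimWeight (wt : A → ℕ) (x : A) (l : ElimLetters x) : ℕ := l.1 * wt x + wt l.2

/-- The letter `(n, b)` read as the Lie element `(ad x)^n b`. -/
noncomputable def elimLetter (R : Type) [CommRing R] (x : A) : ElimLetters x → FreeLieAlgebra R A
  | (0, b) => FreeLieAlgebra.of R b.1
  | (n + 1, b) => ⁅FreeLieAlgebra.of R x, elimLetter R x (n, b)⁆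

/-- The Lie homomorphism from the free Lie algebra on the eliminated letters. -/
noncomputable def elimHom (R : Type) [CommRing R] (x : A) :
    FreeLieAlgebra R (ElimLetters x) →ₗ⁅R⁆ FreeLieAlgebra R A :=
  FreeLieAlgebra.lift R (elimLetter R x)

theorem lie_elimHom_mem {wt : A → ℕ} (x : A) {p : ℕ} {z : FreeLieAlgebra R (ElimLetters x)}
    (hz : z ∈ weightSpan R (elimWeight wt x) p) :
    ∃ w ∈ weightSpan R (elimWeight wt x) (wt x + p),
      ⁅FreeLieAlgebra.of R x, elimHom R x z⁆ = elimHom R x w := by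
  induction hz using Submodule.span_induction with
  | mem z hz =>
    induction hz with
    | of l =>
      obtain ⟨n, b⟩ := l
      refine ⟨FreeLieAlgebra.of R (n + 1, b), ?_, ?_⟩
      · have : wt x + elimWeight wt x (n, b) = elimWeight wt x (n + 1, b) := by
          simp only [elimWeight]; ring
        rw [this]
        exact Submodule.subset_span (IsLieMonomial.of _)
      · simp [elimHom, elimLetter]
    | @lie p q u v hu hv ihu ihv =>
      obtain ⟨u', hu', eu⟩ := ihu
      obtain ⟨v', hv', ev⟩ := ihv
      refine ⟨⁅u', v⁆ + ⁅u, v'⁆, add_mem ?_ ?_, ?_⟩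
      · rw [← add_assoc]
        exact lie_mem_weightSpan hu' (Submodule.subset_span hv)
      · rw [add_left_comm]
        exact lie_mem_weightSpan (Submodule.subset_span hu) hv'
      · rw [LieHom.map_lie, leibniz_lie, eu, ev, map_add, LieHom.map_lie, LieHom.map_lie]
  | zero => exact ⟨0, zero_mem _, by simp⟩
  | add y z _ _ hy hz =>
    obtain ⟨y', hy', ey⟩ := hy
    obtain ⟨z', hz', ez⟩ := hz
    exact ⟨y' + z', add_mem hy' hz', by rw [map_add, lie_add, ey, ez, map_add]⟩
  | smul r y _ hy =>
    obtain ⟨y', hy', ey⟩ := hy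
    exact ⟨r • y', Submodule.smul_mem _ r hy', by rw [map_smul, lie_smul, ey, map_smul]⟩

theorem IsLieMonomial.eq_or_exists_elimHom {wt : A → ℕ} (x : A) {p : ℕ}
    {y : FreeLieAlgebra R A} (hy : IsLieMonomial R wt p y) :
    (y = FreeLieAlgebra.of R x ∧ p = wt x) ∨
      ∃ z ∈ weightSpan R (elimWeight wt x) p, y = elimHom R x z := by
  induction hy with
  | of a =>
    by_cases h : a = x
    · exact Or.inl ⟨by rw [h], by rw [h]⟩
    · refine Or.inr ⟨FreeLieAlgebra.of R (0, ⟨a, h⟩), ?_, ?_⟩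
      · have : wt a = elimWeight wt x (0, ⟨a, h⟩) := by simp [elimWeight]
        rw [this]
        exact Submodule.subset_span (IsLieMonomial.of _)
      · simp [elimHom, elimLetter]
  | @lie p q u v hu hv ihu ihv =>
    right
    rcases ihu with ⟨rfl, rfl⟩ | ⟨z, hz, rfl⟩
    · rcases ihv with ⟨rfl, rfl⟩ | ⟨z', hz', rfl⟩
      · exact ⟨0, zero_mem _, by simp⟩
      · obtain ⟨w, hw, e⟩ := lie_elimHom_mem x hz'
        exact ⟨w, hw, e⟩
    · rcases ihv with ⟨rfl, rfl⟩ | ⟨z', hz', rfl⟩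
      · obtain ⟨w, hw, e⟩ := lie_elimHom_mem x hz
        refine ⟨-w, neg_mem (by rwa [add_comm]), ?_⟩
        rw [← lie_skew, e, map_neg]
      · exact ⟨⁅z, z'⁆, lie_mem_weightSpan hz hz', by rw [LieHom.map_lie]⟩

theorem exists_eq_smul_add_elimHom {wt : A → ℕ} (x : A) {n : ℕ} {y : FreeLieAlgebra R A}
    (hy : y ∈ weightSpan R wt n) :
    ∃ (c : R), ∃ z ∈ weightSpan R (elimWeight wt x) n,
      y = c • FreeLieAlgebra.of R x + elimHom R x z := by
  induction hy using Submodule.span_induction with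
  | mem y hy =>
    rcases hy.eq_or_exists_elimHom x with ⟨rfl, -⟩ | ⟨z, hz, rfl⟩
    · exact ⟨1, 0, zero_mem _, by simp⟩
    · exact ⟨0, z, hz, by simp⟩
  | zero => exact ⟨0, 0, zero_mem _, by simp⟩
  | add y y' _ _ hy hy' =>
    obtain ⟨c, z, hz, rfl⟩ := hy
    obtain ⟨c', z', hz', rfl⟩ := hy'
    exact ⟨c + c', z + z', add_mem hz hz', by rw [map_add, add_smul]; abel⟩
  | smul r y _ hy =>
    obtain ⟨c, z, hz, rfl⟩ := hy
    exact ⟨r * c, r • z, Submodule.smul_mem _ r hz, by rw [map_smul, smul_add, mul_smul]⟩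

/-- The algebra homomorphism `w ↦ w + ε D w` where `D` is the derivation raising `(n, b)` to
`(n + 1, b)`. -/
noncomputable def shiftDual (R : Type) [CommRing R] (x : A) :
    FreeAlgebra R (ElimLetters x) →ₐ[R] DualNumber (FreeAlgebra R (ElimLetters x)) :=
  FreeAlgebra.lift R fun l =>
    TrivSqZeroExt.inl (FreeAlgebra.ι R l) + TrivSqZeroExt.inr (FreeAlgebra.ι R (l.1 + 1, l.2))

theorem fst_shiftDual (x : A) (w : FreeAlgebra R (ElimLetters x)) :
    (shiftDual R x w).fst = w := by
  have : (TrivSqZeroExt.fstHom R _ _).comp (shiftDual R x) = AlgHom.id R _ := by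
    ext l
    simp [shiftDual]
  exact DFunLike.congr_fun this w

/-- The derivation raising `(n, b)` to `(n + 1, b)`, as a linear map. -/
noncomputable def shiftDer (R : Type) [CommRing R] (x : A) :
    Module.End R (FreeAlgebra R (ElimLetters x)) :=
  (TrivSqZeroExt.sndHom (FreeAlgebra R (ElimLetters x))
      (FreeAlgebra R (ElimLetters x))).restrictScalars R ∘ₗ
    (shiftDual R x).toLinearMap

theorem shiftDer_mul (x : A) (u v : FreeAlgebra R (ElimLetters x)) :
    shiftDer R x (u * v) = shiftDer R x u * v + u * shiftDer R x v := by
  simp [shiftDer, fst_shiftDual, add_comm]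

theorem shiftDer_one (x : A) : shiftDer R x 1 = 0 := by
  simp [shiftDer]

theorem shiftDer_ι (x : A) (l : ElimLetters x) :
    shiftDer R x (FreeAlgebra.ι R l) = FreeAlgebra.ι R (l.1 + 1, l.2) := by
  simp [shiftDer, shiftDual]

open Classical in
/-- The action of the free algebra on the free algebra of eliminated letters: `x` acts by the
shift derivation and the other letters by left multiplication. -/
noncomputable def elimAction (R : Type) [CommRing R] (x : A) :
    FreeAlgebra R A →ₐ[R] Module.End R (FreeAlgebra R (ElimLetters x)) :=
  FreeAlgebra.lift R fun a =>
    if h : a = x then shiftDer R x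
    else Algebra.lmul R _ (FreeAlgebra.ι R ((0, ⟨a, h⟩) : ElimLetters x))

theorem elimAction_elimLetter (x : A) (l : ElimLetters x) :
    elimAction R x (freeLieToFreeAlgebra R A (elimLetter R x l)) =
      Algebra.lmul R _ (FreeAlgebra.ι R l) := by
  obtain ⟨n, b⟩ := l
  induction n with
  | zero => simp [elimLetter, freeLieToFreeAlgebra, elimAction, b.2]
  | succ n ih =>
    rw [elimLetter, LieHom.map_lie, LieRing.of_associative_ring_bracket, map_sub, map_mul,
      map_mul, ih]
    ext1 w
    simp [freeLieToFreeAlgebra, elimAction, shiftDer_mul, shiftDer_ι]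

theorem elimAction_elimHom (x : A) (z : FreeLieAlgebra R (ElimLetters x)) :
    elimAction R x (freeLieToFreeAlgebra R A (elimHom R x z)) =
      Algebra.lmul R _ (freeLieToFreeAlgebra R _ z) := by
  have : ((elimAction R x).toLieHom.comp (freeLieToFreeAlgebra R A)).comp (elimHom R x) =
      (Algebra.lmul R (FreeAlgebra R (ElimLetters x))).toLieHom.comp
        (freeLieToFreeAlgebra R _) := by
    ext1 l
    have h := elimAction_elimLetter (R := R) x l
    simpa [elimHom, freeLieToFreeAlgebra] using h
  exact DFunLike.congr_fun this z

theorem eq_zero_of_forall_elim [Nontrivial R] {wt : A → ℕ} (x : A) {n : ℕ}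
    (ih : ∀ z ∈ weightSpan R (elimWeight wt x) n, freeLieToFreeAlgebra R _ z = 0 → z = 0)
    {y : FreeLieAlgebra R A} (hy : y ∈ weightSpan R wt n)
    (h0 : freeLieToFreeAlgebra R A y = 0) : y = 0 := by
  obtain ⟨c, z, hz, rfl⟩ := exists_eq_smul_add_elimHom x hy
  have hz0 : z = 0 := by
    apply ih z hz
    have h1 := congrArg (fun f => elimAction R x f 1) h0
    simp only [map_add, map_smul, map_zero, elimAction_elimHom] at h1
    simpa [freeLieToFreeAlgebra, elimAction, shiftDer_one] using h1
  subst hz0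
  have hc : c = 0 := by
    have h1 := congrArg (FreeAlgebra.lift R (fun _ => (1 : R))) h0
    simpa [freeLieToFreeAlgebra] using h1
  simp [hc]

theorem IsLieMonomial.exists_weight_le {wt : A → ℕ} {n : ℕ} {y : FreeLieAlgebra R A}
    (hy : IsLieMonomial R wt n y) : ∃ a, wt a ≤ n := by
  induction hy with
  | of a => exact ⟨a, le_rfl⟩
  | lie _ _ ihu _ => obtain ⟨a, ha⟩ := ihu; exact ⟨a, by omega⟩

theorem freeLieToFreeAlgebra_eq_zero_aux [Nontrivial R] (n d : ℕ) :
    ∀ (c : ℕ) (A : Type) (wt : A → ℕ), (∀ a, 1 ≤ wt a) → (∀ a, n < wt a + d) →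
      {a | wt a ≤ n}.Finite → {a | wt a + d = n + 1 ∧ wt a ≤ n}.ncard = c →
      ∀ y ∈ weightSpan R wt n, freeLieToFreeAlgebra R A y = 0 → y = 0 := by
  induction d with
  | zero =>
    intro c A wt _ hn _ _ y hy _
    have : {y | IsLieMonomial R wt n y} = ∅ := by
      ext y
      simp only [Set.mem_ofPred_eq, Set.mem_empty_iff_false, iff_false]
      intro hy
      obtain ⟨a, ha⟩ := hy.exists_weight_le
      have := hn a
      omega
    rw [weightSpan, this, Submodule.span_empty] at hy
    exact hy
  | succ d ihd =>
    intro c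
    induction c with
    | zero =>
      intro A wt h1 hn hfin hc y hy h0
      refine ihd _ A wt h1 (fun a => ?_) hfin rfl y hy h0
      rw [Set.ncard_eq_zero (hfin.subset fun a ha => ha.2)] at hc
      by_contra hcon
      have ha : a ∈ {a | wt a + (d + 1) = n + 1 ∧ wt a ≤ n} :=
        ⟨by have := hn a; omega, by omega⟩
      rw [hc] at ha
      exact ha
    | succ c ihc =>
      intro A wt h1 hn hfin hc y hy h0
      obtain ⟨x, hx⟩ : {a | wt a + (d + 1) = n + 1 ∧ wt a ≤ n}.Nonempty :=
        Set.nonempty_of_ncard_ne_zero (by omega)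
      have hle : ∀ l : ElimLetters x, l.1 + wt l.2 ≤ elimWeight wt x l := fun l =>
        Nat.add_le_add_right (Nat.le_mul_of_pos_right _ (h1 x)) _
      refine eq_zero_of_forall_elim x (ihc (ElimLetters x) (elimWeight wt x) (fun l => ?_)
        (fun l => ?_) ?_ ?_) hy h0
      · have := hle l; have := h1 l.2; omega
      · have := hle l; have := hn l.2; omega
      · refine ((Set.finite_Iic n).prod
          (hfin.preimage Subtype.val_injective.injOn)).subset fun l hl => ?_
        have h2 := hle l
        have h3 : elimWeight wt x l ≤ n := hl
        exact ⟨Set.mem_Iic.2 (by omega), show wt l.2 ≤ n by omega⟩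
      · set S := {l | elimWeight wt x l + (d + 1) = n + 1 ∧ elimWeight wt x l ≤ n}
        have hS : ∀ l ∈ S, l.1 = 0 := fun l hl => by
          have := hle l; have := hn l.2; have := hl.1; omega
        have him : (fun l : ElimLetters x => (l.2 : A)) '' S =
            {a | wt a + (d + 1) = n + 1 ∧ wt a ≤ n} \ {x} := by
          ext a
          constructor
          · rintro ⟨⟨i, b⟩, hl, rfl⟩
            obtain rfl : i = 0 := hS _ hl
            have h2 : elimWeight wt x (0, b) = wt b := by simp [elimWeight]
            exact ⟨⟨h2 ▸ hl.1, h2 ▸ hl.2⟩, b.2⟩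
          · rintro ⟨ha, hax⟩
            have h2 : elimWeight wt x (0, ⟨a, hax⟩) = wt a := by simp [elimWeight]
            exact ⟨(0, ⟨a, hax⟩), ⟨h2.symm ▸ ha.1, h2.symm ▸ ha.2⟩, rfl⟩
        have hinj : Set.InjOn (fun l : ElimLetters x => (l.2 : A)) S := fun l hl l' hl' e =>
          Prod.ext ((hS l hl).trans (hS l' hl').symm) (Subtype.ext e)
        rw [← hinj.ncard_image, him, Set.ncard_sdiff_singleton_of_mem hx, hc]
        rfl

/-- A free Lie algebra on finitely many generators embeds, weight by weight, into the free
associative algebra. -/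
theorem freeLieToFreeAlgebra_eq_zero [Nontrivial R] [Finite A] {n : ℕ}
    {y : FreeLieAlgebra R A} (hy : y ∈ weightSpan R (fun _ => 1) n)
    (h0 : freeLieToFreeAlgebra R A y = 0) : y = 0 :=
  freeLieToFreeAlgebra_eq_zero_aux n n _ A _ (fun _ => le_rfl) (fun _ => by omega)
    (Set.toFinite _) rfl y hy h0

end FreeLieEmbedding

section TreeBracket

variable {m : ℕ}

/-- The bilinear extension of grafting `(s, t) ↦ [s, t]`. -/
def treeBr (m : ℕ) :
    FreeAbelianGroup (RTree m) →+ FreeAbelianGroup (RTree m) →+ FreeAbelianGroup (RTree m) :=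
  FreeAbelianGroup.lift fun s => FreeAbelianGroup.lift fun t =>
    FreeAbelianGroup.of (RTree.node s t)

@[simp]
theorem treeBr_of (s t : RTree m) :
    treeBr m (FreeAbelianGroup.of s) (FreeAbelianGroup.of t) =
      FreeAbelianGroup.of (RTree.node s t) := by
  simp [treeBr]

/-- A set of relators is stable under grafting with trees on both sides. -/
def GraftStable (S : Set (FreeAbelianGroup (RTree m))) : Prop :=
  ∀ x ∈ S, ∀ t : RTree m, treeBr m (FreeAbelianGroup.of t) x ∈ S ∧
    treeBr m x (FreeAbelianGroup.of t) ∈ S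

theorem GraftStable.union {S T : Set (FreeAbelianGroup (RTree m))} (hS : GraftStable S)
    (hT : GraftStable T) : GraftStable (S ∪ T) := by
  rintro x (hx | hx) t
  · exact ⟨Or.inl (hS x hx t).1, Or.inl (hS x hx t).2⟩
  · exact ⟨Or.inr (hT x hx t).1, Or.inr (hT x hx t).2⟩

theorem GraftStable.treeBr_mem_left {S : Set (FreeAbelianGroup (RTree m))} (hS : GraftStable S)
    {x : FreeAbelianGroup (RTree m)} (hx : x ∈ AddSubgroup.closure S)
    (y : FreeAbelianGroup (RTree m)) : treeBr m x y ∈ AddSubgroup.closure S := by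
  induction y using FreeAbelianGroup.induction_on with
  | zero => simp
  | of t =>
    induction hx using AddSubgroup.closure_induction with
    | mem x hx => exact AddSubgroup.subset_closure (hS x hx t).2
    | zero => simp
    | add x y _ _ hx hy => simpa using add_mem hx hy
    | neg x _ hx => simpa using hx
  | neg t ht => simpa using ht
  | add y z hy hz => simpa using add_mem hy hz

theorem GraftStable.treeBr_mem_right {S : Set (FreeAbelianGroup (RTree m))} (hS : GraftStable S)
    {x : FreeAbelianGroup (RTree m)} (hx : x ∈ AddSubgroup.closure S)
    (y : FreeAbelianGroup (RTree m)) : treeBr m y x ∈ AddSubgroup.closure S := by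
  induction y using FreeAbelianGroup.induction_on with
  | zero => simp
  | of t =>
    induction hx using AddSubgroup.closure_induction with
    | mem x hx => exact AddSubgroup.subset_closure (hS x hx t).1
    | zero => simp
    | add x y _ _ hx hy => simpa using add_mem hx hy
    | neg x _ hx => simpa using hx
  | neg t ht => simpa using ht
  | add y z hy hz => simpa using add_mem hy hz

/-- The antisymmetry and Jacobi relators at every position, in all degrees at once. -/
def antisymmJacobiRels (m : ℕ) : Set (FreeAbelianGroup (RTree m)) :=
  {x | ∃ (c : Ctx m) (A B : RTree m),
      x = FreeAbelianGroup.of (c.fill (RTree.node A B)) +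
          FreeAbelianGroup.of (c.fill (RTree.node B A))} ∪
  {x | ∃ (c : Ctx m) (A B C : RTree m),
      x = FreeAbelianGroup.of (c.fill (RTree.node A (RTree.node B C))) -
          FreeAbelianGroup.of (c.fill (RTree.node (RTree.node A B) C)) -
          FreeAbelianGroup.of (c.fill (RTree.node B (RTree.node A C)))}

/-- The squares `[J, J]` at every position. -/
def squareRels (m : ℕ) : Set (FreeAbelianGroup (RTree m)) :=
  {x | ∃ (c : Ctx m) (J : RTree m), x = FreeAbelianGroup.of (c.fill (RTree.node J J))}

theorem antisymmJacobiRels_subset (m n : ℕ) : antisymmJacobiRels m ⊆ quasiLieRels m n := by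
  rintro x (hx | hx)
  · exact Or.inl (Or.inr hx)
  · exact Or.inr hx

theorem graftStable_antisymmJacobiRels (m : ℕ) : GraftStable (antisymmJacobiRels m) := by
  rintro x (⟨c, A, B, rfl⟩ | ⟨c, A, B, C, rfl⟩) t
  · exact ⟨Or.inl ⟨Ctx.nodeR t c, A, B, by simp [Ctx.fill]⟩,
      Or.inl ⟨Ctx.nodeL c t, A, B, by simp [Ctx.fill]⟩⟩
  · exact ⟨Or.inr ⟨Ctx.nodeR t c, A, B, C, by simp [Ctx.fill]⟩,
      Or.inr ⟨Ctx.nodeL c t, A, B, C, by simp [Ctx.fill]⟩⟩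

theorem graftStable_squareRels (m : ℕ) : GraftStable (squareRels m) := by
  rintro x ⟨c, J, rfl⟩ t
  exact ⟨⟨Ctx.nodeR t c, J, by simp [Ctx.fill]⟩, ⟨Ctx.nodeL c t, J, by simp [Ctx.fill]⟩⟩

section Vanishing

variable {M : Type*} [AddCommGroup M] {q : FreeAbelianGroup (RTree m) →+ M}

theorem map_treeBr_swap (hq : ∀ x ∈ antisymmJacobiRels m, q x = 0)
    (x y : FreeAbelianGroup (RTree m)) : q (treeBr m x y) = -q (treeBr m y x) := by
  induction x using FreeAbelianGroup.induction_on with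
  | zero => simp
  | of s =>
    induction y using FreeAbelianGroup.induction_on with
    | zero => simp
    | of t =>
      rw [eq_neg_iff_add_eq_zero, ← map_add]
      exact hq _ (Or.inl ⟨Ctx.hole, s, t, by simp [Ctx.fill]⟩)
    | neg t ht => simp only [map_neg, AddMonoidHom.neg_apply, ht]
    | add y z hy hz => simp [hy, hz, add_comm]
  | neg t ht => simp [ht]
  | add y z hy hz => simp [hy, hz, add_comm]

theorem map_treeBr_jacobi (hq : ∀ x ∈ antisymmJacobiRels m, q x = 0)
    (x y z : FreeAbelianGroup (RTree m)) :
    q (treeBr m x (treeBr m y z)) =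
      q (treeBr m (treeBr m x y) z) + q (treeBr m y (treeBr m x z)) := by
  induction x using FreeAbelianGroup.induction_on with
  | zero => simp
  | of s =>
    induction y using FreeAbelianGroup.induction_on with
    | zero => simp
    | of t =>
      induction z using FreeAbelianGroup.induction_on with
      | zero => simp
      | of u =>
        rw [← sub_eq_zero, ← sub_sub, ← map_sub, ← map_sub]
        exact hq _ (Or.inr ⟨Ctx.hole, s, t, u, by simp [Ctx.fill]⟩)
      | neg t ht => simp only [map_neg, ht]; abel
      | add y z hy hz => simp only [map_add, hy, hz]; abel
    | neg t ht => simp [ht, add_comm]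
    | add y z hy hz => simp only [map_add, AddMonoidHom.add_apply, hy, hz]; abel
  | neg t ht => simp [ht, add_comm]
  | add y z hy hz => simp only [map_add, AddMonoidHom.add_apply, hy, hz]; abel

theorem map_treeBr_square_right (hq : ∀ x ∈ antisymmJacobiRels m, q x = 0)
    (x y : FreeAbelianGroup (RTree m)) : q (treeBr m x (treeBr m y y)) = 0 := by
  rw [map_treeBr_jacobi hq, map_treeBr_swap hq (treeBr m x y), neg_add_cancel]

theorem map_treeBr_self (hq : ∀ x ∈ antisymmJacobiRels m, q x = 0)
    (hs : ∀ x ∈ squareRels m, q x = 0) (x : FreeAbelianGroup (RTree m)) :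
    q (treeBr m x x) = 0 := by
  induction x using FreeAbelianGroup.induction_on with
  | zero => simp
  | of t => exact hs _ ⟨Ctx.hole, t, by simp [Ctx.fill]⟩
  | neg t ht => simpa only [map_neg, AddMonoidHom.neg_apply, neg_neg] using ht
  | add x y hx hy =>
    simp only [map_add, AddMonoidHom.add_apply, hx, hy]
    rw [map_treeBr_swap hq y x]
    abel

end Vanishing

theorem of_fill_square_mem (c : Ctx m) (J : RTree m) :
    c = Ctx.hole ∨ FreeAbelianGroup.of (c.fill (RTree.node J J)) ∈
      AddSubgroup.closure (antisymmJacobiRels m) := by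
  have hq : ∀ x ∈ antisymmJacobiRels m,
      QuotientAddGroup.mk' (AddSubgroup.closure (antisymmJacobiRels m)) x = 0 := fun x hx =>
    (QuotientAddGroup.eq_zero_iff x).2 (AddSubgroup.subset_closure hx)
  have hr : ∀ t : RTree m, FreeAbelianGroup.of (RTree.node t (RTree.node J J)) ∈
      AddSubgroup.closure (antisymmJacobiRels m) := fun t => by
    rw [← QuotientAddGroup.eq_zero_iff]
    simpa using map_treeBr_square_right hq (FreeAbelianGroup.of t) (FreeAbelianGroup.of J)
  have hl : ∀ t : RTree m, FreeAbelianGroup.of (RTree.node (RTree.node J J) t) ∈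
      AddSubgroup.closure (antisymmJacobiRels m) := fun t => by
    have h1 := map_treeBr_swap hq (treeBr m (FreeAbelianGroup.of J) (FreeAbelianGroup.of J))
      (FreeAbelianGroup.of t)
    rw [map_treeBr_square_right hq, neg_zero] at h1
    rw [← QuotientAddGroup.eq_zero_iff]
    simpa using h1
  induction c with
  | hole => exact Or.inl rfl
  | nodeL c t ih =>
    right
    rcases ih with rfl | ih
    · exact hl t
    · simpa [Ctx.fill] using
        (graftStable_antisymmJacobiRels m).treeBr_mem_left ih (FreeAbelianGroup.of t)
  | nodeR t c ih =>
    right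
    rcases ih with rfl | ih
    · exact hr t
    · simpa [Ctx.fill] using
        (graftStable_antisymmJacobiRels m).treeBr_mem_right ih (FreeAbelianGroup.of t)

theorem LpMk_eq_zero_of_mem {n : ℕ} {x : FreeAbelianGroup (RTree m)}
    (hx : x ∈ AddSubgroup.closure (antisymmJacobiRels m)) : LpMk m n x = 0 :=
  (QuotientAddGroup.eq_zero_iff x).2
    (AddSubgroup.closure_mono (antisymmJacobiRels_subset m n) hx)

theorem LpMk_eq_zero_of_rel (m n : ℕ) :
    ∀ x ∈ antisymmJacobiRels m, LpMk m n x = 0 := fun _ hx =>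
  LpMk_eq_zero_of_mem (AddSubgroup.subset_closure hx)

theorem LpMk_of_deg_ne {n : ℕ} {t : RTree m} (h : t.deg ≠ n) :
    LpMk m n (FreeAbelianGroup.of t) = 0 :=
  (QuotientAddGroup.eq_zero_iff _).2 (AddSubgroup.subset_closure (Or.inl (Or.inl ⟨t, h, rfl⟩)))

theorem LLMk_of_deg_ne {n : ℕ} {t : RTree m} (h : t.deg ≠ n) :
    LLMk m n (FreeAbelianGroup.of t) = 0 :=
  (QuotientAddGroup.eq_zero_iff _).2
    (AddSubgroup.subset_closure (Or.inl (Or.inl (Or.inl ⟨t, h, rfl⟩))))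

end TreeBracket

section Squaring

variable {m : ℕ}

theorem two_nsmul_LpMk_treeBr_self (n : ℕ) (x : FreeAbelianGroup (RTree m)) :
    2 • LpMk m n (treeBr m x x) = 0 := by
  rw [two_nsmul]
  nth_rewrite 1 [map_treeBr_swap (LpMk_eq_zero_of_rel m n)]
  exact neg_add_cancel _

/-- The squaring map `e ↦ [e, e]` with values in the quasi-Lie ring. -/
def squareFree (m n : ℕ) : FreeAbelianGroup (RTree m) →+ Lp m n :=
  AddMonoidHom.mk' (fun e => LpMk m n (treeBr m e e)) fun x y => by
    simp only [map_add, AddMonoidHom.add_apply]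
    rw [map_treeBr_swap (LpMk_eq_zero_of_rel m n) y x]
    abel

theorem squareFree_apply (n : ℕ) (e : FreeAbelianGroup (RTree m)) :
    squareFree m n e = LpMk m n (treeBr m e e) := rfl

theorem squareFree_eq_zero_of_mem (k : ℕ) :
    AddSubgroup.closure (lieRels m k) ≤ (squareFree m (2 * k)).ker := by
  rw [AddSubgroup.closure_le]
  have h0 : ∀ x ∈ AddSubgroup.closure (antisymmJacobiRels m), squareFree m (2 * k) x = 0 :=
    fun x hx => LpMk_eq_zero_of_mem ((graftStable_antisymmJacobiRels m).treeBr_mem_left hx x)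
  rintro x (((⟨J, hJ, rfl⟩ | hx) | hx) | ⟨c, J, rfl⟩)
  · change squareFree m (2 * k) _ = 0
    rw [squareFree_apply, treeBr_of]
    exact LpMk_of_deg_ne (by simp only [RTree.deg]; omega)
  · exact h0 x (AddSubgroup.subset_closure (Or.inl hx))
  · exact h0 x (AddSubgroup.subset_closure (Or.inr hx))
  · rcases of_fill_square_mem c J with rfl | h
    · change squareFree m (2 * k) _ = 0
      have := map_treeBr_square_right (LpMk_eq_zero_of_rel m (2 * k))
        (FreeAbelianGroup.of (RTree.node J J)) (FreeAbelianGroup.of J)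
      rwa [treeBr_of] at this
    · exact h0 _ h

/-- The squaring map `L_k → L'_{2k}`. -/
def squareLL (m k : ℕ) : LL m k →+ Lp m (2 * k) :=
  QuotientAddGroup.lift _ (squareFree m (2 * k)) (squareFree_eq_zero_of_mem k)

theorem squareLL_LLMk (k : ℕ) (e : FreeAbelianGroup (RTree m)) :
    squareLL m k (LLMk m k e) = LpMk m (2 * k) (treeBr m e e) := rfl

theorem two_zsmul_squareLL (m k : ℕ) : (2 : ℤ) • squareLL m k = 0 := by
  ext e
  exact (ofNat_zsmul _ 2).trans
    (two_nsmul_LpMk_treeBr_self (2 * k) (FreeAbelianGroup.of e))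

/-- The homomorphism `ℤ₂ → Hom(L_k, L'_{2k})` sending `1` to the squaring map. -/
def squareScalar (m k : ℕ) : ZMod 2 →+ LL m k →+ Lp m (2 * k) :=
  ZMod.lift 2 ⟨zmultiplesHom _ (squareLL m k), two_zsmul_squareLL m k⟩

theorem squareScalar_one (m k : ℕ) : squareScalar m k 1 = squareLL m k := by
  have h := ZMod.lift_coe 2 ⟨zmultiplesHom _ (squareLL m k), two_zsmul_squareLL m k⟩ 1
  rw [Int.cast_one] at h
  exact h.trans (one_zsmul _)

/-- The squaring map `ℤ₂ ⊗ L_k → L'_{2k}`, `1 ⊗ Y ↦ [Y, Y]`. -/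
noncomputable def squareTensor (m k : ℕ) : (ZMod 2) ⊗[ℤ] (LL m k) →+ Lp m (2 * k) :=
  TensorProduct.liftAddHom (squareScalar m k)
    (fun r a y => by rw [map_zsmul, map_zsmul, AddMonoidHom.smul_apply])

theorem squareTensor_one_tmul (k : ℕ) (y : LL m k) :
    squareTensor m k ((1 : ZMod 2) ⊗ₜ[ℤ] y) = squareLL m k y := by
  rw [squareTensor, TensorProduct.liftAddHom_tmul, squareScalar_one]

theorem exists_eq_one_tmul {M : Type*} [AddCommGroup M] (y : (ZMod 2) ⊗[ℤ] M) :
    ∃ z : M, y = (1 : ZMod 2) ⊗ₜ[ℤ] z := by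
  induction y using TensorProduct.induction_on with
  | zero => exact ⟨0, by simp⟩
  | tmul a z =>
    refine ⟨(a.val : ℤ) • z, ?_⟩
    rw [← TensorProduct.smul_tmul]
    simp
  | add x y hx hy =>
    obtain ⟨x, rfl⟩ := hx
    obtain ⟨y, rfl⟩ := hy
    exact ⟨x + y, by rw [TensorProduct.tmul_add]⟩

end Squaring

section SquareInvariant

attribute [local instance] LieRing.ofAssociativeRing

variable {m : ℕ}

theorem Ctx.deg_fill_congr (c : Ctx m) {s t : RTree m} (h : s.deg = t.deg) :
    (c.fill s).deg = (c.fill t).deg := by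
  induction c with
  | hole => exact h
  | nodeL c r ih => simp only [Ctx.fill, RTree.deg, ih]
  | nodeR r c ih => simp only [Ctx.fill, RTree.deg, ih]

/-- Polynomials over `ℤ₂` with one variable for every word in the labels. -/
abbrev WordPoly (m : ℕ) : Type := MvPolynomial (FreeMonoid (Fin m)) (ZMod 2)

/-- Triples `(D, δ, σ)` of a derivation of the word polynomials and two word polynomials. -/
abbrev SquareTriple (m : ℕ) : Type :=
  Derivation (ZMod 2) (WordPoly m) (WordPoly m) × WordPoly m × WordPoly m

/-- A quasi-Lie bracket on triples, in which the square of `(D, δ, σ)` is `(0, 0, δ ^ 2)`. -/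
noncomputable def tripleBr (m : ℕ) : SquareTriple m →+ SquareTriple m →+ SquareTriple m :=
  AddMonoidHom.mk' (fun x => AddMonoidHom.mk' (fun y =>
      (⁅x.1, y.1⁆, x.1 y.2.1 - y.1 x.2.1, x.1 y.2.2 - y.1 x.2.2 + x.2.1 * y.2.1))
      fun y z => by
        ext1
        · ext1 p
          simp only [Prod.fst_add, Derivation.commutator_apply, Derivation.add_apply, map_add]
          ring
        · ext1
          · simp only [Prod.fst_add, Prod.snd_add, map_add, Derivation.add_apply]; ring
          · simp only [Prod.fst_add, Prod.snd_add, map_add, Derivation.add_apply]; ring)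
    fun x y => by
      ext1 z
      ext1
      · ext1 p
        simp only [AddMonoidHom.mk'_apply, AddMonoidHom.add_apply, Prod.fst_add,
          Derivation.commutator_apply, Derivation.add_apply, map_add]
        ring
      · ext1
        · simp only [AddMonoidHom.mk'_apply, AddMonoidHom.add_apply, Prod.fst_add, Prod.snd_add,
            map_add, Derivation.add_apply]
          ring
        · simp only [AddMonoidHom.mk'_apply, AddMonoidHom.add_apply, Prod.fst_add, Prod.snd_add,
            map_add, Derivation.add_apply]
          ring

theorem tripleBr_apply (x y : SquareTriple m) : tripleBr m x y =
    (⁅x.1, y.1⁆, x.1 y.2.1 - y.1 x.2.1, x.1 y.2.2 - y.1 x.2.2 + x.2.1 * y.2.1) := rfl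

theorem tripleBr_self (x : SquareTriple m) : (tripleBr m x x).2.2 = x.2.1 * x.2.1 := by
  simp [tripleBr_apply]

theorem tripleBr_add_swap (x y : SquareTriple m) : tripleBr m x y + tripleBr m y x = 0 := by
  have h2 : (2 : WordPoly m) = 0 := CharTwo.two_eq_zero
  ext1
  · simp only [tripleBr_apply, Prod.fst_add, Prod.fst_zero]
    rw [← lie_skew x.1 y.1, neg_add_cancel]
  · ext1
    · simp [tripleBr_apply]
    · simp only [tripleBr_apply, Prod.snd_add, Prod.snd_zero]
      linear_combination x.2.1 * y.2.1 * h2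

theorem tripleBr_jacobi (x y z : SquareTriple m) :
    tripleBr m x (tripleBr m y z) - tripleBr m (tripleBr m x y) z -
      tripleBr m y (tripleBr m x z) = 0 := by
  have h2 : (2 : WordPoly m) = 0 := CharTwo.two_eq_zero
  ext1
  · simp only [tripleBr_apply, Prod.fst_sub, Prod.fst_zero]
    ext1 p
    simp only [Derivation.sub_apply, Derivation.commutator_apply, Derivation.zero_apply, map_sub]
    ring
  · ext1
    · simp only [tripleBr_apply, Prod.fst_sub, Prod.snd_sub, Prod.fst_zero, Prod.snd_zero,
        Derivation.commutator_apply, map_sub]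
      ring
    · simp only [tripleBr_apply, Prod.snd_sub, Prod.snd_zero,
        Derivation.commutator_apply, map_sub, map_add, Derivation.leibniz, smul_eq_mul]
      linear_combination y.2.1 * z.1 x.2.1 * h2

/-- The value of a rooted tree in the triples. -/
noncomputable def treeTriple : RTree m → SquareTriple m
  | .leaf i => (MvPolynomial.mkDerivation (ZMod 2) fun w => MvPolynomial.X (FreeMonoid.of i * w),
      MvPolynomial.X (FreeMonoid.of i), 0)
  | .node s t => tripleBr m (treeTriple s) (treeTriple t)

theorem exists_treeTriple_fill (c : Ctx m) :
    ∃ h : SquareTriple m →+ SquareTriple m, ∀ t, treeTriple (c.fill t) = h (treeTriple t) := by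
  induction c with
  | hole => exact ⟨AddMonoidHom.id _, fun t => rfl⟩
  | nodeL c r ih =>
    obtain ⟨h, hh⟩ := ih
    exact ⟨((tripleBr m).flip (treeTriple r)).comp h, fun t => by
      simp [Ctx.fill, treeTriple, hh]⟩
  | nodeR r c ih =>
    obtain ⟨h, hh⟩ := ih
    exact ⟨(tripleBr m (treeTriple r)).comp h, fun t => by
      simp [Ctx.fill, treeTriple, hh]⟩

/-- The additive extension of `treeTriple`. -/
noncomputable def tripleHom (m : ℕ) : FreeAbelianGroup (RTree m) →+ SquareTriple m :=
  FreeAbelianGroup.lift treeTriple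

@[simp]
theorem tripleHom_of (t : RTree m) : tripleHom m (FreeAbelianGroup.of t) = treeTriple t := by
  simp [tripleHom]

/-- The projection of the free group on trees onto its degree `n` part. -/
def truncDeg (m n : ℕ) : FreeAbelianGroup (RTree m) →+ FreeAbelianGroup (RTree m) :=
  FreeAbelianGroup.lift fun t => if t.deg = n then FreeAbelianGroup.of t else 0

theorem truncDeg_of (n : ℕ) (t : RTree m) : truncDeg m n (FreeAbelianGroup.of t) =
    if t.deg = n then FreeAbelianGroup.of t else 0 := by
  simp [truncDeg]

theorem LLMk_truncDeg (n : ℕ) (e : FreeAbelianGroup (RTree m)) :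
    LLMk m n (truncDeg m n e) = LLMk m n e := by
  have h : (LLMk m n).comp (truncDeg m n) = LLMk m n := by
    ext t
    rw [AddMonoidHom.comp_apply, truncDeg_of]
    split_ifs with ht
    · rfl
    · rw [map_zero, LLMk_of_deg_ne ht]
  exact DFunLike.congr_fun h e

/-- The last coordinate of the triple of the degree `n` part. -/
noncomputable def squareCoord (m n : ℕ) : FreeAbelianGroup (RTree m) →+ WordPoly m :=
  ((AddMonoidHom.snd _ _).comp (AddMonoidHom.snd _ _)).comp ((tripleHom m).comp (truncDeg m n))

theorem squareCoord_apply (n : ℕ) (e : FreeAbelianGroup (RTree m)) :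
    squareCoord m n e = (tripleHom m (truncDeg m n e)).2.2 := rfl

theorem closure_quasiLieRels_le_ker_squareCoord (m n : ℕ) :
    AddSubgroup.closure (quasiLieRels m n) ≤ (squareCoord m n).ker := by
  rw [AddSubgroup.closure_le]
  rintro x ((⟨J, hJ, rfl⟩ | ⟨c, A, B, rfl⟩) | ⟨c, A, B, C, rfl⟩)
  · change squareCoord m n _ = 0
    rw [squareCoord_apply, truncDeg_of, if_neg hJ, map_zero]
    rfl
  · change squareCoord m n _ = 0
    obtain ⟨h, hh⟩ := exists_treeTriple_fill c
    have hd : (c.fill (RTree.node B A)).deg = (c.fill (RTree.node A B)).deg :=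
      c.deg_fill_congr (by simp only [RTree.deg]; omega)
    rw [squareCoord_apply, map_add, truncDeg_of, truncDeg_of, hd]
    split_ifs
    · rw [map_add, tripleHom_of, tripleHom_of, hh, hh, ← map_add]
      simp [treeTriple, tripleBr_add_swap]
    · simp
  · change squareCoord m n _ = 0
    obtain ⟨h, hh⟩ := exists_treeTriple_fill c
    have hd : (c.fill (RTree.node (RTree.node A B) C)).deg =
        (c.fill (RTree.node A (RTree.node B C))).deg :=
      c.deg_fill_congr (by simp only [RTree.deg]; omega)
    have hd' : (c.fill (RTree.node B (RTree.node A C))).deg =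
        (c.fill (RTree.node A (RTree.node B C))).deg :=
      c.deg_fill_congr (by simp only [RTree.deg]; omega)
    rw [squareCoord_apply, map_sub (truncDeg m n), map_sub (truncDeg m n), truncDeg_of,
      truncDeg_of, truncDeg_of, hd, hd']
    split_ifs
    · rw [map_sub, map_sub, tripleHom_of, tripleHom_of, tripleHom_of, hh, hh, hh, ← map_sub,
        ← map_sub]
      simp [treeTriple, tripleBr_jacobi]
    · simp

theorem tripleHom_treeBr (x y : FreeAbelianGroup (RTree m)) :
    tripleHom m (treeBr m x y) = tripleBr m (tripleHom m x) (tripleHom m y) := by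
  have h : (AddMonoidHom.compr₂ (treeBr m) (tripleHom m)) =
      ((tripleBr m).compl₂ (tripleHom m)).comp (tripleHom m) := by
    refine FreeAbelianGroup.lift_ext _ _ fun s => FreeAbelianGroup.lift_ext _ _ fun t => ?_
    simp [treeTriple]
  exact DFunLike.congr_fun (DFunLike.congr_fun h x) y

theorem truncDeg_treeBr (k : ℕ) (x y : FreeAbelianGroup (RTree m)) :
    truncDeg m (2 * k) (treeBr m (truncDeg m k x) (truncDeg m k y)) =
      treeBr m (truncDeg m k x) (truncDeg m k y) := by
  have h : (AddMonoidHom.compr₂ (((treeBr m).compl₂ (truncDeg m k)).comp (truncDeg m k))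
      (truncDeg m (2 * k))) = ((treeBr m).compl₂ (truncDeg m k)).comp (truncDeg m k) := by
    refine FreeAbelianGroup.lift_ext _ _ fun s => FreeAbelianGroup.lift_ext _ _ fun t => ?_
    simp only [AddMonoidHom.compr₂_apply, AddMonoidHom.comp_apply, AddMonoidHom.compl₂_apply,
      truncDeg_of]
    split_ifs with hs ht
    · rw [treeBr_of, truncDeg_of, if_pos (by simp only [RTree.deg]; omega)]
    all_goals simp
  exact DFunLike.congr_fun (DFunLike.congr_fun h x) y

theorem tripleHom_eq_zero_of_square {k : ℕ} {e : FreeAbelianGroup (RTree m)}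
    (h : squareLL m k (LLMk m k e) = 0) : (tripleHom m (truncDeg m k e)).2.1 = 0 := by
  rw [← LLMk_truncDeg, squareLL_LLMk] at h
  have h1 := closure_quasiLieRels_le_ker_squareCoord m (2 * k)
    ((QuotientAddGroup.eq_zero_iff _).1 h)
  have h2 : squareCoord m (2 * k) _ = 0 := h1
  rw [squareCoord_apply, truncDeg_treeBr, tripleHom_treeBr, tripleBr_self] at h2
  exact mul_self_eq_zero.1 h2

/-- The linear embedding of the free associative algebra sending a word to its variable. -/
noncomputable def wordPolyEmb (m : ℕ) : FreeAlgebra (ZMod 2) (Fin m) →ₗ[ZMod 2] WordPoly m :=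
  (Finsupp.linearCombination (ZMod 2) MvPolynomial.X).comp
    ((MonoidAlgebra.coeffLinearEquiv (ZMod 2)).toLinearMap.comp
      FreeAlgebra.equivMonoidAlgebraFreeMonoid.toLinearMap)

theorem wordPolyEmb_injective (m : ℕ) : Function.Injective (wordPolyEmb m) := by
  have h : LinearIndependent (ZMod 2)
      (MvPolynomial.X : FreeMonoid (Fin m) → WordPoly m) :=
    (MvPolynomial.basisMonomials (FreeMonoid (Fin m)) (ZMod 2)).linearIndependent.comp
      (fun w => Finsupp.single w 1) (Finsupp.single_left_injective one_ne_zero)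
  have hc : Function.Injective ((MonoidAlgebra.coeffLinearEquiv (ZMod 2)) ∘
      (FreeAlgebra.equivMonoidAlgebraFreeMonoid (R := ZMod 2) (X := Fin m))) :=
    (LinearEquiv.injective _).comp (AlgEquiv.injective _)
  exact Function.Injective.comp (g := Finsupp.linearCombination (ZMod 2) MvPolynomial.X) h hc

theorem wordPolyEmb_symm_single (w : FreeMonoid (Fin m)) (r : ZMod 2) :
    wordPolyEmb m (FreeAlgebra.equivMonoidAlgebraFreeMonoid.symm (MonoidAlgebra.single w r)) =
      r • MvPolynomial.X w := by
  simp [wordPolyEmb, MonoidAlgebra.coeffLinearEquiv]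

theorem equivMonoidAlgebraFreeMonoid_symm_single (i : Fin m) :
    FreeAlgebra.equivMonoidAlgebraFreeMonoid.symm
      (MonoidAlgebra.single (FreeMonoid.of i) (1 : ZMod 2)) = FreeAlgebra.ι (ZMod 2) i := by
  rw [AlgEquiv.symm_apply_eq]
  simp [FreeAlgebra.equivMonoidAlgebraFreeMonoid]

theorem treeTriple_leaf_fst_wordPolyEmb (i : Fin m) (z : FreeAlgebra (ZMod 2) (Fin m)) :
    (treeTriple (.leaf i)).1 (wordPolyEmb m z) =
      wordPolyEmb m (FreeAlgebra.ι (ZMod 2) i * z) := by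
  obtain ⟨z, rfl⟩ := FreeAlgebra.equivMonoidAlgebraFreeMonoid.symm.surjective z
  rw [← equivMonoidAlgebraFreeMonoid_symm_single, ← map_mul]
  induction z using MonoidAlgebra.induction_linear with
  | zero => simp
  | add x y hx hy => rw [mul_add]; simp only [map_add, hx, hy]
  | single w r =>
    rw [MonoidAlgebra.single_mul_single, wordPolyEmb_symm_single, wordPolyEmb_symm_single,
      one_mul, Derivation.map_smul]
    simp [treeTriple]

/-- The value of a rooted tree in the free Lie algebra over `ℤ₂`. -/
noncomputable def treeLie : RTree m → FreeLieAlgebra (ZMod 2) (Fin m)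
  | .leaf i => FreeLieAlgebra.of (ZMod 2) i
  | .node s t => ⁅treeLie s, treeLie t⁆

theorem isLieMonomial_treeLie (t : RTree m) :
    IsLieMonomial (ZMod 2) (fun _ => 1) t.deg (treeLie t) := by
  induction t with
  | leaf i => exact IsLieMonomial.of i
  | node s t hs ht => exact IsLieMonomial.lie hs ht

theorem treeTriple_eq (t : RTree m) :
    (∀ z, (treeTriple t).1 (wordPolyEmb m z) =
      wordPolyEmb m (freeLieToFreeAlgebra (ZMod 2) (Fin m) (treeLie t) * z)) ∧
    (treeTriple t).2.1 =
      wordPolyEmb m (freeLieToFreeAlgebra (ZMod 2) (Fin m) (treeLie t)) := by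
  induction t with
  | leaf i =>
    have hi : freeLieToFreeAlgebra (ZMod 2) (Fin m) (treeLie (.leaf i)) =
        FreeAlgebra.ι (ZMod 2) i := by simp [freeLieToFreeAlgebra, treeLie]
    rw [hi]
    refine ⟨treeTriple_leaf_fst_wordPolyEmb i, ?_⟩
    rw [← equivMonoidAlgebraFreeMonoid_symm_single, wordPolyEmb_symm_single, one_smul]
    rfl
  | node s t hs ht =>
    refine ⟨fun z => ?_, ?_⟩
    · simp only [treeTriple, tripleBr_apply, Derivation.commutator_apply, treeLie, LieHom.map_lie,
        LieRing.of_associative_ring_bracket, hs.1, ht.1, ← map_sub, sub_mul, mul_assoc]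
    · simp only [treeTriple, tripleBr_apply, treeLie, LieHom.map_lie,
        LieRing.of_associative_ring_bracket, hs.1, ht.1, hs.2, ht.2, ← map_sub]

/-- The additive extension of `treeLie`. -/
noncomputable def lieHom (m : ℕ) : FreeAbelianGroup (RTree m) →+ FreeLieAlgebra (ZMod 2) (Fin m) :=
  FreeAbelianGroup.lift treeLie

theorem tripleHom_eq_wordPolyEmb (e : FreeAbelianGroup (RTree m)) :
    (tripleHom m e).2.1 =
      wordPolyEmb m (freeLieToFreeAlgebra (ZMod 2) (Fin m) (lieHom m e)) := by
  induction e using FreeAbelianGroup.induction_on with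
  | zero => simp
  | of t => simp [lieHom, (treeTriple_eq t).2]
  | neg t ht => simp only [map_neg, Prod.snd_neg, Prod.fst_neg, ht]
  | add x y hx hy => simp only [map_add, Prod.snd_add, Prod.fst_add, hx, hy]

theorem lieHom_truncDeg_mem (k : ℕ) (e : FreeAbelianGroup (RTree m)) :
    lieHom m (truncDeg m k e) ∈ weightSpan (ZMod 2) (fun _ => 1) k := by
  induction e using FreeAbelianGroup.induction_on with
  | zero => simp
  | of t =>
    rw [truncDeg_of]
    split_ifs with h
    · subst h
      exact Submodule.subset_span (by simpa [lieHom] using isLieMonomial_treeLie t)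
    · simp
  | neg t ht => simpa using ht
  | add x y hx hy => simpa using add_mem hx hy

theorem lieHom_eq_zero_of_square {k : ℕ} {e : FreeAbelianGroup (RTree m)}
    (h : squareLL m k (LLMk m k e) = 0) : lieHom m (truncDeg m k e) = 0 := by
  refine freeLieToFreeAlgebra_eq_zero (lieHom_truncDeg_mem k e) (wordPolyEmb_injective m ?_)
  rw [← tripleHom_eq_wordPolyEmb, tripleHom_eq_zero_of_square h, map_zero]

end SquareInvariant

section LieModTwo

variable {m : ℕ}

/-- The relators of the free Lie ring over `ℤ₂`, in all degrees at once. -/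
def lieModTwoRels (m : ℕ) : Set (FreeAbelianGroup (RTree m)) :=
  (antisymmJacobiRels m ∪ squareRels m) ∪
    {x | ∃ t : RTree m, x = FreeAbelianGroup.of t + FreeAbelianGroup.of t}

theorem graftStable_lieModTwoRels (m : ℕ) : GraftStable (lieModTwoRels m) := by
  refine ((graftStable_antisymmJacobiRels m).union (graftStable_squareRels m)).union ?_
  rintro x ⟨s, rfl⟩ t
  exact ⟨⟨RTree.node t s, by simp⟩, ⟨RTree.node s t, by simp⟩⟩

/-- The Lie ring presented by rooted trees over `ℤ₂`. -/
def LieModTwo (m : ℕ) : Type :=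
  FreeAbelianGroup (RTree m) ⧸ AddSubgroup.closure (lieModTwoRels m)

instance (m : ℕ) : AddCommGroup (LieModTwo m) :=
  inferInstanceAs (AddCommGroup (_ ⧸ AddSubgroup.closure (lieModTwoRels m)))

/-- The projection onto the Lie ring presented by rooted trees over `ℤ₂`. -/
def lieModTwoMk (m : ℕ) : FreeAbelianGroup (RTree m) →+ LieModTwo m :=
  QuotientAddGroup.mk' (AddSubgroup.closure (lieModTwoRels m))

theorem lieModTwoMk_surjective (m : ℕ) : Function.Surjective (lieModTwoMk m) :=
  QuotientAddGroup.mk'_surjective _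

theorem lieModTwoMk_eq_zero_iff {x : FreeAbelianGroup (RTree m)} :
    lieModTwoMk m x = 0 ↔ x ∈ AddSubgroup.closure (lieModTwoRels m) :=
  QuotientAddGroup.eq_zero_iff x

/-- The bracket of the Lie ring presented by rooted trees over `ℤ₂`. -/
def lieModTwoBr (m : ℕ) : LieModTwo m →+ LieModTwo m →+ LieModTwo m :=
  QuotientAddGroup.lift _
    (AddMonoidHom.mk' (fun x => QuotientAddGroup.map _ _ (treeBr m x) fun _ hy =>
        (graftStable_lieModTwoRels m).treeBr_mem_right hy x)
      fun x y => by
        refine AddMonoidHom.ext fun e => ?_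
        obtain ⟨e, rfl⟩ := lieModTwoMk_surjective m e
        exact congrArg (lieModTwoMk m) (DFunLike.congr_fun (map_add (treeBr m) x y) e))
    fun x hx => by
      refine AddMonoidHom.ext fun e => ?_
      obtain ⟨e, rfl⟩ := lieModTwoMk_surjective m e
      exact (QuotientAddGroup.eq_zero_iff _).2
        ((graftStable_lieModTwoRels m).treeBr_mem_left hx _)

theorem lieModTwoMk_eq_zero_of_rel : ∀ x ∈ antisymmJacobiRels m, lieModTwoMk m x = 0 :=
  fun _ hx => lieModTwoMk_eq_zero_iff.2 (AddSubgroup.subset_closure (Or.inl (Or.inl hx)))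

instance (m : ℕ) : LieRing (LieModTwo m) where
  bracket x y := lieModTwoBr m x y
  add_lie x y z := by
    change lieModTwoBr m (x + y) z = lieModTwoBr m x z + lieModTwoBr m y z
    rw [map_add, AddMonoidHom.add_apply]
  lie_add x y z := map_add (lieModTwoBr m x) y z
  lie_self x := by
    obtain ⟨x, rfl⟩ := lieModTwoMk_surjective m x
    exact map_treeBr_self lieModTwoMk_eq_zero_of_rel (fun _ hx => lieModTwoMk_eq_zero_iff.2
      (AddSubgroup.subset_closure (Or.inl (Or.inr hx)))) x
  leibniz_lie x y z := by
    obtain ⟨x, rfl⟩ := lieModTwoMk_surjective m x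
    obtain ⟨y, rfl⟩ := lieModTwoMk_surjective m y
    obtain ⟨z, rfl⟩ := lieModTwoMk_surjective m z
    exact map_treeBr_jacobi lieModTwoMk_eq_zero_of_rel x y z

theorem LieModTwo.two_nsmul (x : LieModTwo m) : 2 • x = 0 := by
  obtain ⟨x, rfl⟩ := lieModTwoMk_surjective m x
  induction x using FreeAbelianGroup.induction_on with
  | zero => simp
  | of t =>
    rw [← map_nsmul, _root_.two_nsmul]
    exact lieModTwoMk_eq_zero_iff.2 (AddSubgroup.subset_closure (Or.inr ⟨t, rfl⟩))
  | neg t ht => rw [map_neg, smul_neg, ht, neg_zero]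
  | add x y hx hy => rw [map_add, smul_add, hx, hy, add_zero]

instance (m : ℕ) : Module (ZMod 2) (LieModTwo m) :=
  AddCommGroup.zmodModule LieModTwo.two_nsmul

instance (m : ℕ) : LieAlgebra (ZMod 2) (LieModTwo m) where
  lie_smul c x y := ZMod.map_smul (lieModTwoBr m x) c y

theorem lift_treeLie (t : RTree m) :
    FreeLieAlgebra.lift (ZMod 2) (fun i => lieModTwoMk m (FreeAbelianGroup.of (RTree.leaf i)))
      (treeLie t) = lieModTwoMk m (FreeAbelianGroup.of t) := by
  induction t with
  | leaf i => simp [treeLie]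
  | node s t hs ht =>
    rw [treeLie, LieHom.map_lie, hs, ht, ← treeBr_of]
    rfl

theorem mem_closure_of_lieHom_eq_zero {e : FreeAbelianGroup (RTree m)} (h : lieHom m e = 0) :
    e ∈ AddSubgroup.closure (lieModTwoRels m) := by
  rw [← lieModTwoMk_eq_zero_iff]
  have key : ∀ e : FreeAbelianGroup (RTree m),
      FreeLieAlgebra.lift (ZMod 2) (fun i => lieModTwoMk m (FreeAbelianGroup.of (RTree.leaf i)))
        (lieHom m e) = lieModTwoMk m e := fun e => by
    induction e using FreeAbelianGroup.induction_on with
    | zero => simp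
    | of t => simpa [lieHom] using lift_treeLie t
    | neg t ht => simp only [map_neg, ht]
    | add x y hx hy => simp only [map_add, hx, hy]
  rw [← key, h, map_zero]

theorem one_tmul_LLMk_eq_zero (n : ℕ) {e : FreeAbelianGroup (RTree m)}
    (h : e ∈ AddSubgroup.closure (lieModTwoRels m)) :
    (1 : ZMod 2) ⊗ₜ[ℤ] (LLMk m n e) = 0 := by
  induction h using AddSubgroup.closure_induction with
  | mem x hx =>
    have h0 : ∀ x ∈ lieRels m n, (1 : ZMod 2) ⊗ₜ[ℤ] (LLMk m n x) = 0 := fun x hx => by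
      have hx0 : LLMk m n x = 0 :=
        (QuotientAddGroup.eq_zero_iff x).2 (AddSubgroup.subset_closure hx)
      rw [hx0, TensorProduct.tmul_zero]
    rcases hx with (hx | hx) | ⟨t, rfl⟩
    · exact h0 x (Or.inl (antisymmJacobiRels_subset m n hx))
    · exact h0 x (Or.inr hx)
    · rw [map_add, TensorProduct.tmul_add, ← TensorProduct.add_tmul]
      rw [show (1 : ZMod 2) + 1 = 0 from rfl, TensorProduct.zero_tmul]
  | zero => simp
  | add x y _ _ hx hy => rw [map_add, TensorProduct.tmul_add, hx, hy, add_zero]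
  | neg x _ hx => rw [map_neg, TensorProduct.tmul_neg, hx, neg_zero]

/-- Levine's theorem: the squaring map `ℤ₂ ⊗ L_k → L'_{2k}` is injective. -/
theorem squareTensor_injective (m k : ℕ) : Function.Injective (squareTensor m k) := by
  rw [injective_iff_map_eq_zero]
  intro y hy
  obtain ⟨z, rfl⟩ := exists_eq_one_tmul y
  obtain ⟨e, rfl⟩ := QuotientAddGroup.mk'_surjective _ z
  rw [squareTensor_one_tmul] at hy
  have h := one_tmul_LLMk_eq_zero k (mem_closure_of_lieHom_eq_zero (lieHom_eq_zero_of_square hy))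
  rwa [LLMk_truncDeg] at h

end LieModTwo

section ExactSequence

variable {m : ℕ}

theorem LpToLL_surjective (m n : ℕ) : Function.Surjective (LpToLL m n) := fun y => by
  obtain ⟨e, rfl⟩ := QuotientAddGroup.mk'_surjective _ y
  exact ⟨LpMk m n e, rfl⟩

theorem LpMk_eq_zero_of_quasi {n : ℕ} {x : FreeAbelianGroup (RTree m)}
    (hx : x ∈ quasiLieRels m n) : LpMk m n x = 0 :=
  (QuotientAddGroup.eq_zero_iff x).2 (AddSubgroup.subset_closure hx)

theorem LpToLL_bijective_of_odd (m : ℕ) {n : ℕ} (hn : Odd n) :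
    Function.Bijective (LpToLL m n) := by
  refine ⟨(injective_iff_map_eq_zero _).2 fun y hy => ?_, LpToLL_surjective m n⟩
  obtain ⟨e, rfl⟩ := QuotientAddGroup.mk'_surjective _ y
  have he : e ∈ AddSubgroup.closure (lieRels m n) := (QuotientAddGroup.eq_zero_iff e).1 hy
  have hle : AddSubgroup.closure (lieRels m n) ≤ (LpMk m n).ker := by
    rw [AddSubgroup.closure_le]
    rintro x (hx | ⟨c, J, rfl⟩)
    · exact LpMk_eq_zero_of_quasi hx
    · rcases of_fill_square_mem c J with rfl | h
      · refine LpMk_of_deg_ne fun hd => (Nat.not_even_iff_odd.2 hn) ⟨J.deg, hd.symm⟩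
      · exact LpMk_eq_zero_of_mem h
  exact hle he

theorem LpToLL_squareLL (k : ℕ) (z : LL m k) : LpToLL m (2 * k) (squareLL m k z) = 0 := by
  obtain ⟨e, rfl⟩ := QuotientAddGroup.mk'_surjective _ z
  have hr : ∀ x ∈ lieRels m (2 * k), LLMk m (2 * k) x = 0 := fun x hx =>
    (QuotientAddGroup.eq_zero_iff x).2 (AddSubgroup.subset_closure hx)
  exact map_treeBr_self (q := LLMk m (2 * k))
    (fun x hx => hr x (Or.inl (antisymmJacobiRels_subset m _ hx))) (fun x hx => hr x (Or.inr hx)) e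

theorem mem_range_squareLL_of_LpToLL_eq_zero {k : ℕ} {y : Lp m (2 * k)}
    (hy : LpToLL m (2 * k) y = 0) : y ∈ (squareLL m k).range := by
  obtain ⟨e, rfl⟩ := QuotientAddGroup.mk'_surjective _ y
  have he : e ∈ AddSubgroup.closure (lieRels m (2 * k)) := (QuotientAddGroup.eq_zero_iff e).1 hy
  have hle : AddSubgroup.closure (lieRels m (2 * k)) ≤
      (squareLL m k).range.comap (LpMk m (2 * k)) := by
    rw [AddSubgroup.closure_le]
    rintro x (hx | ⟨c, J, rfl⟩)
    · exact ⟨0, by rw [map_zero, LpMk_eq_zero_of_quasi hx]⟩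
    · rcases of_fill_square_mem c J with rfl | h
      · exact ⟨LLMk m k (FreeAbelianGroup.of J), by
          rw [squareLL_LLMk, treeBr_of]; rfl⟩
      · exact ⟨0, by rw [map_zero, LpMk_eq_zero_of_mem h]⟩
  exact hle he

theorem LpToLL_eq_zero_iff {k : ℕ} {y : Lp m (2 * k)} :
    LpToLL m (2 * k) y = 0 ↔ y ∈ (squareTensor m k).range := by
  constructor
  · intro hy
    obtain ⟨z, rfl⟩ := mem_range_squareLL_of_LpToLL_eq_zero hy
    exact ⟨_, squareTensor_one_tmul k z⟩
  · rintro ⟨x, rfl⟩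
    obtain ⟨z, rfl⟩ := exists_eq_one_tmul x
    rw [squareTensor_one_tmul, LpToLL_squareLL]

theorem projT_bijective_of_odd (m : ℕ) {n : ℕ} (hn : Odd n) : Function.Bijective (projT m n) :=
  (LinearEquiv.lTensor (FreeAbelianGroup (Fin m))
    (LinearEquiv.ofBijective (LpToLL m n).toIntLinearMap (LpToLL_bijective_of_odd m hn))).bijective

theorem bracketLp_of_tmul (a : ℕ) (i : Fin m) (y : Lp m a) :
    bracketLp m a (FreeAbelianGroup.of i ⊗ₜ[ℤ] y) = brLeaf m a i y := by
  rw [bracketLp]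
  exact (TensorProduct.lift.tmul _ _).trans
    (LinearMap.congr_fun (FreeAbelianGroup.lift_apply_of
      (fun i => (brLeaf m a i).toIntLinearMap) i) y)

theorem bracketLL_of_tmul (a : ℕ) (i : Fin m) (y : LL m a) :
    bracketLL m a (FreeAbelianGroup.of i ⊗ₜ[ℤ] y) = brLeafL m a i y := by
  rw [bracketLL]
  exact (TensorProduct.lift.tmul _ _).trans
    (LinearMap.congr_fun (FreeAbelianGroup.lift_apply_of
      (fun i => (brLeafL m a i).toIntLinearMap) i) y)

theorem projT_tmul (n : ℕ) (x : FreeAbelianGroup (Fin m)) (y : Lp m n) :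
    projT m n (x ⊗ₜ[ℤ] y) = x ⊗ₜ[ℤ] LpToLL m n y := rfl

theorem brLeaf_LpMk_of (a : ℕ) (i : Fin m) (t : RTree m) :
    brLeaf m a i (LpMk m a (FreeAbelianGroup.of t)) =
      LpMk m (a + 1) (FreeAbelianGroup.of (RTree.node (RTree.leaf i) t)) :=
  congrArg (LpMk m (a + 1)) (FreeAbelianGroup.lift_apply_of _ t)

theorem LpToLL_brLeaf (a : ℕ) (i : Fin m) (y : Lp m a) :
    LpToLL m (a + 1) (brLeaf m a i y) = brLeafL m a i (LpToLL m a y) := by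
  obtain ⟨e, rfl⟩ := QuotientAddGroup.mk'_surjective _ y
  simp [LpToLL, brLeaf, brLeafL]

theorem bracketLL_projT (a : ℕ) (w : (FreeAbelianGroup (Fin m)) ⊗[ℤ] (Lp m a)) :
    bracketLL m a (projT m a w) = LpToLL m (a + 1) (bracketLp m a w) := by
  induction w using TensorProduct.induction_on with
  | zero => simp only [map_zero]
  | add x y hx hy => simp only [map_add, hx, hy]
  | tmul x y =>
    induction x using FreeAbelianGroup.induction_on with
    | zero => simp only [TensorProduct.zero_tmul, map_zero]
    | of i => rw [projT_tmul, bracketLp_of_tmul, bracketLL_of_tmul, LpToLL_brLeaf]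
    | neg i hi => simp only [TensorProduct.neg_tmul, map_neg, hi]
    | add x y hx hy => simp only [TensorProduct.add_tmul, map_add, hx, hy]

theorem exists_bracketLp_eq_LpMk_node (a : ℕ) (s t : RTree m) :
    LpMk m (a + 1) (FreeAbelianGroup.of (RTree.node s t)) ∈ LinearMap.range (bracketLp m a) := by
  induction s generalizing t with
  | leaf i =>
    exact ⟨_, (bracketLp_of_tmul a i _).trans (brLeaf_LpMk_of a i t)⟩
  | node s₁ s₂ h₁ h₂ =>
    have h := map_treeBr_jacobi (LpMk_eq_zero_of_rel m (a + 1)) (FreeAbelianGroup.of s₁)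
      (FreeAbelianGroup.of s₂) (FreeAbelianGroup.of t)
    simp only [treeBr_of] at h
    rw [eq_sub_of_add_eq h.symm]
    exact sub_mem (h₁ _) (h₂ _)

theorem bracketLp_surjective {a : ℕ} (ha : 1 ≤ a) : Function.Surjective (bracketLp m a) := by
  rw [← LinearMap.range_eq_top, eq_top_iff]
  rintro y -
  obtain ⟨e, rfl⟩ := QuotientAddGroup.mk'_surjective _ y
  induction e using FreeAbelianGroup.induction_on with
  | zero => rw [map_zero]; exact zero_mem _
  | of t =>
    cases t with
    | leaf i =>
      have h : LpMk m (a + 1) (FreeAbelianGroup.of (RTree.leaf i)) = 0 :=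
        LpMk_of_deg_ne (by simp only [RTree.deg]; omega)
      rw [h]
      exact zero_mem _
    | node s t => exact exists_bracketLp_eq_LpMk_node a s t
  | neg t ht => rw [map_neg]; exact neg_mem ht
  | add x y hx hy => rw [map_add]; exact add_mem hx hy

/-- The connecting homomorphism of a commuting square with bijective left side and surjective top
side, the kernel of whose right side is the image of an injective homomorphism. -/
theorem exists_connectingHom {T T' U V S : Type*} [AddCommGroup T] [AddCommGroup T']
    [AddCommGroup U] [AddCommGroup V] [AddCommGroup S] {p : T' →ₗ[ℤ] T} {f : T' →ₗ[ℤ] U}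
    {g : T →ₗ[ℤ] V} {π : U →+ V} {σ : S →+ U} (hp : Function.Bijective p)
    (hf : Function.Surjective f) (hσ : Function.Injective σ)
    (hπ : ∀ u, π u = 0 ↔ u ∈ σ.range) (hcomm : ∀ w, g (p w) = π (f w)) :
    ∃ sl : ↥(LinearMap.ker g) →+ S,
      (∀ (Z : ↥(LinearMap.ker g)) (W : T'), p W = (Z : T) → σ (sl Z) = f W) ∧
      Function.Surjective sl ∧
      (∀ Z : ↥(LinearMap.ker g), sl Z = 0 ↔
        (Z : T) ∈ Set.range (p ∘ₗ (LinearMap.ker f).subtype)) := by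
  let P := LinearEquiv.ofBijective p hp
  have hP : ∀ Z, p (P.symm Z) = Z := P.apply_symm_apply
  let F : ↥(LinearMap.ker g) →+ σ.range :=
    (f ∘ₗ P.symm.toLinearMap ∘ₗ (LinearMap.ker g).subtype).toAddMonoidHom.codRestrict σ.range
      fun Z => (hπ _).1 ((hcomm _).symm.trans ((congrArg g (hP Z)).trans Z.2))
  let sl : ↥(LinearMap.ker g) →+ S := (AddMonoidHom.ofInjective hσ).symm.toAddMonoidHom.comp F
  have hsl : ∀ (Z : ↥(LinearMap.ker g)) (W : T'), p W = (Z : T) → σ (sl Z) = f W :=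
    fun Z W hW => by
      have h : P.symm (Z : T) = W := hp.1 ((hP Z).trans hW.symm)
      rw [← h]
      exact congrArg Subtype.val ((AddMonoidHom.ofInjective hσ).apply_symm_apply (F Z))
  refine ⟨sl, hsl, fun s => ?_, fun Z => ?_⟩
  · obtain ⟨w, hw⟩ := hf (σ s)
    refine ⟨⟨p w, ?_⟩, hσ ?_⟩
    · rw [LinearMap.mem_ker, hcomm, hw, hπ]
      exact ⟨s, rfl⟩
    · rw [hsl _ w rfl, hw]
  · rw [← (injective_iff_map_eq_zero' σ).1 hσ, hsl Z _ (hP Z)]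
    constructor
    · intro h
      exact ⟨⟨_, h⟩, hP Z⟩
    · rintro ⟨⟨w, hw⟩, h⟩
      rw [← hp.1 (h.trans (hP Z).symm)]
      exact hw

end ExactSequence

/-- For all `m,k ≥ 1`: under the identification of `L_1 ⊗ L_{2k+1}` with
`L_1 ⊗ L'_{2k+1}`, `D'_{2k}` is a subgroup of `D_{2k}`; the recipe
`sq(sl_{2k}(Z)) = (L'-valued bracket of Z)` defines a homomorphism
`sl_{2k} : D_{2k} → ℤ₂ ⊗ L_{k+1}`; `sl_{2k}` is surjective; `Ker(sl_{2k}) = D'_{2k}`.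
Here `sq : ℤ₂ ⊗ L_{k+1} → L'_{2k+2}` is the squaring map `1 ⊗ Y ↦ [Y,Y]`,
`D'_{2k} = Ker(bracketLp m (2k+1))`, `D_{2k} = Ker(bracketLL m (2k+1))`,
and the `L'`-valued bracket of `Z` is `bracketLp` applied to any lift `W` of `Z`
along `id ⊗ (L'_{2k+1} → L_{2k+1})`. -/
theorem statement8 (m k : ℕ) (hm : 1 ≤ m) (hk : 1 ≤ k) :
    (∀ w ∈ LinearMap.ker (bracketLp m (2 * k + 1)),
      projT m (2 * k + 1) w ∈ LinearMap.ker (bracketLL m (2 * k + 1))) ∧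
    ∃ sq : ((ZMod 2) ⊗[ℤ] (LL m (k + 1))) →+ Lp m (2 * k + 2),
      (∀ T : RTree m, T.deg = k + 1 →
        sq ((1 : ZMod 2) ⊗ₜ[ℤ] (LLMk m (k + 1) (FreeAbelianGroup.of T)))
          = LpMk m (2 * k + 2) (FreeAbelianGroup.of (RTree.node T T))) ∧
      ∃ sl : ↥(LinearMap.ker (bracketLL m (2 * k + 1))) →+
          ((ZMod 2) ⊗[ℤ] (LL m (k + 1))),
        (∀ (Z : ↥(LinearMap.ker (bracketLL m (2 * k + 1))))
            (W : (FreeAbelianGroup (Fin m)) ⊗[ℤ] (Lp m (2 * k + 1))),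
          projT m (2 * k + 1) W = (Z : (FreeAbelianGroup (Fin m)) ⊗[ℤ] (LL m (2 * k + 1))) →
            sq (sl Z) = bracketLp m (2 * k + 1) W) ∧
        Function.Surjective sl ∧
        (∀ Z : ↥(LinearMap.ker (bracketLL m (2 * k + 1))), sl Z = 0 ↔
          (Z : (FreeAbelianGroup (Fin m)) ⊗[ℤ] (LL m (2 * k + 1))) ∈
            Set.range ((projT m (2 * k + 1)) ∘ₗ
              (LinearMap.ker (bracketLp m (2 * k + 1))).subtype)) := by
  have hodd : Odd (2 * k + 1) := odd_two_mul_add_one k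
  refine ⟨fun w hw => ?_, squareTensor m (k + 1), fun T _ => ?_, ?_⟩
  · rw [LinearMap.mem_ker, bracketLL_projT, LinearMap.mem_ker.1 hw, map_zero]
  · rw [squareTensor_one_tmul, squareLL_LLMk, treeBr_of]
    rfl
  · exact exists_connectingHom (π := LpToLL m (2 * k + 2)) (σ := squareTensor m (k + 1))
      (projT_bijective_of_odd m hodd) (bracketLp_surjective (by omega))
      (squareTensor_injective m (k + 1)) (fun u => LpToLL_eq_zero_iff (k := k + 1))
      (bracketLL_projT (2 * k + 1))
end

section
/- (Levine Conjecture) For all integers m ≥ 1 and n ≥ 1, the homomorphism η'_n : 𝒯_n → L'_1 ⊗ L'_{n+1} is injective and its image is exactly D'_n; that is, η'_n induces an isomorphism 𝒯_n ≅ D'_n. -/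
open scoped TensorProduct

namespace QuasiLie

/-- A biadditive map bundled as a homomorphism into a group of homomorphisms. -/
def biadd {A B C : Type*} [AddCommGroup A] [AddCommGroup B] [AddCommGroup C] (f : A → B → C)
    (hl : ∀ a a' b, f (a + a') b = f a b + f a' b)
    (hr : ∀ a b b', f a (b + b') = f a b + f a b') : A →+ B →+ C :=
  AddMonoidHom.mk' (fun a => AddMonoidHom.mk' (f a) (hr a))
    fun a a' => AddMonoidHom.ext fun b => hl a a' b

@[simp] theorem biadd_apply {A B C : Type*} [AddCommGroup A] [AddCommGroup B] [AddCommGroup C]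
    (f : A → B → C) (hl hr) (a : A) (b : B) : biadd f hl hr a b = f a b := rfl

/-- A quasi-Lie bracket on an abelian group: skew-symmetric (not necessarily alternating) and
satisfying the Jacobi identity. -/
structure QLie (N : Type*) [AddCommGroup N] where
  br : N →+ N →+ N
  skew : ∀ a b, br a b + br b a = 0
  jacobi : ∀ a b c, br a (br b c) = br (br a b) c + br b (br a c)

/-- Evaluation of a bracket monomial in a quasi-Lie ring. -/
def QLie.eval {α N : Type*} [AddCommGroup N] (Q : QLie N) (f : α → N) : FreeMagma α → N
  | .of x => f x
  | .mul a b => Q.br (Q.eval f a) (Q.eval f b)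

@[simp] theorem QLie.eval_of {α N : Type*} [AddCommGroup N] (Q : QLie N) (f : α → N) (x : α) :
    Q.eval f (.of x) = f x := rfl

@[simp] theorem QLie.eval_mul {α N : Type*} [AddCommGroup N] (Q : QLie N) (f : α → N)
    (a b : FreeMagma α) : Q.eval f (a * b) = Q.br (Q.eval f a) (Q.eval f b) := rfl

/-- The relators of the free quasi-Lie ring, closed under multiplication by monomials. -/
inductive Relator {α : Type*} : FreeAbelianGroup (FreeMagma α) → Prop
  | skew (A B : FreeMagma α) :
      Relator (FreeAbelianGroup.of (A * B) + FreeAbelianGroup.of (B * A))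
  | jacobi (A B C : FreeMagma α) :
      Relator (FreeAbelianGroup.of (A * (B * C)) - FreeAbelianGroup.of (A * B * C) -
        FreeAbelianGroup.of (B * (A * C)))
  | mul_right {z : FreeAbelianGroup (FreeMagma α)} (hz : Relator z) (B : FreeMagma α) :
      Relator (z * FreeAbelianGroup.of B)
  | mul_left (A : FreeMagma α) {z : FreeAbelianGroup (FreeMagma α)} (hz : Relator z) :
      Relator (FreeAbelianGroup.of A * z)

theorem lift_of_mul {α G : Type*} [AddCommGroup G] (f : FreeMagma α → G) (A : FreeMagma α)
    (z : FreeAbelianGroup (FreeMagma α)) :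
    FreeAbelianGroup.lift f (FreeAbelianGroup.of A * z) =
      FreeAbelianGroup.lift (fun B => f (A * B)) z :=
  DFunLike.congr_fun (FreeAbelianGroup.lift_ext
    ((FreeAbelianGroup.lift f).comp (AddMonoidHom.mulLeft (FreeAbelianGroup.of A))) _
    fun B => by simp [FreeAbelianGroup.of_mul_of]) z

theorem lift_mul_of {α G : Type*} [AddCommGroup G] (f : FreeMagma α → G) (B : FreeMagma α)
    (z : FreeAbelianGroup (FreeMagma α)) :
    FreeAbelianGroup.lift f (z * FreeAbelianGroup.of B) =
      FreeAbelianGroup.lift (fun A => f (A * B)) z :=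
  DFunLike.congr_fun (FreeAbelianGroup.lift_ext
    ((FreeAbelianGroup.lift f).comp (AddMonoidHom.mulRight (FreeAbelianGroup.of B))) _
    fun A => by simp [FreeAbelianGroup.of_mul_of]) z

/-- Compatibility of `FreeAbelianGroup.lift` with additive maps. -/
theorem map_lift {T G H : Type*} [AddCommGroup G] [AddCommGroup H] (φ : G →+ H) (f : T → G)
    (z : FreeAbelianGroup T) :
    φ (FreeAbelianGroup.lift f z) = FreeAbelianGroup.lift (fun t => φ (f t)) z :=
  DFunLike.congr_fun (FreeAbelianGroup.lift_ext (φ.comp (FreeAbelianGroup.lift f)) _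
    fun t => by simp) z

/-- The free quasi-Lie ring on an alphabet. -/
def Free (α : Type*) : Type _ :=
  FreeAbelianGroup (FreeMagma α) ⧸
    AddSubgroup.closure {z : FreeAbelianGroup (FreeMagma α) | Relator z}

instance (α : Type*) : AddCommGroup (Free α) :=
  inferInstanceAs (AddCommGroup (FreeAbelianGroup (FreeMagma α) ⧸
    AddSubgroup.closure {z : FreeAbelianGroup (FreeMagma α) | Relator z}))

/-- The number of occurrences of each letter in a bracket monomial. -/
def letters {α : Type*} : FreeMagma α → Multiset α
  | .of x => {x}
  | .mul a b => letters a + letters b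

@[simp] theorem letters_of {α : Type*} (x : α) : letters (FreeMagma.of x) = {x} := rfl

@[simp] theorem letters_mul {α : Type*} (a b : FreeMagma α) :
    letters (a * b) = letters a + letters b := rfl

theorem letters_ne_zero {α : Type*} (A : FreeMagma α) : letters A ≠ 0 := by
  induction A with
  | ih1 x => simp
  | ih2 a b ha hb => simp [ha]

namespace Free

variable {α : Type*}

/-- The projection from formal sums of bracket monomials. -/
def mk : FreeAbelianGroup (FreeMagma α) →+ Free α := QuotientAddGroup.mk' _

/-- The class of a bracket monomial. -/
def ev (A : FreeMagma α) : Free α := mk (FreeAbelianGroup.of A)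

@[simp] theorem mk_of (A : FreeMagma α) : mk (FreeAbelianGroup.of A) = ev A := rfl

theorem mk_eq_zero {z : FreeAbelianGroup (FreeMagma α)} (hz : Relator z) : mk z = 0 :=
  (QuotientAddGroup.eq_zero_iff _).2 (AddSubgroup.subset_closure hz)

/-- Additive maps out of the free quasi-Lie ring. -/
def desc {G : Type*} [AddCommGroup G] (f : FreeMagma α → G)
    (hf : ∀ z, Relator z → FreeAbelianGroup.lift f z = 0) : Free α →+ G :=
  QuotientAddGroup.lift _ (FreeAbelianGroup.lift f) ((AddSubgroup.closure_le _).2 hf)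

@[simp] theorem desc_mk {G : Type*} [AddCommGroup G] (f : FreeMagma α → G) (hf)
    (z : FreeAbelianGroup (FreeMagma α)) : desc f hf (mk z) = FreeAbelianGroup.lift f z := rfl

@[simp] theorem desc_ev {G : Type*} [AddCommGroup G] (f : FreeMagma α → G) (hf)
    (A : FreeMagma α) : desc f hf (ev A) = f A := by
  rw [← mk_of, desc_mk, FreeAbelianGroup.lift_apply_of]

theorem mk_surjective : Function.Surjective (mk : _ →+ Free α) :=
  QuotientAddGroup.mk'_surjective _

@[ext] theorem hom_ext {G : Type*} [AddCommGroup G] {φ ψ : Free α →+ G}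
    (h : ∀ A, φ (ev A) = ψ (ev A)) : φ = ψ := by
  ext u
  obtain ⟨z, rfl⟩ := mk_surjective u
  exact DFunLike.congr_fun (FreeAbelianGroup.lift_ext (φ.comp mk) (ψ.comp mk) h) z

theorem closure_range_ev : AddSubgroup.closure (Set.range (ev : _ → Free α)) = ⊤ := by
  refine eq_top_iff.2 fun u _ => ?_
  obtain ⟨z, rfl⟩ := mk_surjective u
  induction z using FreeAbelianGroup.induction_on with
  | zero => simp
  | of x => exact AddSubgroup.subset_closure ⟨x, rfl⟩
  | neg x hx => rw [map_neg]; exact neg_mem (hx trivial)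
  | add x y hx hy => rw [map_add]; exact add_mem (hx trivial) (hy trivial)

theorem lift_ev (z : FreeAbelianGroup (FreeMagma α)) :
    FreeAbelianGroup.lift (fun A => ev A) z = mk z :=
  DFunLike.congr_fun (FreeAbelianGroup.lift_ext _ mk fun A => by simp) z

/-- The bracket of the free quasi-Lie ring. -/
def br : Free α →+ Free α →+ Free α :=
  desc (fun A => desc (fun B => ev (A * B)) fun z hz => by
      rw [← lift_of_mul, lift_ev, mk_eq_zero (hz.mul_left A)])
    fun z hz => hom_ext fun B => by
      have := map_lift (AddMonoidHom.eval (ev B) : (Free α →+ Free α) →+ Free α)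
        (fun A => desc (fun B => ev (A * B)) fun z hz => by
          rw [← lift_of_mul, lift_ev, mk_eq_zero (hz.mul_left A)]) z
      simp only [AddMonoidHom.eval_apply_apply, desc_ev] at this
      rw [this, ← lift_mul_of, lift_ev, mk_eq_zero (hz.mul_right B)]
      rfl

@[simp] theorem br_ev (A B : FreeMagma α) : br (ev A) (ev B) = ev (A * B) := by
  simp [br]

theorem ev_mul (A B : FreeMagma α) : ev (A * B) = br (ev A) (ev B) := (br_ev A B).symm

/-- Induction on elements of the free quasi-Lie ring. -/
theorem induction {p : Free α → Prop} (u : Free α) (hev : ∀ A, p (ev A)) (h0 : p 0)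
    (hneg : ∀ u, p u → p (-u)) (hadd : ∀ u v, p u → p v → p (u + v)) : p u := by
  have hu : u ∈ AddSubgroup.closure (Set.range (ev : _ → Free α)) := by
    rw [closure_range_ev]; trivial
  induction hu using AddSubgroup.closure_induction with
  | mem x hx => obtain ⟨A, rfl⟩ := hx; exact hev A
  | zero => exact h0
  | add x y _ _ hx hy => exact hadd x y hx hy
  | neg x _ hx => exact hneg x hx

theorem br_skew (a b : Free α) : br a b + br b a = 0 := by
  have h : br (α := α) + br.flip = 0 := by
    ext A B
    simpa using mk_eq_zero (Relator.skew A B)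
  simpa using DFunLike.congr_fun (DFunLike.congr_fun h a) b

theorem br_eq_neg (a b : Free α) : br a b = -br b a := eq_neg_of_add_eq_zero_left (br_skew a b)

theorem br_jacobi (a b c : Free α) : br a (br b c) = br (br a b) c + br b (br a c) := by
  induction a using induction with
  | h0 => simp
  | hneg u h => simp only [map_neg, AddMonoidHom.neg_apply, h]; abel
  | hadd u v h h' => simp only [map_add, AddMonoidHom.add_apply, h, h']; abel
  | hev A =>
    induction b using induction with
    | h0 => simp
    | hneg u h => simp only [map_neg, AddMonoidHom.neg_apply, h]; abel
    | hadd u v h h' => simp only [map_add, AddMonoidHom.add_apply, h, h']; abel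
    | hev B =>
      induction c using induction with
      | h0 => simp
      | hneg u h => simp only [map_neg, h]; abel
      | hadd u v h h' => simp only [map_add, h, h']; abel
      | hev C =>
        have := mk_eq_zero (Relator.jacobi A B C)
        simp only [map_sub, mk_of, sub_sub, sub_eq_zero] at this
        simpa using this

/-- The free quasi-Lie ring as a quasi-Lie ring. -/
def qlie (α : Type*) : QLie (Free α) := ⟨br, br_skew, br_jacobi⟩

@[simp] theorem qlie_br : (qlie α).br = br := rfl

theorem lift_eval_eq_zero {N : Type*} [AddCommGroup N] (Q : QLie N) (f : α → N)
    (z : FreeAbelianGroup (FreeMagma α)) (hz : Relator z) :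
    FreeAbelianGroup.lift (Q.eval f) z = 0 := by
  induction hz with
  | skew A B => simpa using Q.skew _ _
  | jacobi A B C => simp [Q.jacobi (Q.eval f A)]
  | @mul_right z hz B ih =>
    rw [lift_mul_of]
    have := map_lift (Q.br.flip (Q.eval f B)) (Q.eval f) z
    rw [ih] at this
    simpa using this.symm
  | @mul_left A z hz ih =>
    rw [lift_of_mul]
    have := map_lift (Q.br (Q.eval f A)) (Q.eval f) z
    rw [ih] at this
    simpa using this.symm

/-- The universal property of the free quasi-Lie ring. -/
def lift {N : Type*} [AddCommGroup N] (Q : QLie N) (f : α → N) : Free α →+ N :=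
  desc (Q.eval f) (lift_eval_eq_zero Q f)

@[simp] theorem lift_of {N : Type*} [AddCommGroup N] (Q : QLie N) (f : α → N) (x : α) :
    lift Q f (ev (.of x)) = f x := by simp [lift]

/-- Two biadditive maps agreeing on monomials agree. -/
theorem biadd_ext {β G : Type*} [AddCommGroup G] {φ ψ : Free α →+ Free β →+ G}
    (h : ∀ A B, φ (ev A) (ev B) = ψ (ev A) (ev B)) (a : Free α) (b : Free β) :
    φ a b = ψ a b := by
  have : φ = ψ := by ext A B; exact h A B
  rw [this]

@[simp] theorem lift_br {N : Type*} [AddCommGroup N] (Q : QLie N) (f : α → N) (a b : Free α) :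
    lift Q f (br a b) = Q.br (lift Q f a) (lift Q f b) := by
  have := biadd_ext (φ := br.compr₂ (lift Q f)) (ψ := (Q.br.compl₂ (lift Q f)).comp (lift Q f))
    (fun A B => by simp [lift]) a b
  simpa using this

/-- Additive maps that agree on letters and propagate through brackets agree. -/
theorem ext_of_mul {G : Type*} [AddCommGroup G] {φ ψ : Free α →+ G}
    (hof : ∀ x, φ (ev (.of x)) = ψ (ev (.of x)))
    (hmul : ∀ A B, φ (ev A) = ψ (ev A) → φ (ev B) = ψ (ev B) →
      φ (br (ev A) (ev B)) = ψ (br (ev A) (ev B))) : φ = ψ := by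
  ext A
  induction A with
  | ih1 x => exact hof x
  | ih2 A B hA hB => rw [ev_mul]; exact hmul A B hA hB

/-- The double brackets `[[a,a],b]` vanish. -/
theorem br_sq (a b : Free α) : br (br a a) b = 0 := by
  have := br_jacobi a a b
  simpa using this

/-- The squaring map `a ↦ [a,a]`, which is additive. -/
def sq : Free α →+ Free α :=
  AddMonoidHom.mk' (fun a => br a a) fun a b => by
    have := br_skew a b
    simp only [map_add, AddMonoidHom.add_apply]
    rw [eq_neg_of_add_eq_zero_left this]; abel

theorem sq_apply (a : Free α) : sq a = br a a := rfl

end Free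

/-- The semidirect product of a quasi-Lie ring and a module. -/
def QLie.semi {N M : Type*} [AddCommGroup N] [AddCommGroup M] (Q : QLie N) (act : N →+ M →+ M)
    (h : ∀ a b m, act (Q.br a b) m = act a (act b m) - act b (act a m)) : QLie (N × M) where
  br := biadd (fun a b => (Q.br a.1 b.1, act a.1 b.2 - act b.1 a.2))
    (fun a a' b => by ext <;> simp; abel) (fun a b b' => by ext <;> simp; abel)
  skew a b := by ext <;> simp [Q.skew]
  jacobi a b c := by
    ext
    · simp [Q.jacobi a.1]
    · simp [h]; abel

@[simp] theorem QLie.semi_br {N M : Type*} [AddCommGroup N] [AddCommGroup M] (Q : QLie N)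
    (act : N →+ M →+ M) (h) (a b : N × M) :
    (Q.semi act h).br a b = (Q.br a.1 b.1, act a.1 b.2 - act b.1 a.2) := rfl

namespace Free

variable {α M : Type*} [AddCommGroup M]

theorem fst_lift_semi (act : Free α →+ M →+ M) (h) (g : α → M) (a : Free α) :
    (lift ((qlie α).semi act h) (fun x => (ev (.of x), g x)) a).1 = a := by
  have := ext_of_mul (φ := (AddMonoidHom.fst _ _).comp
    (lift ((qlie α).semi act h) (fun x => (ev (.of x), g x)))) (ψ := AddMonoidHom.id (Free α))
    (fun x => by simp) (fun A B hA hB => by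
      simp only [AddMonoidHom.comp_apply, AddMonoidHom.coe_fst, AddMonoidHom.id_apply] at hA hB
      simp only [AddMonoidHom.comp_apply, AddMonoidHom.coe_fst, AddMonoidHom.id_apply, lift_br]
      simp [hA, hB])
  exact DFunLike.congr_fun this a

/-- The derivation into a module with prescribed values on letters. -/
def deriv (act : Free α →+ M →+ M)
    (h : ∀ a b m, act (br a b) m = act a (act b m) - act b (act a m)) (g : α → M) : Free α →+ M :=
  (AddMonoidHom.snd _ _).comp (lift ((qlie α).semi act h) (fun x => (ev (.of x), g x)))

@[simp] theorem deriv_of (act : Free α →+ M →+ M) (h) (g : α → M) (x : α) :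
    deriv act h g (ev (.of x)) = g x := by simp [deriv]

theorem deriv_br (act : Free α →+ M →+ M) (h) (g : α → M) (a b : Free α) :
    deriv act h g (br a b) = act a (deriv act h g b) - act b (deriv act h g a) := by
  have ha := fst_lift_semi act h g a
  have hb := fst_lift_semi act h g b
  simp only [deriv, AddMonoidHom.comp_apply, lift_br]
  refine (congrArg Prod.snd (QLie.semi_br (qlie α) act h _ _)).trans ?_
  simp only [ha, hb]
  rfl

/-- The coadjoint cocycle with prescribed values on letters. -/
def coc (g : α → Free α →+ M) : Free α →+ Free α →+ M :=
  deriv (M := Free α →+ M)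
    (biadd (fun a φ => -(φ.comp (br a))) (fun a a' φ => by ext; simp; abel)
      (fun a φ ψ => by ext; simp; abel))
    (fun a b φ => by ext C; simp [br_jacobi a]) g

@[simp] theorem coc_of (g : α → Free α →+ M) (x : α) : coc g (ev (.of x)) = g x := by
  simp [coc]

theorem coc_br (g : α → Free α →+ M) (a b c : Free α) :
    coc g (br a b) c = coc g a (br b c) - coc g b (br a c) := by
  simp only [coc, deriv_br]
  simp; abel

/-- Uniqueness of coadjoint cocycles. -/
theorem eq_coc (g : α → Free α →+ M) (φ : Free α →+ Free α →+ M)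
    (hof : ∀ x, φ (ev (.of x)) = g x)
    (hbr : ∀ a b c, φ (br a b) c = φ a (br b c) - φ b (br a c)) : φ = coc g := by
  refine ext_of_mul (fun x => by simp [hof]) fun A B hA hB => ?_
  ext C
  rw [hbr, coc_br, hA, hB]

/-- The additive map applying to each monomial a map that depends on its letters. -/
def select (w : Multiset α → Free α →+ M) : Free α →+ M :=
  desc (fun A => w (letters A) (ev A)) fun z hz => by
    induction hz generalizing w with
    | skew A B =>
      simp only [map_add, FreeAbelianGroup.lift_apply_of, letters_mul, ev_mul,
        add_comm (letters B)]
      rw [← map_add, br_skew, map_zero]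
    | jacobi A B C =>
      have h2 : letters B + (letters A + letters C) = letters A + letters B + letters C := by abel
      simp only [map_sub, FreeAbelianGroup.lift_apply_of, letters_mul, ← add_assoc, h2, ev_mul]
      rw [← map_sub, ← map_sub, br_jacobi]
      simp
    | @mul_right z hz B ih =>
      rw [lift_mul_of, ← ih fun d => (w (d + letters B)).comp (br.flip (ev B))]
      simp
    | @mul_left A z hz ih =>
      rw [lift_of_mul, ← ih fun d => (w (letters A + d)).comp (br (ev A))]
      simp

@[simp] theorem select_ev (w : Multiset α → Free α →+ M) (A : FreeMagma α) :
    select w (ev A) = w (letters A) (ev A) := by simp [select]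

open Classical in
/-- The additive map keeping the monomials whose letters satisfy a predicate. -/
noncomputable def proj (p : Multiset α → Prop) : Free α →+ Free α :=
  select fun d => if p d then AddMonoidHom.id _ else 0

theorem proj_ev_of_pos {p : Multiset α → Prop} {A : FreeMagma α} (h : p (letters A)) :
    proj p (ev A) = ev A := by simp [proj, h]

theorem proj_ev_of_neg {p : Multiset α → Prop} {A : FreeMagma α} (h : ¬p (letters A)) :
    proj p (ev A) = 0 := by simp [proj, h]

theorem proj_mem {p : Multiset α → Prop} {u : Free α} (H : AddSubgroup (Free α))
    (h : ∀ d, p d → proj (· = d) u ∈ H) : proj p u ∈ H := by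
  classical
  have h1 : proj p = (Finsupp.liftAddHom fun d => if p d then AddMonoidHom.id (Free α) else 0).comp
      (select Finsupp.singleAddHom) := by
    ext A
    simp [proj]
  have h2 (d : Multiset α) : proj (· = d) =
      (Finsupp.applyAddHom d).comp (select (α := α) Finsupp.singleAddHom) := by
    ext A
    by_cases hd : letters A = d <;> simp [proj, hd]
  rw [h1, AddMonoidHom.comp_apply, Finsupp.liftAddHom_apply]
  refine sum_mem fun d _ => ?_
  by_cases hd : p d
  · have := h d hd
    rw [h2] at this
    simpa [hd] using this
  · simp [hd]

theorem mem_of_proj {u : Free α} (H : AddSubgroup (Free α)) (h : ∀ d, proj (· = d) u ∈ H) :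
    u ∈ H := by
  have h1 : proj (fun _ => True) = AddMonoidHom.id (Free α) := by
    ext A; exact proj_ev_of_pos trivial
  rw [← AddMonoidHom.id_apply (Free α) u, ← h1]
  exact proj_mem H fun d _ => h d

theorem br_proj (y : α) (p : Multiset α → Prop) (u : Free α) :
    br (ev (.of y)) (proj (fun d => p (y ::ₘ d)) u) = proj p (br (ev (.of y)) u) := by
  have : (br (ev (.of y))).comp (proj fun d => p (y ::ₘ d)) =
      (proj p).comp (br (ev (.of y))) := by
    ext A
    by_cases h : p (y ::ₘ letters A)
    · simp [proj_ev_of_pos (p := fun d => p (y ::ₘ d)) h,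
        proj_ev_of_pos (p := p) (A := .of y * A) (by simpa using h)]
    · simp [proj_ev_of_neg (p := fun d => p (y ::ₘ d)) h,
        proj_ev_of_neg (p := p) (A := .of y * A) (by simpa using h)]
  exact DFunLike.congr_fun this u

/-- The span of the monomials whose letters satisfy a predicate. -/
def span (p : Multiset α → Prop) : AddSubgroup (Free α) :=
  AddSubgroup.closure {u | ∃ A, p (letters A) ∧ u = ev A}

theorem ev_mem_span {p : Multiset α → Prop} {A : FreeMagma α} (h : p (letters A)) :
    ev A ∈ span p := AddSubgroup.subset_closure ⟨A, h, rfl⟩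

theorem proj_mem_span (p : Multiset α → Prop) (u : Free α) : proj p u ∈ span p := by
  induction u using Free.induction with
  | h0 => simp
  | hneg u h => simpa using h
  | hadd u v h h' => rw [map_add]; exact add_mem h h'
  | hev A =>
    by_cases h : p (letters A)
    · rw [proj_ev_of_pos h]; exact ev_mem_span h
    · rw [proj_ev_of_neg h]; exact zero_mem _

theorem proj_eq_self {p : Multiset α → Prop} {u : Free α} (hu : u ∈ span p) : proj p u = u := by
  induction hu using AddSubgroup.closure_induction with
  | mem x hx => obtain ⟨A, hA, rfl⟩ := hx; exact proj_ev_of_pos hA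
  | zero => simp
  | add x y _ _ hx hy => rw [map_add, hx, hy]
  | neg x _ hx => rw [map_neg, hx]

theorem map_mem_of_mem_span {G : Type*} [AddCommGroup G] {p : Multiset α → Prop}
    (φ : Free α →+ G) (H : AddSubgroup G) (h : ∀ A, p (letters A) → φ (ev A) ∈ H)
    {u : Free α} (hu : u ∈ span p) : φ u ∈ H :=
  (AddSubgroup.closure_le (H.comap φ)).2 (by rintro _ ⟨A, hA, rfl⟩; exact h A hA) hu

theorem span_mono {p q : Multiset α → Prop} (h : ∀ d, p d → q d) : span p ≤ span q :=
  AddSubgroup.closure_mono (by rintro _ ⟨A, hA, rfl⟩; exact ⟨A, h _ hA, rfl⟩)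

/-- The span of the monomials of degree at most `n`. -/
def fil (α : Type*) (n : ℕ) : AddSubgroup (Free α) := span fun d => d.card ≤ n

theorem fil_mono {m n : ℕ} (h : m ≤ n) : fil α m ≤ fil α n := span_mono fun _ hd => hd.trans h

theorem br_mem_fil {m n : ℕ} {a b : Free α} (ha : a ∈ fil α m) (hb : b ∈ fil α n) :
    br a b ∈ fil α (m + n) := by
  refine map_mem_of_mem_span (br.flip b) _ (fun A hA => ?_) ha
  refine map_mem_of_mem_span (br (ev A)) _ (fun B hB => ?_) hb
  rw [br_ev]
  exact ev_mem_span (by simpa using add_le_add hA hB)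

theorem eq_zero_of_mem_fil_zero {a : Free α} (ha : a ∈ fil α 0) : a = 0 :=
  map_mem_of_mem_span (AddMonoidHom.id _) ⊥
    (fun A hA => absurd (Multiset.card_eq_zero.1 (Nat.le_zero.1 hA)) (letters_ne_zero A)) ha

end Free
end QuasiLie

namespace QuasiLie

/-- The relators of the group of unrooted trees, presented by pairs of rooted trees. -/
inductive TRelator {α : Type*} : FreeAbelianGroup (FreeMagma α × FreeMagma α) → Prop
  | symm (A B : FreeMagma α) :
      TRelator (FreeAbelianGroup.of (A, B) - FreeAbelianGroup.of (B, A))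
  | slide (A B C : FreeMagma α) :
      TRelator (FreeAbelianGroup.of (A * B, C) - FreeAbelianGroup.of (A, B * C))
  | skew (A B C : FreeMagma α) :
      TRelator (FreeAbelianGroup.of (A * B, C) + FreeAbelianGroup.of (B * A, C))
  | jacobi (A B C D : FreeMagma α) :
      TRelator (FreeAbelianGroup.of (A * (B * C), D) - FreeAbelianGroup.of (A * B * C, D) -
        FreeAbelianGroup.of (B * (A * C), D))

/-- The group of unrooted trees with univalent vertices labeled by an alphabet. -/
def TG (α : Type*) : Type _ :=
  FreeAbelianGroup (FreeMagma α × FreeMagma α) ⧸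
    AddSubgroup.closure {z : FreeAbelianGroup (FreeMagma α × FreeMagma α) | TRelator z}

instance (α : Type*) : AddCommGroup (TG α) :=
  inferInstanceAs (AddCommGroup (FreeAbelianGroup (FreeMagma α × FreeMagma α) ⧸
    AddSubgroup.closure {z : FreeAbelianGroup (FreeMagma α × FreeMagma α) | TRelator z}))

namespace TG

open Free

variable {α : Type*} {M : Type*} [AddCommGroup M]

/-- The projection from formal sums of pairs of rooted trees. -/
def mk : FreeAbelianGroup (FreeMagma α × FreeMagma α) →+ TG α := QuotientAddGroup.mk' _

theorem mk_eq_zero {z : FreeAbelianGroup (FreeMagma α × FreeMagma α)} (hz : TRelator z) :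
    mk z = 0 :=
  (QuotientAddGroup.eq_zero_iff _).2 (AddSubgroup.subset_closure hz)

/-- The tree obtained by joining the roots of two rooted trees. -/
def tr (A B : FreeMagma α) : TG α := mk (FreeAbelianGroup.of (A, B))

@[simp] theorem mk_of (A B : FreeMagma α) : mk (FreeAbelianGroup.of (A, B)) = tr A B := rfl

theorem tr_symm (A B : FreeMagma α) : tr A B = tr B A := by
  simpa [sub_eq_zero] using mk_eq_zero (TRelator.symm A B)

theorem tr_slide (A B C : FreeMagma α) : tr (A * B) C = tr A (B * C) := by
  simpa [sub_eq_zero] using mk_eq_zero (TRelator.slide A B C)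

theorem tr_skew (A B C : FreeMagma α) : tr (A * B) C = -tr (B * A) C := by
  simpa [add_eq_zero_iff_eq_neg] using mk_eq_zero (TRelator.skew A B C)

/-- Additive maps out of the group of unrooted trees. -/
def desc (f : FreeMagma α → FreeMagma α → M)
    (hf : ∀ z, TRelator z → FreeAbelianGroup.lift (fun p => f p.1 p.2) z = 0) : TG α →+ M :=
  QuotientAddGroup.lift _ (FreeAbelianGroup.lift fun p => f p.1 p.2)
    ((AddSubgroup.closure_le _).2 hf)

@[simp] theorem desc_tr (f : FreeMagma α → FreeMagma α → M) (hf) (A B : FreeMagma α) :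
    desc f hf (tr A B) = f A B :=
  FreeAbelianGroup.lift_apply_of (fun p : FreeMagma α × FreeMagma α => f p.1 p.2) (A, B)

theorem mk_surjective : Function.Surjective (mk : _ →+ TG α) :=
  QuotientAddGroup.mk'_surjective _

@[ext] theorem hom_ext {φ ψ : TG α →+ M} (h : ∀ A B, φ (tr A B) = ψ (tr A B)) : φ = ψ := by
  ext u
  obtain ⟨z, rfl⟩ := mk_surjective u
  exact DFunLike.congr_fun (FreeAbelianGroup.lift_ext (φ.comp mk) (ψ.comp mk)
    fun p => h p.1 p.2) z

/-- Induction on elements of the group of unrooted trees. -/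
theorem induction {p : TG α → Prop} (t : TG α) (htr : ∀ A B, p (tr A B)) (h0 : p 0)
    (hneg : ∀ t, p t → p (-t)) (hadd : ∀ s t, p s → p t → p (s + t)) : p t := by
  obtain ⟨z, rfl⟩ := mk_surjective t
  induction z using FreeAbelianGroup.induction_on with
  | zero => simpa using h0
  | of x => exact htr x.1 x.2
  | neg x hx => rw [map_neg]; exact hneg _ hx
  | add x y hx hy => rw [map_add]; exact hadd _ _ hx hy

theorem lift_tr_eq_zero (z : FreeAbelianGroup (FreeMagma α)) (hz : Relator z) (C : FreeMagma α) :
    FreeAbelianGroup.lift (fun A => tr A C) z = 0 := by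
  induction hz generalizing C with
  | skew A B => simp [tr_skew A B]
  | jacobi A B D =>
    simpa using mk_eq_zero (TRelator.jacobi A B D C)
  | @mul_right z hz B ih =>
    rw [lift_mul_of, ← ih (B * C)]
    simp only [tr_slide]
  | @mul_left A z hz ih =>
    have := map_lift (negAddMonoidHom : TG α →+ TG α) (fun B => tr B (A * C)) z
    rw [ih (A * C), map_zero] at this
    rw [lift_of_mul]
    refine Eq.trans ?_ this.symm
    congr 2
    funext B
    rw [tr_skew, tr_slide]; rfl

/-- The inner product of two elements of the free quasi-Lie ring. -/
def form : Free α →+ Free α →+ TG α :=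
  Free.desc (fun A => Free.desc (fun B => tr A B) fun z hz => by
      simpa only [tr_symm A] using lift_tr_eq_zero z hz A)
    fun z hz => Free.hom_ext fun B => by
      have := map_lift (AddMonoidHom.eval (ev B) : (Free α →+ TG α) →+ TG α)
        (fun A => Free.desc (fun B => tr A B) fun z hz => by
          simpa only [tr_symm A] using lift_tr_eq_zero z hz A) z
      simp only [AddMonoidHom.eval_apply_apply, Free.desc_ev] at this
      rw [this, lift_tr_eq_zero z hz]
      rfl

@[simp] theorem form_ev (A B : FreeMagma α) : form (ev A) (ev B) = tr A B := by simp [form]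

theorem form_symm (a b : Free α) : form a b = form b a :=
  biadd_ext (ψ := form.flip) (fun A B => by simpa using tr_symm A B) a b

theorem form_br (a b c : Free α) : form (br a b) c = form a (br b c) := by
  induction a using Free.induction with
  | h0 => simp
  | hneg u h => simp [h]
  | hadd u v h h' => simp [h, h']
  | hev A =>
    induction b using Free.induction with
    | h0 => simp
    | hneg u h => simp [h]
    | hadd u v h h' => simp [h, h']
    | hev B =>
      induction c using Free.induction with
      | h0 => simp
      | hneg u h => simp [h, -br_ev]
      | hadd u v h h' => simp [h, h', -br_ev]
      | hev C => simpa using tr_slide A B C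

/-- The universal property of the inner product: symmetric invariant forms. -/
def lift (F : Free α →+ Free α →+ M) (hs : ∀ a b, F a b = F b a)
    (hi : ∀ a b c, F (br a b) c = F a (br b c)) : TG α →+ M :=
  desc (fun A B => F (ev A) (ev B)) fun z hz => by
    induction hz with
    | symm A B => simp [hs (ev A)]
    | slide A B C => simp only [map_sub, FreeAbelianGroup.lift_apply_of, ev_mul, hi, sub_self]
    | skew A B C =>
      simp only [map_add, FreeAbelianGroup.lift_apply_of, ev_mul]
      rw [← AddMonoidHom.add_apply, ← map_add, br_skew]
      simp
    | jacobi A B C D =>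
      simp only [map_sub, FreeAbelianGroup.lift_apply_of, ev_mul, br_jacobi (ev A), map_add,
        AddMonoidHom.add_apply]
      abel

@[simp] theorem lift_form (F : Free α →+ Free α →+ M) (hs) (hi) (a b : Free α) :
    lift F hs hi (form a b) = F a b :=
  biadd_ext (φ := form.compr₂ (lift F hs hi)) (fun A B => by simp [lift]) a b

/-- The sum over all univalent vertices, with prescribed local contributions. -/
def eta (g : α → Free α →+ M) : TG α →+ M :=
  lift (coc g + (coc g).flip) (fun a b => by simp [add_comm]) fun a b c => by
    simp only [AddMonoidHom.add_apply, AddMonoidHom.flip_apply, coc_br, br_eq_neg c a,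
      br_eq_neg b a, map_neg]
    abel

theorem eta_form (g : α → Free α →+ M) (a b : Free α) :
    eta g (form a b) = coc g a b + coc g b a := lift_form _ _ _ a b

/-- The universal coadjoint cocycle. -/
noncomputable def rho : Free α →+ Free α →+ (α →₀ Free α) := coc Finsupp.singleAddHom

theorem rho_of (x : α) (r : Free α) : rho (ev (.of x)) r = Finsupp.single x r := by
  simp [rho]

theorem rho_br (a b c : Free α) : rho (br a b) c = rho a (br b c) - rho b (br a c) := coc_br _ a b c

theorem coc_eq_rho (g : α → Free α →+ M) (a b : Free α) :
    coc g a b = Finsupp.liftAddHom g (rho a b) := by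
  rw [← eq_coc g (rho.compr₂ (Finsupp.liftAddHom g)) (fun x => by ext; simp [rho_of])
    fun a b c => by
      simp only [AddMonoidHom.compr₂_apply, rho_br, map_sub]]
  simp

/-- The universal instance of `eta`. -/
noncomputable def etaU : TG α →+ (α →₀ Free α) := eta Finsupp.singleAddHom

theorem etaU_form (a b : Free α) : etaU (form a b) = rho a b + rho b a := eta_form _ a b

theorem eta_eq_etaU (g : α → Free α →+ M) (t : TG α) :
    eta g t = Finsupp.liftAddHom g (etaU t) := by
  have : eta g = (Finsupp.liftAddHom g).comp etaU := by
    ext A B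
    simp [← form_ev, eta_form, etaU_form, coc_eq_rho g]
  rw [this]; rfl

/-- The total bracket map. -/
noncomputable def mu : (α →₀ Free α) →+ Free α := Finsupp.liftAddHom fun x => br (ev (.of x))

@[simp] theorem mu_single (x : α) (r : Free α) : mu (Finsupp.single x r) = br (ev (.of x)) r := by
  simp [mu]

theorem mu_rho (a b : Free α) : mu (rho a b) = br a b := by
  rw [mu, ← coc_eq_rho, ← eq_coc _ br (fun _ => rfl) fun a b c => by simp [br_jacobi a]]

theorem mu_etaU (t : TG α) : mu (etaU t) = 0 := by
  have : mu.comp etaU = (0 : TG α →+ Free α) := by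
    ext A B
    simp only [← form_ev, AddMonoidHom.comp_apply, etaU_form, map_add, mu_rho, br_skew]
    rfl
  exact DFunLike.congr_fun this t

/-- The cut of a bracket monomial at its root. -/
noncomputable def cutTree : FreeMagma α → (α →₀ Free α) ⧸ (etaU (α := α)).range
  | .of _ => 0
  | .mul A B => QuotientAddGroup.mk' _ (rho (ev A) (ev B))

theorem cutTree_mul (A B : FreeMagma α) :
    cutTree (A * B) = QuotientAddGroup.mk' _ (rho (ev A) (ev B)) := rfl

/-- The inverse of the total bracket modulo the image of `etaU`. -/
noncomputable def cut : Free α →+ (α →₀ Free α) ⧸ (etaU (α := α)).range :=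
  Free.desc cutTree fun z hz => by
    cases hz with
    | skew A B =>
      simp only [map_add, FreeAbelianGroup.lift_apply_of, cutTree_mul]
      rw [← map_add, ← etaU_form]
      exact (QuotientAddGroup.eq_zero_iff _).2 ⟨_, rfl⟩
    | jacobi A B C =>
      simp only [map_sub, FreeAbelianGroup.lift_apply_of, cutTree_mul, ev_mul, rho_br]
      abel
    | @mul_right z hz B =>
      have := map_lift ((QuotientAddGroup.mk' (etaU (α := α)).range).comp (rho.flip (ev B)))
        ev z
      rw [lift_ev, Free.mk_eq_zero hz, map_zero] at this
      rw [lift_mul_of]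
      exact this.symm
    | @mul_left A z hz =>
      have := map_lift ((QuotientAddGroup.mk' (etaU (α := α)).range).comp (rho (ev A)))
        ev z
      rw [lift_ev, Free.mk_eq_zero hz, map_zero] at this
      rw [lift_of_mul]
      exact this.symm

theorem cut_br (a b : Free α) : cut (br a b) = QuotientAddGroup.mk' _ (rho a b) :=
  biadd_ext (φ := br.compr₂ cut) (ψ := rho.compr₂ (QuotientAddGroup.mk' _))
    (fun A B => by simp [cut, cutTree_mul]) a b

/-- The kernel of the total bracket is the image of `etaU`. -/
theorem exists_etaU_eq {z : α →₀ Free α} (hz : mu z = 0) : ∃ t, etaU t = z := by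
  have : cut.comp mu = QuotientAddGroup.mk' (etaU (α := α)).range := by
    refine Finsupp.addHom_ext fun x r => ?_
    simp [cut_br, rho_of]
  have h := DFunLike.congr_fun this z
  rw [AddMonoidHom.comp_apply, hz, map_zero] at h
  exact (QuotientAddGroup.eq_zero_iff _).1 h.symm

end TG
end QuasiLie

namespace QuasiLie

open Free

variable {α : Type*}

/-- The alphabet of iterated brackets `[y,[y,…,[y,x]]]` with `x ≠ y`. -/
abbrev Elim (y : α) : Type _ := ℕ × {x : α // x ≠ y}

namespace Elim

variable (y : α)

/-- The derivation of the free quasi-Lie ring on `Elim y` corresponding to bracketing with `y`. -/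
def D : Free (Elim y) →+ Free (Elim y) :=
  deriv br (fun a b m => by rw [br_jacobi a]; abel) fun w => ev (.of (w.1 + 1, w.2))

@[simp] theorem D_of (w : Elim y) : D y (ev (.of w)) = ev (.of (w.1 + 1, w.2)) := deriv_of _ _ _ _

theorem D_br (a b : Free (Elim y)) : D y (br a b) = br (D y a) b + br a (D y b) := by
  rw [D, deriv_br, br_eq_neg _ b]; abel

/-- The inclusion of the free quasi-Lie ring on `Elim y`. -/
def incl : Free (Elim y) →+ Free α :=
  lift (qlie α) fun w => (br (ev (.of y)))^[w.1] (ev (.of w.2.1))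

theorem incl_of (w : Elim y) :
    incl y (ev (.of w)) = (br (ev (.of y)))^[w.1] (ev (.of w.2.1)) := lift_of _ _ _

theorem incl_br (a b : Free (Elim y)) : incl y (br a b) = br (incl y a) (incl y b) := lift_br _ _ _ _

theorem incl_D (r : Free (Elim y)) : incl y (D y r) = br (ev (.of y)) (incl y r) := by
  have : (incl y).comp (D y) = (br (ev (.of y))).comp (incl y) :=
    ext_of_mul (fun w => by
      simp only [AddMonoidHom.comp_apply, D_of, incl_of, Function.iterate_succ_apply'])
      fun A B hA hB => by
        simp only [AddMonoidHom.comp_apply] at hA hB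
        simp only [AddMonoidHom.comp_apply, D_br, incl_br, map_add, hA, hB]
        rw [br_jacobi (ev (.of y))]
  exact DFunLike.congr_fun this r

/-- The extension of the free quasi-Lie ring on `Elim y` by the quasi-Lie ring on `y`. -/
def ext : QLie (ℤ × ZMod 2 × Free (Elim y)) where
  br := biadd (fun a b => (0, (a.1 * b.1 : ℤ),
      a.1 • D y b.2.2 - b.1 • D y a.2.2 + br a.2.2 b.2.2))
    (fun a a' b => by
      refine Prod.ext (by simp) (Prod.ext (by simp [add_mul]) ?_)
      simp [add_smul]; abel)
    (fun a b b' => by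
      refine Prod.ext (by simp) (Prod.ext (by simp [mul_add]) ?_)
      simp [add_smul]; abel)
  skew a b := by
    refine Prod.ext (by simp) (Prod.ext ?_ ?_)
    · simp only [biadd_apply, Prod.snd_add, Prod.fst_add, Int.cast_mul, mul_comm (b.1 : ZMod 2)]
      exact CharTwo.add_self_eq_zero _
    · simp only [biadd_apply, Prod.snd_add, br_eq_neg b.2.2, Prod.snd_zero]; abel
  jacobi a b c := by
    refine Prod.ext (by simp) (Prod.ext (by simp) ?_)
    simp only [biadd_apply, Prod.snd_add, map_add, map_sub, map_zsmul, D_br,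
      AddMonoidHom.add_apply, AddMonoidHom.sub_apply, AddMonoidHom.zsmul_apply,
      br_jacobi a.2.2, zero_smul, br_eq_neg b.2.2 (D y a.2.2)]
    simp only [smul_add, smul_sub, smul_neg, smul_comm b.1 a.1, smul_comm c.1 a.1,
      smul_comm c.1 b.1]
    abel

theorem ext_br (a b : ℤ × ZMod 2 × Free (Elim y)) : (ext y).br a b =
    ((0 : ℤ), ((a.1 * b.1 : ℤ) : ZMod 2), a.1 • D y b.2.2 - b.1 • D y a.2.2 + br a.2.2 b.2.2) := rfl

open Classical in
/-- The splitting of the free quasi-Lie ring into the parts generated by `y` and by `Elim y`. -/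
noncomputable def split : Free α →+ ℤ × ZMod 2 × Free (Elim y) :=
  lift (ext y) fun x => if h : x = y then (1, 0, 0) else (0, 0, ev (.of (0, ⟨x, h⟩)))

theorem split_self : split y (ev (.of y)) = (1, 0, 0) := by simp [split]

theorem split_of_ne {x : α} (h : x ≠ y) :
    split y (ev (.of x)) = (0, 0, ev (.of (0, ⟨x, h⟩))) := by simp [split, h]

theorem split_br (a b : Free α) : split y (br a b) = (ext y).br (split y a) (split y b) :=
  lift_br _ _ _ _

theorem split_incl (r : Free (Elim y)) : split y (incl y r) = (0, 0, r) := by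
  have : (split y).comp (incl y) = (AddMonoidHom.inr _ _).comp (AddMonoidHom.inr _ _) := by
    refine ext_of_mul (fun w => ?_) fun A B hA hB => ?_
    · obtain ⟨k, x, hx⟩ := w
      simp only [AddMonoidHom.comp_apply, incl_of, AddMonoidHom.inr_apply]
      induction k with
      | zero => simp [split_of_ne y hx]
      | succ k ih => rw [Function.iterate_succ_apply', split_br, ih, split_self, ext_br]; simp
    · simp only [AddMonoidHom.comp_apply, AddMonoidHom.inr_apply] at hA hB
      simp [incl_br, split_br, hA, hB, ext_br, -br_ev]
  exact DFunLike.congr_fun this r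

theorem incl_injective : Function.Injective (incl y) := fun a b h => by
  have := congrArg (split y) h
  simpa [split_incl] using this

theorem D_mem_fil {n : ℕ} {r : Free (Elim y)} (hr : r ∈ fil _ n) : D y r ∈ fil _ n := by
  have key (A : FreeMagma (Elim y)) : D y (ev A) ∈ fil _ (letters A).card := by
    induction A with
    | ih1 w => rw [D_of]; exact ev_mem_span (by simp)
    | ih2 A B hA hB =>
      rw [ev_mul, D_br, letters_mul, Multiset.card_add]
      exact add_mem (br_mem_fil hA (ev_mem_span le_rfl)) (br_mem_fil (ev_mem_span le_rfl) hB)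
  exact map_mem_of_mem_span _ _ (fun A hA => fil_mono hA (key A)) hr

open Classical in
theorem exists_ev_eq (A : FreeMagma α) : ∃ (c e : ℤ), ∃ r ∈ fil (Elim y)
    ((letters A).filter (· ≠ y)).card,
    ev A = c • ev (.of y) + e • br (ev (.of y)) (ev (.of y)) + incl y r := by
  induction A with
  | ih1 x =>
    by_cases h : x = y
    · subst h
      exact ⟨1, 0, 0, zero_mem _, by simp⟩
    · exact ⟨0, 0, ev (.of (0, ⟨x, h⟩)), ev_mem_span (by simp [Multiset.filter_singleton, h]),
        by simp [incl_of]⟩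
  | ih2 A B hA hB =>
    obtain ⟨c, e, r, hr, hA⟩ := hA
    obtain ⟨c', e', r', hr', hB⟩ := hB
    refine ⟨0, c * c', c • D y r' - c' • D y r + br r r', ?_, ?_⟩
    · rw [letters_mul, Multiset.filter_add, Multiset.card_add]
      exact add_mem (sub_mem (zsmul_mem (D_mem_fil y (fil_mono (Nat.le_add_left _ _) hr')) _)
        (zsmul_mem (D_mem_fil y (fil_mono (Nat.le_add_right _ _) hr)) _)) (br_mem_fil hr hr')
    · have h0 (z : Free α) : br z (br (ev (.of y)) (ev (.of y))) = 0 := by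
        rw [br_eq_neg, br_sq, neg_zero]
      rw [ev_mul, hA, hB]
      simp only [map_add, map_sub, map_zsmul, AddMonoidHom.add_apply, AddMonoidHom.zsmul_apply,
        br_sq, h0, incl_D, incl_br, smul_zero, br_eq_neg (incl y r) (ev (.of y)), smul_neg,
        mul_smul, zero_smul, smul_add, smul_comm c' c, add_zero, zero_add]
      abel

open Classical in
/-- Elimination: every homogeneous element is a combination of `y`, `[y,y]` and an element of the
free quasi-Lie ring on `Elim y`. -/
theorem exists_eq {d : Multiset α} {u : Free α} (hu : u ∈ span (· = d)) :
    ∃ (c e : ℤ), ∃ r ∈ fil (Elim y) (d.filter (· ≠ y)).card,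
      u = c • ev (.of y) + e • br (ev (.of y)) (ev (.of y)) + incl y r := by
  induction hu using AddSubgroup.closure_induction with
  | mem x hx => obtain ⟨A, rfl, rfl⟩ := hx; exact exists_ev_eq y A
  | zero => exact ⟨0, 0, 0, zero_mem _, by simp⟩
  | add a b _ _ ha hb =>
    obtain ⟨c, e, r, hr, rfl⟩ := ha
    obtain ⟨c', e', r', hr', rfl⟩ := hb
    exact ⟨c + c', e + e', r + r', add_mem hr hr', by simp only [add_smul, map_add]; abel⟩
  | neg a _ ha =>
    obtain ⟨c, e, r, hr, rfl⟩ := ha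
    exact ⟨-c, -e, -r, neg_mem hr, by simp only [neg_smul, map_neg]; abel⟩

end Elim
end QuasiLie

namespace QuasiLie

open Free

namespace Free

variable {α : Type*}

/-- The linear part of an element of the free quasi-Lie ring. -/
noncomputable def lin : Free α →+ (α →₀ ℤ) := deriv 0 (by simp) fun x => Finsupp.single x 1

@[simp] theorem lin_of (x : α) : lin (ev (.of x)) = Finsupp.single x 1 := deriv_of _ _ _ _

@[simp] theorem lin_br (a b : Free α) : lin (br a b) = 0 := by simp [lin, deriv_br]

@[simp] theorem lin_mul (A B : FreeMagma α) : lin (ev (A * B)) = 0 := by rw [ev_mul, lin_br]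

/-- The combinations of a letter and a square. -/
def sqs (y : α) : AddSubgroup (Free α) := sq.range ⊔ AddSubgroup.zmultiples (ev (.of y))

theorem mem_sqs {y : α} {u : Free α} :
    u ∈ sqs y ↔ ∃ (a : Free α) (c : ℤ), br a a + c • ev (.of y) = u := by
  simp [sqs, AddSubgroup.mem_sup, AddSubgroup.mem_zmultiples_iff, sq_apply]

end Free

namespace Elim

universe u

open Classical in
theorem proj_mem_sqs (N : ℕ) : ∀ (α : Type u) (y : α) (u : Free α) (d : Multiset α),
    d.card ≤ N → br (ev (.of y)) u = 0 → proj (· = d) u ∈ sqs y := by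
  induction N with
  | zero =>
    intro α y u d hd _
    obtain rfl := Multiset.card_eq_zero.1 (Nat.le_zero.1 hd)
    rw [eq_zero_of_mem_fil_zero (span_mono (by rintro _ rfl; simp) (proj_mem_span (· = 0) u))]
    exact zero_mem _
  | succ N ih =>
    intro α y u d hd hu
    have hv : br (ev (.of y)) (proj (· = d) u) = 0 := by
      have := br_proj y (· = y ::ₘ d) u
      rw [hu, map_zero] at this
      simpa only [Multiset.cons_inj_right] using this
    obtain ⟨x, hx, hxy⟩ | hy := Classical.em (∃ x ∈ d, x ≠ y)
    · obtain ⟨c, e, r, hr, h⟩ := exists_eq x (proj_mem_span (· = d) u)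
      rw [h] at hv ⊢
      have hr' : r ∈ fil (Elim x) N := by
        refine fil_mono (Nat.le_of_lt_succ (lt_of_lt_of_le ?_ hd)) hr
        exact Multiset.card_lt_card (lt_of_le_of_ne (Multiset.filter_le _ _)
          fun h => Multiset.filter_eq_self.1 h x hx rfl)
      have hyx : incl x (ev (.of (0, ⟨y, hxy.symm⟩))) = ev (.of y) := incl_of _ _
      have hyx' : incl x (ev (.of (1, ⟨y, hxy.symm⟩))) = br (ev (.of x)) (ev (.of y)) :=
        incl_of _ _
      have h1 : br (ev (.of (0, ⟨y, hxy.symm⟩))) r = c • ev (.of (1, ⟨y, hxy.symm⟩)) := by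
        refine incl_injective x ?_
        rw [incl_br, hyx, map_zsmul, hyx', ← sub_eq_zero, ← hv]
        simp only [map_add, map_zsmul, br_eq_neg (ev (.of y)) (br _ _), br_sq,
          br_eq_neg (ev (.of y)) (ev (.of x)), smul_neg, neg_zero, smul_zero]
        abel
      have hc : c = 0 := by
        have := congrArg (fun z => lin z (1, ⟨y, hxy.symm⟩)) h1
        simpa using this.symm
      rw [hc, zero_smul] at h1
      have hr2 : r ∈ sqs (α := Elim x) (0, ⟨y, hxy.symm⟩) := by
        rw [← proj_eq_self hr']
        exact proj_mem _ fun d hd => ih _ _ _ _ hd h1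
      obtain ⟨a, k, rfl⟩ := mem_sqs.1 hr2
      rw [hc, zero_smul, zero_add]
      refine add_mem (zsmul_mem (mem_sqs.2 ⟨ev (.of x), 0, by simp⟩) _)
        (mem_sqs.2 ⟨incl x a, k, by simp [incl_br, hyx]⟩)
    · push Not at hy
      obtain ⟨c, e, r, hr, h⟩ := exists_eq y (proj_mem_span (· = d) u)
      rw [Multiset.filter_eq_nil.2 fun x hx => by simpa using hy x hx] at hr
      rw [h, eq_zero_of_mem_fil_zero (a := r) (by simpa using hr), map_zero, add_zero, add_comm]
      exact add_mem (zsmul_mem (mem_sqs.2 ⟨ev (.of y), 0, by simp⟩) _)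
        (mem_sqs.2 ⟨0, c, by simp⟩)

/-- The centralizer of a letter consists of squares and multiples of the letter. -/
theorem mem_sqs_of_br_eq_zero {α : Type u} {y : α} {u : Free α} (h : br (ev (.of y)) u = 0) :
    u ∈ sqs y :=
  mem_of_proj _ fun d => proj_mem_sqs _ α y u d le_rfl h

/-- The kernel of the derivation `D` consists of squares. -/
theorem exists_eq_sq_of_D_eq_zero {α : Type u} {y : α} {r : Free (Elim y)} (h : D y r = 0) :
    ∃ a, br a a = r := by
  obtain ⟨a, c, hac⟩ := mem_sqs.1 (mem_sqs_of_br_eq_zero (y := y) (u := incl y r)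
    (by rw [← incl_D, h, map_zero]))
  refine ⟨(split y a).2.2, ?_⟩
  have := congrArg (fun z => (split y z).2.2) hac
  simpa [split_incl, split_br, ext_br, split_self] using this

end Elim
end QuasiLie

namespace QuasiLie

open Free

namespace TG

variable {α M : Type*} [AddCommGroup M]

/-- The additive map applying to each tree a map that depends on its labels. -/
def select (w : Multiset α → TG α →+ M) : TG α →+ M :=
  desc (fun A B => w (letters A + letters B) (tr A B)) fun z hz => by
    induction hz with
    | symm A B => simp [tr_symm A B, add_comm (letters A)]
    | slide A B C => simp [tr_slide, add_assoc]
    | skew A B C => simp [tr_skew A B, add_comm (letters A)]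
    | jacobi A B C D =>
      have h : letters B + (letters A + letters C) = letters A + (letters B + letters C) := by abel
      have := congrArg (w (letters A + (letters B + letters C) + letters D))
        (mk_eq_zero (TRelator.jacobi A B C D))
      simpa [h, add_assoc (letters A) (letters B) (letters C)] using this

@[simp] theorem select_tr (w : Multiset α → TG α →+ M) (A B : FreeMagma α) :
    select w (tr A B) = w (letters A + letters B) (tr A B) := by simp [select]

open Classical in
/-- The additive map keeping the trees whose labels satisfy a predicate. -/
noncomputable def proj (p : Multiset α → Prop) : TG α →+ TG α :=
  select fun d => if p d then AddMonoidHom.id _ else 0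

theorem proj_tr_of_pos {p : Multiset α → Prop} {A B : FreeMagma α}
    (h : p (letters A + letters B)) : proj p (tr A B) = tr A B := by simp [proj, h]

theorem proj_tr_of_neg {p : Multiset α → Prop} {A B : FreeMagma α}
    (h : ¬p (letters A + letters B)) : proj p (tr A B) = 0 := by simp [proj, h]

theorem proj_eq_zero {p : Multiset α → Prop} {t : TG α}
    (h : ∀ d, p d → proj (· = d) t = 0) : proj p t = 0 := by
  classical
  have h1 : proj p = (Finsupp.liftAddHom fun d => if p d then AddMonoidHom.id (TG α) else 0).comp
      (select Finsupp.singleAddHom) := by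
    ext A B
    simp [proj]
  have h2 (d : Multiset α) : proj (· = d) =
      (Finsupp.applyAddHom d).comp (select (α := α) Finsupp.singleAddHom) := by
    ext A B
    by_cases hd : letters A + letters B = d <;> simp [proj, hd]
  rw [h1, AddMonoidHom.comp_apply, Finsupp.liftAddHom_apply]
  refine Finset.sum_eq_zero fun d _ => ?_
  by_cases hd : p d
  · have := h d hd
    rw [h2] at this
    simpa [hd] using this
  · simp [hd]

theorem eq_zero_of_proj {t : TG α} (h : ∀ d, proj (· = d) t = 0) : t = 0 := by
  have h1 : proj (fun _ => True) = AddMonoidHom.id (TG α) := by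
    ext A B; exact proj_tr_of_pos trivial
  rw [← AddMonoidHom.id_apply (TG α) t, ← h1]
  exact proj_eq_zero fun d _ => h d

open Classical in
theorem coc_proj (g : α → Free α →+ M) (p : Multiset α → Prop) (A B : FreeMagma α) :
    coc (fun x => (g x).comp (Free.proj fun d => p (x ::ₘ d))) (ev A) (ev B) =
      if p (letters A + letters B) then coc g (ev A) (ev B) else 0 := by
  induction A generalizing B with
  | ih1 x =>
    by_cases h : p (x ::ₘ letters B)
    · simp [Free.proj_ev_of_pos (p := fun d => p (x ::ₘ d)) h, h]
    · simp [Free.proj_ev_of_neg (p := fun d => p (x ::ₘ d)) h, h]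
  | ih2 A A' hA hA' =>
    have h : letters A' + (letters A + letters B) = letters A + (letters A' + letters B) := by abel
    rw [ev_mul, coc_br, coc_br, br_ev, br_ev, hA, hA', letters_mul, letters_mul, letters_mul, h,
      add_assoc]
    split_ifs <;> simp

theorem eta_proj (g : α → Free α →+ M) (p : Multiset α → Prop) (t : TG α) :
    eta g (proj p t) = eta (fun x => (g x).comp (Free.proj fun d => p (x ::ₘ d))) t := by
  classical
  have : (eta g).comp (proj p) =
      eta (fun x => (g x).comp (Free.proj fun d => p (x ::ₘ d))) := by
    ext A B
    rw [AddMonoidHom.comp_apply, ← form_ev, eta_form, coc_proj, coc_proj, form_ev,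
      add_comm (letters B)]
    by_cases h : p (letters A + letters B)
    · rw [proj_tr_of_pos h, ← form_ev, eta_form]; simp [h]
    · rw [proj_tr_of_neg h]; simp [h]
  exact DFunLike.congr_fun this t

theorem etaU_proj_eq_zero {t : TG α} (ht : etaU t = 0) (p : Multiset α → Prop) :
    etaU (proj p t) = 0 := by
  rw [etaU, eta_proj, eta_eq_etaU, ht, map_zero]

/-- The span of the trees with at most `n` univalent vertices. -/
def fil (α : Type*) (n : ℕ) : AddSubgroup (TG α) :=
  AddSubgroup.closure {t | ∃ A B, (letters A).card + (letters B).card ≤ n ∧ t = tr A B}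

theorem fil_mono {m n : ℕ} (h : m ≤ n) : fil α m ≤ fil α n :=
  AddSubgroup.closure_mono (by rintro _ ⟨A, B, hAB, rfl⟩; exact ⟨A, B, hAB.trans h, rfl⟩)

theorem form_mem_fil {m n : ℕ} {a b : Free α} (ha : a ∈ Free.fil α m) (hb : b ∈ Free.fil α n) :
    form a b ∈ fil α (m + n) := by
  refine map_mem_of_mem_span (form.flip b) _ (fun A hA => ?_) ha
  refine map_mem_of_mem_span (form (ev A)) _ (fun B hB => ?_) hb
  rw [form_ev]
  exact AddSubgroup.subset_closure ⟨A, B, add_le_add hA hB, rfl⟩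

theorem proj_eq_self {n : ℕ} {t : TG α} (ht : t ∈ fil α n) :
    proj (fun d => d.card ≤ n) t = t := by
  induction ht using AddSubgroup.closure_induction with
  | mem x hx =>
    obtain ⟨A, B, hA, rfl⟩ := hx
    exact proj_tr_of_pos (p := fun d => d.card ≤ n) (by simpa using hA)
  | zero => simp
  | add x y _ _ hx hy => rw [map_add, hx, hy]
  | neg x _ hx => rw [map_neg, hx]

theorem exists_tr_eq {y : α} {e : Multiset α} (A B : FreeMagma α) (hy : y ∈ letters A)
    (h : letters A + letters B = y ::ₘ e) :
    ∃ u ∈ span (· = e), tr A B = form (ev (.of y)) u := by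
  induction A generalizing B with
  | ih1 x =>
    obtain rfl : y = x := by simpa using hy
    exact ⟨ev B, ev_mem_span (by simpa using h), by simp⟩
  | ih2 A A' hA hA' =>
    rw [letters_mul, Multiset.mem_add] at hy
    rw [letters_mul] at h
    obtain hy | hy := hy
    · obtain ⟨u, hu, h'⟩ := hA (A' * B) hy (by rw [← h, letters_mul, add_assoc])
      exact ⟨u, hu, by rw [tr_slide, h']⟩
    · obtain ⟨u, hu, h'⟩ := hA' (A * B) hy (by rw [← h, letters_mul]; abel)
      exact ⟨-u, neg_mem hu, by rw [tr_skew, tr_slide, h', map_neg]⟩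

theorem exists_proj_eq (y : α) (e : Multiset α) (t : TG α) :
    ∃ u ∈ span (· = e), proj (· = y ::ₘ e) t = form (ev (.of y)) u := by
  induction t using TG.induction with
  | h0 => exact ⟨0, zero_mem _, by simp⟩
  | hneg t h =>
    obtain ⟨u, hu, h⟩ := h
    exact ⟨-u, neg_mem hu, by simp [h]⟩
  | hadd s t h h' =>
    obtain ⟨u, hu, h⟩ := h
    obtain ⟨u', hu', h'⟩ := h'
    exact ⟨u + u', add_mem hu hu', by simp [h, h']⟩
  | htr A B =>
    by_cases h : letters A + letters B = y ::ₘ e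
    · rw [proj_tr_of_pos h]
      have hy : y ∈ letters A + letters B := h ▸ Multiset.mem_cons_self y e
      obtain hy | hy := Multiset.mem_add.1 hy
      · exact exists_tr_eq A B hy h
      · rw [tr_symm]
        exact exists_tr_eq B A hy (by rw [add_comm, h])
    · rw [proj_tr_of_neg h]
      exact ⟨0, zero_mem _, by simp⟩

theorem proj_zero (t : TG α) : proj (· = 0) t = 0 := by
  have : proj (· = 0) = (0 : TG α →+ TG α) := by
    ext A B
    exact proj_tr_of_neg (by simp [letters_ne_zero])
  rw [this]; rfl

end TG

end QuasiLie

namespace QuasiLie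

open Free

namespace Elim

open TG

universe u

variable {α : Type u} (y : α)

/-- The `y`-part of the splitting. -/
noncomputable def head : Free α →+ ℤ × ZMod 2 :=
  (AddMonoidHom.mk' (fun z => (z.1, z.2.1)) fun _ _ => rfl).comp (split y)

theorem head_apply (u : Free α) : head y u = ((split y u).1, (split y u).2.1) := rfl

theorem head_incl (r : Free (Elim y)) : head y (incl y r) = 0 := by
  rw [head_apply, split_incl]; rfl

/-- The part of the splitting in the free quasi-Lie ring on `Elim y`. -/
noncomputable def tail : Free α →+ Free (Elim y) :=
  ((AddMonoidHom.snd _ _).comp (AddMonoidHom.snd _ _)).comp (split y)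

theorem tail_incl (r : Free (Elim y)) : tail y (incl y r) = r := by
  simp [tail, split_incl]

theorem head_self : head y (ev (.of y)) = (1, 0) := by
  rw [head_apply, split_self]

theorem head_br_self : head y (br (ev (.of y)) (ev (.of y))) = (0, 1) := by
  rw [head_apply, split_br, split_self, ext_br]; simp

theorem head_br (a b : Free α) :
    head y (br a b) = ((0 : ℤ), (((head y a).1 * (head y b).1 : ℤ) : ZMod 2)) := by
  rw [head_apply, split_br, ext_br]; rfl

section

variable {M : Type*} [AddCommGroup M]

theorem incl_of_succ (k : ℕ) (x : {x : α // x ≠ y}) :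
    incl y (ev (.of (k + 1, x))) = br (ev (.of y)) (incl y (ev (.of (k, x)))) := by
  rw [← incl_D, D_of]

open Classical in
theorem coc_incl_eq_zero (r : Free (Elim y)) (c : Free α) :
    coc (fun x => if x = y then head y else 0) (incl y r) c = 0 := by
  have : (coc fun x => if x = y then head y else 0).comp (incl y) = 0 := by
    refine ext_of_mul (fun w => ?_) fun A B hA hB => ?_
    · obtain ⟨k, x⟩ := w
      simp only [AddMonoidHom.comp_apply, AddMonoidHom.zero_apply]
      induction k with
      | zero => simp [incl_of, x.2]
      | succ k ih =>
        ext1 c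
        rw [incl_of_succ, coc_br, ih, coc_of, if_pos rfl, head_br, head_incl]
        simp
    · simp only [AddMonoidHom.comp_apply, AddMonoidHom.zero_apply] at hA hB
      ext1 c
      simp [incl_br, coc_br, hA, hB, -br_ev]
  exact DFunLike.congr_fun (DFunLike.congr_fun this r) c

open Classical in
theorem exists_form_incl_eq {c e : ℤ} {r : Free (Elim y)} {u : Free α}
    (hu : u = c • ev (.of y) + e • br (ev (.of y)) (ev (.of y)) + incl y r)
    (ht : etaU (form (ev (.of y)) u) = 0) : u = incl y r := by
  have h := eta_eq_etaU (fun x => if x = y then head y else 0) (form (ev (.of y)) u)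
  have h1 : coc (fun x => if x = y then head y else 0) u (ev (.of y)) = (c, 0) := by
    rw [hu]
    simp only [map_add, map_zsmul, AddMonoidHom.add_apply, AddMonoidHom.zsmul_apply, coc_br,
      coc_incl_eq_zero, coc_of, if_pos, head_self]
    simp
  have h2 : coc (fun x => if x = y then head y else 0) (ev (.of y)) u = (c, (e : ZMod 2)) := by
    rw [hu]
    simp only [map_add, map_zsmul, coc_of, if_pos, head_self, head_br_self, head_incl]
    simp
  rw [ht, map_zero, eta_form, h1, h2] at h
  simp only [Prod.mk_add_mk, Prod.mk_eq_zero, add_zero] at h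
  obtain ⟨k, rfl⟩ := (ZMod.intCast_zmod_eq_zero_iff_dvd e 2).1 h.2
  obtain rfl : c = 0 := by omega
  have := br_skew (ev (.of y)) (ev (.of y))
  rw [hu, zero_smul, zero_add, mul_comm, mul_smul]
  simp only [Nat.cast_ofNat, two_smul, this, smul_zero, zero_add]

open Classical in
theorem coc_incl_incl (x : {x : α // x ≠ y}) (p q : Free (Elim y)) :
    coc (fun x' => if x' = x.1 then head y else 0) (incl y p) (incl y q) = 0 := by
  have : ((coc fun x' => if x' = x.1 then head y else 0).comp (incl y)).compl₂ (incl y) = 0 := by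
    refine ext_of_mul (fun w => ?_) fun A B hA hB => ?_
    · obtain ⟨k, x'⟩ := w
      refine AddMonoidHom.ext fun q => ?_
      simp only [AddMonoidHom.compl₂_apply, AddMonoidHom.comp_apply, AddMonoidHom.zero_apply]
      induction k generalizing q with
      | zero =>
        simp only [incl_of, Function.iterate_zero, id_eq, coc_of]
        split_ifs
        · exact head_incl y q
        · rfl
      | succ k ih =>
        rw [incl_of_succ, coc_br, coc_of, if_neg x.2.symm, ← incl_D, ih]
        simp
    · refine AddMonoidHom.ext fun q => ?_
      have hA' (q) := DFunLike.congr_fun hA q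
      have hB' (q) := DFunLike.congr_fun hB q
      simp only [AddMonoidHom.compl₂_apply, AddMonoidHom.comp_apply,
        AddMonoidHom.zero_apply] at hA' hB'
      simp only [AddMonoidHom.compl₂_apply, AddMonoidHom.comp_apply, AddMonoidHom.zero_apply,
        incl_br, coc_br]
      rw [← incl_br, ← incl_br, hA', hB', sub_zero]
  exact DFunLike.congr_fun (DFunLike.congr_fun this p) q

open Classical in
theorem coc_incl_self (x : {x : α // x ≠ y}) (r : Free (Elim y)) :
    coc (fun x' => if x' = x.1 then head y else 0) (incl y r) (ev (.of y)) =
      (lin r (0, x), ((lin r (1, x) : ℤ) : ZMod 2)) := by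
  let φ : (Elim y →₀ ℤ) →+ ℤ × ZMod 2 := AddMonoidHom.prod (Finsupp.applyAddHom (0, x))
    ((Int.castAddHom (ZMod 2)).comp (Finsupp.applyAddHom (1, x)))
  have : ((coc fun x' => if x' = x.1 then head y else 0).flip (ev (.of y))).comp (incl y) =
      φ.comp lin := by
    refine ext_of_mul (fun w => ?_) fun A B _ _ => ?_
    · obtain ⟨k, x'⟩ := w
      have hx' : (x'.1 = x.1) ↔ x' = x := Subtype.ext_iff.symm
      match k with
      | 0 =>
        simp only [AddMonoidHom.comp_apply, AddMonoidHom.flip_apply, incl_of, lin_of,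
          Function.iterate_zero, id_eq, coc_of, hx']
        by_cases h : x' = x
        · simp [h, φ, head_self]
        · simp [h, φ]; rfl
      | 1 =>
        simp only [AddMonoidHom.comp_apply, AddMonoidHom.flip_apply, incl_of, lin_of,
          Function.iterate_one, coc_of, hx', coc_br, if_neg x.2.symm]
        by_cases h : x' = x
        · simp [h, φ, head_br_self, -br_ev]
        · simp [h, φ]; rfl
      | k + 2 =>
        have h0 : br (ev (.of y)) (br (ev (.of y)) (ev (.of y))) = 0 := by
          rw [br_eq_neg, br_sq, neg_zero]
        simp only [AddMonoidHom.comp_apply, AddMonoidHom.flip_apply, incl_of_succ, lin_of,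
          coc_of, coc_br, if_neg x.2.symm, h0]
        simp [φ]; rfl
    · have h0 (a : Free (Elim y)) : br (incl y a) (ev (.of y)) = -incl y (D y a) := by
        rw [incl_D, br_eq_neg]
      simp only [AddMonoidHom.comp_apply, AddMonoidHom.flip_apply, incl_br, lin_br, map_zero,
        coc_br, h0, map_neg, coc_incl_incl]
      simp
  exact DFunLike.congr_fun this r

theorem lin_eq_zero {r : Free (Elim y)} (ht : etaU (form (ev (.of y)) (incl y r)) = 0)
    (x : {x : α // x ≠ y}) : lin r (0, x) = 0 ∧ (2 : ℤ) ∣ lin r (1, x) := by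
  classical
  have h := eta_eq_etaU (fun x' => if x' = x.1 then head y else 0)
    (form (ev (.of y)) (incl y r))
  rw [ht, map_zero, eta_form, coc_of, if_neg x.2.symm, AddMonoidHom.zero_apply, zero_add,
    coc_incl_self, Prod.mk_eq_zero] at h
  exact ⟨h.1, (ZMod.intCast_zmod_eq_zero_iff_dvd _ 2).1 h.2⟩

end

/-- The map of tree groups induced by `incl`. -/
def inclT : TG (Elim y) →+ TG α :=
  TG.lift ((form.compl₂ (incl y)).comp (incl y)) (fun a b => by simp [form_symm (incl y a)])
    fun a b c => by simp [incl_br, form_br]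

@[simp] theorem inclT_form (a b : Free (Elim y)) :
    inclT y (form a b) = form (incl y a) (incl y b) := lift_form _ _ _ a b

/-- The derivation `D` on the tree group. -/
def DT : TG (Elim y) →+ TG (Elim y) :=
  TG.lift (form.comp (D y) + form.compl₂ (D y)) (fun a b => by
      simp only [AddMonoidHom.add_apply, AddMonoidHom.comp_apply, AddMonoidHom.compl₂_apply,
        form_symm (D y a), form_symm _ (D y b)]
      abel)
    fun a b c => by
      simp only [AddMonoidHom.add_apply, AddMonoidHom.comp_apply, AddMonoidHom.compl₂_apply, D_br,
        form_br, map_add]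
      abel

theorem DT_form (a b : Free (Elim y)) : DT y (form a b) = form (D y a) b + form a (D y b) :=
  lift_form _ _ _ a b

theorem form_br_swap (z a b : Free α) : form (br z a) b = -form a (br z b) := by
  rw [br_eq_neg, map_neg, AddMonoidHom.neg_apply, form_br]

theorem inclT_DT (s : TG (Elim y)) : inclT y (DT y s) = 0 := by
  have : (inclT y).comp (DT y) = 0 := by
    ext A B
    rw [← form_ev]
    simp [DT_form, incl_D, form_br_swap, -form_ev]
  exact DFunLike.congr_fun this s

/-- The contribution of the linear part. -/
noncomputable def linT : (Elim y →₀ ℤ) →+ TG α :=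
  Finsupp.liftAddHom fun w => zmultiplesHom (TG α) (form (ev (.of y)) (incl y (ev (.of w))))

theorem form_incl_sub_mem {N : ℕ} {r : Free (Elim y)} (hr : r ∈ Free.fil _ N) :
    form (ev (.of y)) (incl y r) - linT y (lin r) ∈ (TG.fil _ N).map (inclT y) := by
  refine map_mem_of_mem_span ((form (ev (.of y))).comp (incl y) - (linT y).comp lin) _
    (fun A hA => ?_) hr
  cases A with
  | of w => simp [linT]
  | mul P Q =>
    change (form (ev (.of y))) (incl y (ev (P * Q))) - linT y (lin (ev (P * Q))) ∈ _
    rw [lin_mul, map_zero, sub_zero, ev_mul, incl_br, ← form_br, ← incl_D, ← inclT_form]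
    refine AddSubgroup.mem_map_of_mem _ (TG.fil_mono hA ?_)
    change _ ∈ TG.fil _ (letters (P * Q)).card
    rw [letters_mul, Multiset.card_add]
    exact form_mem_fil (D_mem_fil y (ev_mem_span le_rfl)) (ev_mem_span le_rfl)

theorem linT_eq_zero {r : Free (Elim y)} (ht : etaU (form (ev (.of y)) (incl y r)) = 0) :
    linT y (lin r) = 0 := by
  rw [linT, Finsupp.liftAddHom_apply]
  refine Finset.sum_eq_zero fun w _ => ?_
  obtain ⟨k, x⟩ := w
  obtain ⟨h0, c, h1⟩ := lin_eq_zero y ht x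
  change lin r (k, x) • form (ev (.of y)) (incl y (ev (.of (k, x)))) = 0
  match k with
  | 0 => rw [h0, zero_smul]
  | 1 =>
    have h2 : (2 : ℤ) • form (br (ev (.of y)) (ev (.of y))) = 0 := by
      rw [← map_zsmul, two_smul, br_skew, map_zero]
    rw [h1, mul_comm, mul_smul, incl_of_succ, ← form_br, ← AddMonoidHom.zsmul_apply, h2,
      AddMonoidHom.zero_apply, smul_zero]
  | k + 2 =>
    rw [incl_of_succ, incl_of_succ, ← form_br, ← form_br, br_sq, map_zero,
      AddMonoidHom.zero_apply, smul_zero]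

/-- The kernel elements come from the tree group on `Elim y`. -/
theorem exists_inclT_eq {N : ℕ} {r : Free (Elim y)} (hr : r ∈ Free.fil _ N)
    (ht : etaU (form (ev (.of y)) (incl y r)) = 0) :
    ∃ s ∈ TG.fil (Elim y) N, inclT y s = form (ev (.of y)) (incl y r) := by
  have := form_incl_sub_mem y hr
  rw [linT_eq_zero y ht, sub_zero] at this
  exact this

open Classical in
/-- The cocycle coefficients on `α` reading off the `Elim y`-part. -/
noncomputable def tailCoeff (x : α) : Free α →+ ({x : α // x ≠ y} →₀ Free (Elim y)) :=
  if h : x = y then 0 else (Finsupp.singleAddHom ⟨x, h⟩).comp (tail y)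

/-- The restriction of `tailCoeff` along `incl`. -/
noncomputable def foldCoeff (x : {x : α // x ≠ y}) :
    ℕ → Free (Elim y) →+ ({x : α // x ≠ y} →₀ Free (Elim y))
  | 0 => Finsupp.singleAddHom x
  | k + 1 => -(foldCoeff x k).comp (D y)

theorem coc_tailCoeff (p q : Free (Elim y)) :
    coc (tailCoeff y) (incl y p) (incl y q) = coc (fun w => foldCoeff y w.2 w.1) p q := by
  rw [← eq_coc (fun w => foldCoeff y w.2 w.1)
    (((coc (tailCoeff y)).comp (incl y)).compl₂ (incl y)) (fun w => ?_) fun a b c => ?_]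
  · rfl
  · obtain ⟨k, x⟩ := w
    refine AddMonoidHom.ext fun q => ?_
    simp only [AddMonoidHom.compl₂_apply, AddMonoidHom.comp_apply]
    induction k generalizing q with
    | zero => simp [incl_of, tailCoeff, foldCoeff, x.2, tail_incl]
    | succ k ih =>
      rw [incl_of_succ, coc_br, coc_of, ← incl_D, ih]
      simp [tailCoeff, foldCoeff]
  · simp [incl_br, coc_br]

theorem eta_inclT (s : TG (Elim y)) :
    eta (tailCoeff y) (inclT y s) = eta (fun w => foldCoeff y w.2 w.1) s := by
  have : (eta (tailCoeff y)).comp (inclT y) = eta fun w => foldCoeff y w.2 w.1 := by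
    ext1 A B
    rw [← form_ev, AddMonoidHom.comp_apply, inclT_form, eta_form, eta_form, coc_tailCoeff,
      coc_tailCoeff]
  exact DFunLike.congr_fun this s

/-- The derivation `D` on `Elim y →₀ Free (Elim y)`. -/
noncomputable def DF : (Elim y →₀ Free (Elim y)) →+ (Elim y →₀ Free (Elim y)) :=
  Finsupp.liftAddHom fun w =>
    Finsupp.singleAddHom (w.1 + 1, w.2) + (Finsupp.singleAddHom w).comp (D y)

@[simp] theorem DF_single (w : Elim y) (r : Free (Elim y)) :
    DF y (Finsupp.single w r) =
      Finsupp.single (w.1 + 1, w.2) r + Finsupp.single w (D y r) := by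
  simp [DF]

theorem mu_DF (z : Elim y →₀ Free (Elim y)) : mu (DF y z) = D y (mu z) := by
  have : mu.comp (DF y) = (D y).comp mu :=
    Finsupp.addHom_ext fun w r => by simp [D_br]
  exact DFunLike.congr_fun this z

theorem DF_rho (a b : Free (Elim y)) :
    DF y (rho a b) = rho (D y a) b + rho a (D y b) := by
  have : rho.compr₂ (DF y) = rho.comp (D y) + rho.compl₂ (D y) := by
    refine ext_of_mul (fun w => ?_) fun A B hA hB => AddMonoidHom.ext fun c => ?_
    · refine AddMonoidHom.ext fun r => ?_
      simp [rho_of]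
    · have hA' (q) := DFunLike.congr_fun hA q
      have hB' (q) := DFunLike.congr_fun hB q
      simp only [AddMonoidHom.compr₂_apply, AddMonoidHom.add_apply, AddMonoidHom.comp_apply,
        AddMonoidHom.compl₂_apply] at hA' hB'
      simp only [AddMonoidHom.compr₂_apply, AddMonoidHom.add_apply, AddMonoidHom.comp_apply,
        AddMonoidHom.compl₂_apply, rho_br, map_sub, map_add, hA', hB', D_br]
      abel
  exact DFunLike.congr_fun (DFunLike.congr_fun this a) b

theorem DF_etaU (s : TG (Elim y)) : DF y (etaU s) = etaU (DT y s) := by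
  have : (DF y).comp etaU = etaU.comp (DT y) := by
    ext1 A B
    rw [← form_ev, AddMonoidHom.comp_apply, AddMonoidHom.comp_apply, etaU_form, DT_form, map_add,
      map_add, etaU_form, etaU_form, DF_rho, DF_rho]
    abel
  exact DFunLike.congr_fun this s

/-- The elements killed by folding lie in the image of `DF`. -/
theorem exists_DF_eq {z : Elim y →₀ Free (Elim y)}
    (hz : Finsupp.liftAddHom (fun w : Elim y => foldCoeff y w.2 w.1) z = 0) :
    ∃ z', DF y z' = z := by
  let J : ({x : α // x ≠ y} →₀ Free (Elim y)) →+ (Elim y →₀ Free (Elim y)) :=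
    Finsupp.liftAddHom fun x => Finsupp.singleAddHom (0, x)
  suffices h : ∀ z, z - J (Finsupp.liftAddHom (fun w : Elim y => foldCoeff y w.2 w.1) z) ∈
      (DF y).range by
    have := h z
    rw [hz, map_zero, sub_zero] at this
    exact this
  intro z
  induction z using Finsupp.induction_linear with
  | zero => simp
  | add a b ha hb =>
    rw [map_add, map_add, add_sub_add_comm]
    exact add_mem ha hb
  | single w r =>
    obtain ⟨k, x⟩ := w
    induction k generalizing r with
    | zero => simp [J, foldCoeff]
    | succ k ih =>
      have h := ih (D y r)
      have h2 : DF y (Finsupp.single (k, x) r) ∈ (DF y).range := ⟨_, rfl⟩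
      convert sub_mem h2 h using 1
      simp [foldCoeff]
      abel

theorem D_ev_mem_span (A : FreeMagma (Elim y)) :
    D y (ev A) ∈ span fun d => d.card = (letters A).card := by
  have h (A B : FreeMagma (Elim y)) {u v : Free (Elim y)}
      (hu : u ∈ span fun d => d.card = (letters A).card)
      (hv : v ∈ span fun d => d.card = (letters B).card) :
      br u v ∈ span fun d => d.card = (letters (A * B)).card := by
    refine map_mem_of_mem_span (br.flip v) _ (fun A' hA => ?_) hu
    refine map_mem_of_mem_span (br (ev A')) _ (fun B' hB => ?_) hv
    rw [br_ev]
    exact ev_mem_span (by simp [hA, hB])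
  induction A with
  | ih1 w => rw [D_of]; exact ev_mem_span (by simp)
  | ih2 A B hA hB =>
    rw [ev_mul, D_br]
    exact add_mem (h A B hA (ev_mem_span rfl)) (h A B (ev_mem_span rfl) hB)

theorem proj_form_D (N : ℕ) (A B : FreeMagma (Elim y)) :
    TG.proj (fun d => d.card ≤ N) (form (D y (ev A)) (ev B)) =
      if (letters A).card + (letters B).card ≤ N then form (D y (ev A)) (ev B) else 0 := by
  let φ : Free (Elim y) →+ TG (Elim y) :=
    (TG.proj fun d => d.card ≤ N).comp (form.flip (ev B)) -
      if (letters A).card + (letters B).card ≤ N then form.flip (ev B) else 0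
  have : φ (D y (ev A)) ∈ (⊥ : AddSubgroup (TG (Elim y))) := by
    refine map_mem_of_mem_span φ ⊥ (fun A' hA => ?_) (D_ev_mem_span y A)
    by_cases h : (letters A).card + (letters B).card ≤ N
    · simp [φ, h, proj_tr_of_pos (p := fun d => d.card ≤ N) (A := A') (B := B) (by simpa [hA])]
    · simp only [φ, h, if_false, sub_zero, AddMonoidHom.comp_apply, AddMonoidHom.flip_apply,
        form_ev]
      exact proj_tr_of_neg (p := fun d => d.card ≤ N) (by simpa [hA] using h)
  rw [AddSubgroup.mem_bot, AddMonoidHom.sub_apply, sub_eq_zero] at this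
  rw [← AddMonoidHom.flip_apply, ← AddMonoidHom.comp_apply, this]
  split_ifs <;> rfl

theorem inclT_proj_DT (N : ℕ) (s : TG (Elim y)) :
    inclT y (TG.proj (fun d => d.card ≤ N) (DT y s)) = 0 := by
  have : ((inclT y).comp (TG.proj fun d => d.card ≤ N)).comp (DT y) = 0 := by
    ext A B
    rw [← form_ev, AddMonoidHom.comp_apply, AddMonoidHom.comp_apply, DT_form, form_symm (ev A),
      map_add, proj_form_D, proj_form_D, add_comm (letters B).card]
    split_ifs
    · rw [form_symm _ (ev A), ← DT_form, inclT_DT]; rfl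
    · simp
  exact DFunLike.congr_fun this s

theorem form_D_self_mem (N : ℕ) (a : Free (Elim y)) : ∃ b : Free α,
    inclT y (TG.proj (fun d => d.card ≤ N) (form (D y a) a)) =
      form (ev (.of y)) (br b b) := by
  induction a using Free.induction with
  | h0 => exact ⟨0, by simp⟩
  | hneg u h => simpa using h
  | hadd u v hu hv =>
    obtain ⟨b, hb⟩ := hu
    obtain ⟨c, hc⟩ := hv
    refine ⟨b + c, ?_⟩
    have h1 : form (D y (u + v)) (u + v) = form (D y u) u + form (D y v) v + DT y (form u v) := by
      rw [DT_form, form_symm u (D y v)]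
      simp only [map_add, AddMonoidHom.add_apply]
      abel
    rw [h1, map_add, map_add, map_add, map_add, inclT_proj_DT, hb, hc, add_zero, ← sq_apply,
      ← sq_apply, ← sq_apply, map_add, map_add]
  | hev A =>
    rw [proj_form_D]
    split_ifs
    · exact ⟨incl y (ev A), by rw [inclT_form, incl_D, form_br]⟩
    · exact ⟨0, by simp⟩

end Elim

namespace TG

open Elim

universe u

open Classical in
theorem form_sq_eq_zero {α : Type u} {y : α} {b : Free α}
    (h : etaU (form (ev (.of y)) (br b b)) = 0) : form (ev (.of y)) (br b b) = 0 := by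
  have h1 := eta_eq_etaU (fun x => if x = y then AddMonoidHom.id (Free α) else 0)
    (form (ev (.of y)) (br b b))
  rw [h, map_zero, eta_form, coc_br, sub_self, add_zero, coc_of, if_pos rfl] at h1
  simp only [AddMonoidHom.id_apply] at h1
  rw [h1, map_zero]

theorem proj_eq_zero_of_etaU (N : ℕ) : ∀ (α : Type u) (t : TG α), etaU t = 0 →
    ∀ d : Multiset α, d.card ≤ N → proj (· = d) t = 0 := by
  induction N with
  | zero =>
    intro α t _ d hd
    obtain rfl := Multiset.card_eq_zero.1 (Nat.le_zero.1 hd)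
    exact proj_zero t
  | succ N ih =>
    intro α t ht d hd
    classical
    induction d using Multiset.induction with
    | empty => exact proj_zero t
    | cons y e _ =>
    have ht' := etaU_proj_eq_zero ht (· = y ::ₘ e)
    obtain ⟨u, hu, hu'⟩ := exists_proj_eq y e t
    rw [hu'] at ht' ⊢
    obtain ⟨c, k, r, hr, hur⟩ := Elim.exists_eq y hu
    obtain rfl := exists_form_incl_eq y hur ht'
    replace hr : r ∈ Free.fil _ N := Free.fil_mono
      ((Multiset.card_le_card (Multiset.filter_le _ e)).trans (by simpa using hd)) hr
    obtain ⟨s, hs, hs'⟩ := exists_inclT_eq y hr ht'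
    have h1 := eta_inclT y s
    rw [hs', eta_eq_etaU, ht', map_zero, eta_eq_etaU] at h1
    obtain ⟨z, hz⟩ := exists_DF_eq y h1.symm
    have h2 := mu_DF y z
    rw [hz, mu_etaU] at h2
    obtain ⟨a, ha⟩ := exists_eq_sq_of_D_eq_zero h2.symm
    obtain ⟨s', hz'⟩ := exists_etaU_eq (z := z - rho a a) (by rw [map_sub, mu_rho, ha, sub_self])
    have hk : etaU (s - form (D y a) a - DT y s') = 0 := by
      rw [map_sub, map_sub, ← DF_etaU, hz', map_sub, hz, DF_rho, etaU_form]
      abel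
    have h3 := congrArg (inclT y) (proj_eq_zero (p := fun d => d.card ≤ N) (ih _ _ hk))
    obtain ⟨b, hb⟩ := form_D_self_mem y N a
    rw [map_sub, map_sub, map_sub, map_sub, proj_eq_self hs, inclT_proj_DT, hb, hs', map_zero,
      sub_zero, sub_eq_zero] at h3
    rw [h3] at ht' ⊢
    exact form_sq_eq_zero ht'

theorem etaU_injective {α : Type u} : Function.Injective (etaU (α := α)) :=
  (injective_iff_map_eq_zero _).2 fun t ht =>
    eq_zero_of_proj fun d => proj_eq_zero_of_etaU d.card α t ht d le_rfl

end TG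

end QuasiLie

namespace QuasiLie

open Free TG

variable {m : ℕ}

/-- A rooted tree as a bracket monomial. -/
def ofRTree : RTree m → FreeMagma (Fin m)
  | .leaf i => .of i
  | .node A B => ofRTree A * ofRTree B

/-- A bracket monomial as a rooted tree. -/
def toRTree : FreeMagma (Fin m) → RTree m
  | .of i => .leaf i
  | .mul A B => .node (toRTree A) (toRTree B)

@[simp] theorem toRTree_mul (A B : FreeMagma (Fin m)) :
    toRTree (A * B) = .node (toRTree A) (toRTree B) := rfl

@[simp] theorem toRTree_ofRTree (A : RTree m) : toRTree (ofRTree A) = A := by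
  induction A with
  | leaf i => rfl
  | node A B hA hB => rw [ofRTree, toRTree_mul, hA, hB]

@[simp] theorem ofRTree_toRTree (A : FreeMagma (Fin m)) : ofRTree (toRTree A) = A := by
  induction A with
  | ih1 i => rfl
  | ih2 A B hA hB => rw [toRTree_mul, ofRTree, hA, hB]

@[simp] theorem card_letters_ofRTree (A : RTree m) : (letters (ofRTree A)).card = A.deg := by
  induction A with
  | leaf i => rfl
  | node A B hA hB => rw [ofRTree, letters_mul, Multiset.card_add, hA, hB, RTree.deg]

/-- The additive map induced by a one-hole context. -/
def ctxHom : Ctx m → Free (Fin m) →+ Free (Fin m)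
  | .hole => AddMonoidHom.id _
  | .nodeL c A => (br.flip (ev (ofRTree A))).comp (ctxHom c)
  | .nodeR A c => (br (ev (ofRTree A))).comp (ctxHom c)

theorem ev_ofRTree_fill (c : Ctx m) (A : RTree m) :
    ev (ofRTree (c.fill A)) = ctxHom c (ev (ofRTree A)) := by
  induction c with
  | hole => rfl
  | nodeL c B ih => simp [Ctx.fill, ctxHom, ofRTree, ← ih]
  | nodeR B c ih => simp [Ctx.fill, ctxHom, ofRTree, ← ih]

/-- The degree `n` part of a formal sum of rooted trees in the free quasi-Lie ring. -/
noncomputable def secFree (m n : ℕ) : FreeAbelianGroup (RTree m) →+ Free (Fin m) :=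
  (Free.proj fun d => d.card = n).comp (FreeAbelianGroup.lift fun A => ev (ofRTree A))

theorem secFree_of (n : ℕ) (A : RTree m) : secFree m n (FreeAbelianGroup.of A) =
    Free.proj (fun d => d.card = n) (ev (ofRTree A)) := by
  rw [secFree, AddMonoidHom.comp_apply, FreeAbelianGroup.lift_apply_of]

theorem secFree_eq_zero {n : ℕ} {x : FreeAbelianGroup (RTree m)} (hx : x ∈ quasiLieRels m n) :
    secFree m n x = 0 := by
  obtain ((⟨J, hJ, rfl⟩ | ⟨c, A, B, rfl⟩) | ⟨c, A, B, C, rfl⟩) := hx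
  · rw [secFree_of]
    exact Free.proj_ev_of_neg (p := fun d => d.card = n) (by simpa using hJ)
  · simp only [map_add, secFree_of, ev_ofRTree_fill, ofRTree, ev_mul]
    rw [← map_add, ← map_add, br_skew, map_zero, map_zero]
  · simp only [map_sub, secFree_of, ev_ofRTree_fill, ofRTree, ev_mul,
      br_jacobi (ev (ofRTree A)), map_add]
    abel

/-- The inclusion of the degree `n` part into the free quasi-Lie ring. -/
noncomputable def sec (m n : ℕ) : Lp m n →+ Free (Fin m) :=
  QuotientAddGroup.lift _ (secFree m n) ((AddSubgroup.closure_le _).2 fun _ => secFree_eq_zero)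

theorem sec_mk (n : ℕ) (A : RTree m) : sec m n (LpMk m n (FreeAbelianGroup.of A)) =
    Free.proj (fun d => d.card = n) (ev (ofRTree A)) := secFree_of n A

theorem lift_toRTree_eq_zero {G : Type*} [AddCommGroup G] {w : RTree m → G}
    (hs : ∀ (c : Ctx m) A B, w (c.fill (.node A B)) + w (c.fill (.node B A)) = 0)
    (hj : ∀ (c : Ctx m) A B C, w (c.fill (.node A (.node B C))) -
      w (c.fill (.node (.node A B) C)) - w (c.fill (.node B (.node A C))) = 0)
    {z : FreeAbelianGroup (FreeMagma (Fin m))} (hz : Relator z) :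
    FreeAbelianGroup.lift (fun A => w (toRTree A)) z = 0 := by
  induction hz generalizing w with
  | skew A B => simpa [Ctx.fill] using hs .hole (toRTree A) (toRTree B)
  | jacobi A B C => simpa [Ctx.fill] using hj .hole (toRTree A) (toRTree B) (toRTree C)
  | @mul_right z hz B ih =>
    rw [lift_mul_of]
    exact ih (w := fun T => w (.node T (toRTree B))) (fun c => hs (.nodeL c (toRTree B)))
      fun c => hj (.nodeL c (toRTree B))
  | @mul_left A z hz ih =>
    rw [lift_of_mul]
    exact ih (w := fun T => w (.node (toRTree A) T)) (fun c => hs (.nodeR (toRTree A) c))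
      fun c => hj (.nodeR (toRTree A) c)

theorem LpMk_eq_zero {n : ℕ} {x : FreeAbelianGroup (RTree m)} (hx : x ∈ quasiLieRels m n) :
    LpMk m n x = 0 := (QuotientAddGroup.eq_zero_iff _).2 (AddSubgroup.subset_closure hx)

/-- The projection of the free quasi-Lie ring onto its degree `n` part. -/
noncomputable def prj (m n : ℕ) : Free (Fin m) →+ Lp m n :=
  Free.desc (fun A => LpMk m n (FreeAbelianGroup.of (toRTree A))) fun z hz => by
    refine lift_toRTree_eq_zero (w := fun T => LpMk m n (FreeAbelianGroup.of T))
      (fun c A B => ?_) (fun c A B C => ?_) hz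
    · rw [← map_add]
      exact LpMk_eq_zero (Or.inl (Or.inr ⟨c, A, B, rfl⟩))
    · rw [← map_sub, ← map_sub]
      exact LpMk_eq_zero (Or.inr ⟨c, A, B, C, rfl⟩)

theorem prj_ev (n : ℕ) (A : FreeMagma (Fin m)) :
    prj m n (ev A) = LpMk m n (FreeAbelianGroup.of (toRTree A)) := Free.desc_ev _ _ _

theorem sec_prj (n : ℕ) (u : Free (Fin m)) :
    sec m n (prj m n u) = Free.proj (fun d => d.card = n) u := by
  have : (sec m n).comp (prj m n) = Free.proj fun d => d.card = n := by
    ext A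
    rw [AddMonoidHom.comp_apply, prj_ev, sec_mk, ofRTree_toRTree]
  exact DFunLike.congr_fun this u

theorem prj_sec (n : ℕ) (u : Lp m n) : prj m n (sec m n u) = u := by
  have : ((prj m n).comp (sec m n)).comp (LpMk m n) = LpMk m n := by
    refine FreeAbelianGroup.lift_ext _ _ fun A => ?_
    rw [AddMonoidHom.comp_apply, AddMonoidHom.comp_apply, sec_mk]
    by_cases h : A.deg = n
    · rw [Free.proj_ev_of_pos (p := fun d => d.card = n) (by simpa using h), prj_ev,
        toRTree_ofRTree]
    · rw [Free.proj_ev_of_neg (p := fun d => d.card = n) (by simpa using h), map_zero]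
      exact (LpMk_eq_zero (Or.inl (Or.inl ⟨A, h, rfl⟩))).symm
  obtain ⟨x, rfl⟩ := QuotientAddGroup.mk'_surjective _ u
  exact DFunLike.congr_fun this x

/-- The order `n` part of a formal sum of trees in the group of all unrooted trees. -/
noncomputable def secTFree (m n : ℕ) : FreeAbelianGroup (RTree m × RTree m) →+ TG (Fin m) :=
  (TG.proj fun d => d.card = n + 2).comp
    (FreeAbelianGroup.lift fun p => tr (ofRTree p.1) (ofRTree p.2))

theorem secTFree_of (n : ℕ) (p : RTree m × RTree m) : secTFree m n (FreeAbelianGroup.of p) =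
    TG.proj (fun d => d.card = n + 2) (tr (ofRTree p.1) (ofRTree p.2)) := by
  rw [secTFree, AddMonoidHom.comp_apply, FreeAbelianGroup.lift_apply_of]

theorem secTFree_eq_zero {n : ℕ} {x : FreeAbelianGroup (RTree m × RTree m)}
    (hx : x ∈ treeRels m n) : secTFree m n x = 0 := by
  obtain ((((⟨p, hp, rfl⟩ | ⟨A, B, rfl⟩) | ⟨A, B, C, rfl⟩) | ⟨A, B, C, rfl⟩) |
    ⟨A, B, C, D, rfl⟩) := hx
  · rw [secTFree_of]
    exact TG.proj_tr_of_neg (p := fun d => d.card = n + 2) (by simpa using hp)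
  · simp [secTFree_of, tr_symm (ofRTree A)]
  · simp [secTFree_of, ofRTree, tr_slide]
  · simp [secTFree_of, ofRTree, tr_skew (ofRTree A)]
  · have := congrArg (TG.proj fun d => d.card = n + 2)
      (TG.mk_eq_zero (TRelator.jacobi (ofRTree A) (ofRTree B) (ofRTree C) (ofRTree D)))
    simpa [secTFree_of, ofRTree] using this

/-- The inclusion of the order `n` tree group into the group of all unrooted trees. -/
noncomputable def secT (m n : ℕ) : Tgrp m n →+ TG (Fin m) :=
  QuotientAddGroup.lift _ (secTFree m n) ((AddSubgroup.closure_le _).2 fun _ => secTFree_eq_zero)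

theorem secT_mk (n : ℕ) (p : RTree m × RTree m) : secT m n (TMk m n (FreeAbelianGroup.of p)) =
    TG.proj (fun d => d.card = n + 2) (tr (ofRTree p.1) (ofRTree p.2)) := secTFree_of n p

theorem TMk_eq_zero {n : ℕ} {x : FreeAbelianGroup (RTree m × RTree m)} (hx : x ∈ treeRels m n) :
    TMk m n x = 0 := (QuotientAddGroup.eq_zero_iff _).2 (AddSubgroup.subset_closure hx)

/-- The projection of the group of all unrooted trees onto the order `n` tree group. -/
noncomputable def prjT (m n : ℕ) : TG (Fin m) →+ Tgrp m n :=
  TG.desc (fun A B => TMk m n (FreeAbelianGroup.of (toRTree A, toRTree B))) fun z hz => by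
    cases hz with
    | symm A B =>
      simpa using TMk_eq_zero (n := n)
        (Or.inl (Or.inl (Or.inl (Or.inr ⟨toRTree A, toRTree B, rfl⟩))))
    | slide A B C =>
      simpa using TMk_eq_zero (n := n)
        (Or.inl (Or.inl (Or.inr ⟨toRTree A, toRTree B, toRTree C, rfl⟩)))
    | skew A B C =>
      simpa using TMk_eq_zero (n := n) (Or.inl (Or.inr ⟨toRTree A, toRTree B, toRTree C, rfl⟩))
    | jacobi A B C D =>
      simpa using TMk_eq_zero (n := n)
        (Or.inr ⟨toRTree A, toRTree B, toRTree C, toRTree D, rfl⟩)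

theorem prjT_tr (n : ℕ) (A B : FreeMagma (Fin m)) :
    prjT m n (tr A B) = TMk m n (FreeAbelianGroup.of (toRTree A, toRTree B)) :=
  TG.desc_tr _ _ _ _

theorem secT_prjT (n : ℕ) (t : TG (Fin m)) :
    secT m n (prjT m n t) = TG.proj (fun d => d.card = n + 2) t := by
  have : (secT m n).comp (prjT m n) = TG.proj fun d => d.card = n + 2 := by
    ext A B
    rw [AddMonoidHom.comp_apply, prjT_tr, secT_mk, ofRTree_toRTree, ofRTree_toRTree]
  exact DFunLike.congr_fun this t

theorem prjT_secT (n : ℕ) (t : Tgrp m n) : prjT m n (secT m n t) = t := by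
  have : ((prjT m n).comp (secT m n)).comp (TMk m n) = TMk m n := by
    refine FreeAbelianGroup.lift_ext _ _ fun p => ?_
    rw [AddMonoidHom.comp_apply, AddMonoidHom.comp_apply, secT_mk]
    by_cases h : p.1.deg + p.2.deg = n + 2
    · rw [TG.proj_tr_of_pos (p := fun d => d.card = n + 2) (by simpa using h), prjT_tr,
        toRTree_ofRTree, toRTree_ofRTree]
    · rw [TG.proj_tr_of_neg (p := fun d => d.card = n + 2) (by simpa using h), map_zero]
      exact (TMk_eq_zero (Or.inl (Or.inl (Or.inl (Or.inl ⟨p, h, rfl⟩))))).symm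
  obtain ⟨x, rfl⟩ := QuotientAddGroup.mk'_surjective _ t
  exact DFunLike.congr_fun this x

theorem proj_secT (n : ℕ) (t : Tgrp m n) :
    TG.proj (fun d => d.card = n + 2) (secT m n t) = secT m n t := by
  rw [← secT_prjT, prjT_secT]

/-- The map from finitely supported functions to tensors of degree `n`. -/
noncomputable def toTensor (m n : ℕ) :
    (Fin m →₀ Free (Fin m)) →+ FreeAbelianGroup (Fin m) ⊗[ℤ] Lp m n :=
  Finsupp.liftAddHom fun i =>
    (TensorProduct.mk ℤ _ _ (FreeAbelianGroup.of i)).toAddMonoidHom.comp (prj m n)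

theorem toTensor_single (n : ℕ) (i : Fin m) (r : Free (Fin m)) :
    toTensor m n (Finsupp.single i r) = FreeAbelianGroup.of i ⊗ₜ prj m n r := by
  simp [toTensor]

/-- The map from tensors of degree `n` to finitely supported functions. -/
noncomputable def ofTensor (m n : ℕ) :
    FreeAbelianGroup (Fin m) ⊗[ℤ] Lp m n →ₗ[ℤ] (Fin m →₀ Free (Fin m)) :=
  TensorProduct.lift ((FreeAbelianGroup.lift fun i =>
    ((Finsupp.singleAddHom i).comp (sec m n)).toIntLinearMap).toIntLinearMap)

theorem ofTensor_tmul (n : ℕ) (i : Fin m) (u : Lp m n) :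
    ofTensor m n (FreeAbelianGroup.of i ⊗ₜ u) = Finsupp.single i (sec m n u) := by
  refine (TensorProduct.lift.tmul _ _).trans ?_
  simp

theorem toTensor_ofTensor (n : ℕ) (z : FreeAbelianGroup (Fin m) ⊗[ℤ] Lp m n) :
    toTensor m n (ofTensor m n z) = z := by
  induction z with
  | zero => simp
  | add a b ha hb => rw [map_add, map_add, ha, hb]
  | tmul a u =>
    induction a using FreeAbelianGroup.induction_on with
    | zero => simp
    | of i => rw [ofTensor_tmul, toTensor_single, prj_sec]
    | neg i hi => rw [TensorProduct.neg_tmul, map_neg, map_neg, hi]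
    | add a b ha hb => rw [TensorProduct.add_tmul, map_add, map_add, ha, hb]

theorem ofTensor_toTensor (n : ℕ) (z : Fin m →₀ Free (Fin m)) :
    ofTensor m n (toTensor m n z) = Finsupp.liftAddHom (fun i =>
      (Finsupp.singleAddHom i).comp (Free.proj fun d => d.card = n)) z := by
  induction z using Finsupp.induction_linear with
  | zero => simp
  | add a b ha hb => simp only [map_add, ha, hb]
  | single i r => rw [toTensor_single, ofTensor_tmul, sec_prj]; simp

theorem ofTensor_toTensor_etaU (n : ℕ) (t : TG (Fin m)) :
    ofTensor m (n + 1) (toTensor m (n + 1) (etaU t)) =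
      etaU (TG.proj (fun d => d.card = n + 2) t) := by
  have := eta_proj Finsupp.singleAddHom (fun d : Multiset (Fin m) => d.card = n + 2) t
  have h (k : ℕ) : k + 1 = n + 2 ↔ k = n + 1 := by omega
  simp only [Multiset.card_cons, h] at this
  rw [ofTensor_toTensor, ← eta_eq_etaU, etaU]
  exact this.symm

theorem mu_ofTensor_toTensor (n : ℕ) (z : Fin m →₀ Free (Fin m)) :
    mu (ofTensor m n (toTensor m n z)) = Free.proj (fun d => d.card = n + 1) (mu z) := by
  rw [ofTensor_toTensor]
  induction z using Finsupp.induction_linear with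
  | zero => simp
  | add a b ha hb => simp only [map_add, ha, hb]
  | single i r =>
    rw [mu_single, ← br_proj]
    simp

theorem bracketLp_toTensor (n : ℕ) (z : Fin m →₀ Free (Fin m)) :
    bracketLp m n (toTensor m n z) = prj m (n + 1) (mu z) := by
  induction z using Finsupp.induction_linear with
  | zero => simp
  | add a b ha hb => simp only [map_add, ha, hb]
  | single i r =>
    rw [mu_single, toTensor_single]
    have : (brLeaf m n i).comp (prj m n) = (prj m (n + 1)).comp (br (ev (.of i))) := by
      ext A
      rw [AddMonoidHom.comp_apply, AddMonoidHom.comp_apply, br_ev, prj_ev, prj_ev]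
      refine congrArg (LpMk m (n + 1)) ?_
      simp [brLeafFree, toRTree]
    refine ((TensorProduct.lift.tmul _ _).trans ?_).trans (DFunLike.congr_fun this r)
    simp

/-- The map `η'_n`. -/
noncomputable def etaTensor (m n : ℕ) :
    Tgrp m n →+ FreeAbelianGroup (Fin m) ⊗[ℤ] Lp m (n + 1) :=
  ((toTensor m (n + 1)).comp etaU).comp (secT m n)

theorem toTensor_rho (n : ℕ) (A B : RTree m) :
    toTensor m n (rho (ev (ofRTree A)) (ev (ofRTree B))) =
      ((rerootList A B).map fun v => FreeAbelianGroup.of v.1 ⊗ₜ[ℤ]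
        LpMk m n (FreeAbelianGroup.of v.2)).sum := by
  induction A generalizing B with
  | leaf i => simp [ofRTree, rho_of, toTensor_single, prj_ev, rerootList]
  | node A A' hA hA' =>
    rw [rerootList, List.map_append, List.sum_append, ← hA, ← hA', ofRTree, ofRTree, ofRTree,
      ev_mul, rho_br, br_eq_neg (ev (ofRTree A)), map_neg, sub_neg_eq_add, map_add, br_ev, br_ev]

theorem etaTensor_mk {n : ℕ} (p : RTree m × RTree m) (hp : p.1.deg + p.2.deg = n + 2) :
    etaTensor m n (TMk m n (FreeAbelianGroup.of p)) =
      ((pairReroots p).map fun v => FreeAbelianGroup.of v.1 ⊗ₜ[ℤ]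
        LpMk m (n + 1) (FreeAbelianGroup.of v.2)).sum := by
  rw [etaTensor, AddMonoidHom.comp_apply, AddMonoidHom.comp_apply, secT_mk,
    TG.proj_tr_of_pos (p := fun d => d.card = n + 2) (by simpa using hp), ← form_ev, etaU_form,
    map_add, toTensor_rho, toTensor_rho, pairReroots, List.map_append, List.sum_append]

theorem etaTensor_injective (m n : ℕ) : Function.Injective (etaTensor m n) := by
  refine (injective_iff_map_eq_zero _).2 fun t ht => ?_
  have h := ofTensor_toTensor_etaU n (secT m n t)
  rw [← AddMonoidHom.comp_apply, ← AddMonoidHom.comp_apply] at h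
  change ofTensor m (n + 1) (etaTensor m n t) = _ at h
  rw [ht, map_zero, proj_secT] at h
  rw [← prjT_secT n t, (injective_iff_map_eq_zero _).1 etaU_injective _ h.symm, map_zero]

theorem range_etaTensor (m n : ℕ) : Set.range (etaTensor m n) =
    (LinearMap.ker (bracketLp m (n + 1)) : Set (FreeAbelianGroup (Fin m) ⊗[ℤ] Lp m (n + 1))) := by
  refine Set.Subset.antisymm ?_ fun z hz => ?_
  · rintro _ ⟨t, rfl⟩
    change bracketLp m (n + 1) (toTensor m (n + 1) (etaU (secT m n t))) = 0
    rw [bracketLp_toTensor, mu_etaU, map_zero]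
  · have h1 : bracketLp m (n + 1) z = 0 := hz
    have h2 := bracketLp_toTensor (n + 1) (ofTensor m (n + 1) z)
    have h3 := mu_ofTensor_toTensor (n + 1) (ofTensor m (n + 1) z)
    rw [toTensor_ofTensor] at h2 h3
    rw [← sec_prj, ← h2, h1, map_zero] at h3
    obtain ⟨s, hs⟩ := exists_etaU_eq h3
    refine ⟨prjT m n s, ?_⟩
    change toTensor m (n + 1) (etaU (secT m n (prjT m n s))) = z
    rw [secT_prjT, ← ofTensor_toTensor_etaU, toTensor_ofTensor, hs, toTensor_ofTensor]

end QuasiLie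

/-- Levine Conjecture: For all `m,n ≥ 1`, the homomorphism
`η'_n : 𝒯_n → L'_1 ⊗ L'_{n+1}`, defined on a generator `t` by
`η'_n(t) = Σ_v X_{ℓ(v)} ⊗ T'_v(t)` (sum over all univalent vertices `v` of `t`),
is injective with image exactly `D'_n = Ker(L'_1 ⊗ L'_{n+1} → L'_{n+2})`;
that is, `η'_n` induces an isomorphism `𝒯_n ≅ D'_n`. -/
theorem statement9 (m n : ℕ) (hm : 1 ≤ m) (hn : 1 ≤ n) :
    ∃ η : Tgrp m n →+ (FreeAbelianGroup (Fin m)) ⊗[ℤ] (Lp m (n + 1)),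
      (∀ p : RTree m × RTree m, p.1.deg + p.2.deg = n + 2 →
        η (TMk m n (FreeAbelianGroup.of p)) =
          ((pairReroots p).map fun v =>
            (FreeAbelianGroup.of v.1) ⊗ₜ[ℤ]
              (LpMk m (n + 1) (FreeAbelianGroup.of v.2))).sum) ∧
      Function.Injective η ∧
      Set.range η = (LinearMap.ker (bracketLp m (n + 1)) :
        Set ((FreeAbelianGroup (Fin m)) ⊗[ℤ] (Lp m (n + 1)))) := by
  exact ⟨QuasiLie.etaTensor m n, fun p hp => QuasiLie.etaTensor_mk p hp,
    QuasiLie.etaTensor_injective m n, QuasiLie.range_etaTensor m n⟩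
end
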